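/- Let 2<p≤3, let u be a nonnegative classical solution of u_t−Δu=|∇u|^p in Q_T with u=0 on Γ_T, having an isolated gradient blowup point at (0,0,T) and satisfying the monotonicity condition x·u_x≤0 in Q_T. Then there exist constants C₁,C₂,C₃>0 and ρ∈(0,L) such that for all (x,y)∈([−ρ,ρ]×[0,ρ])∖{(0,0)} the final blowup profile satisfies d_p[y+C₁|x|^{2(p−1)/(p−2)}]^{−β}−C₃ ≤ u_y(x,y,T) ≤ d_p[y+C₂|x|^{2(p−1)/(p−2)}]^{−β}+C₃, where β=1/(p−1) and d_p=β^β. In particular, there exist C₄,C₅>0 such that C₄|x|^{−2/(p−2)} ≤ u_y(x,0,T) ≤ C₅|x|^{−2/(p−2)} for all 0<|x|≤ρ, and there is C>0 with u≤C and |u_x|≤C on ω'. -/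

import Mathlib

open Real Set Filter MeasureTheory

noncomputable section

/-- Partial derivative of `u(x,y,t)` with respect to `x`. -/
def pdx (u : ℝ → ℝ → ℝ → ℝ) (x y t : ℝ) : ℝ := deriv (fun s => u s y t) x

/-- Partial derivative with respect to `y`. -/
def pdy (u : ℝ → ℝ → ℝ → ℝ) (x y t : ℝ) : ℝ := deriv (fun s => u x s t) y

/-- Partial derivative with respect to `t`. -/
def pdt (u : ℝ → ℝ → ℝ → ℝ) (x y t : ℝ) : ℝ := deriv (fun s => u x y s) t

/-- Second partial derivative with respect to `x`. -/
def pdxx (u : ℝ → ℝ → ℝ → ℝ) (x y t : ℝ) : ℝ := deriv (fun s => pdx u s y t) x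

/-- Second partial derivative with respect to `y`. -/
def pdyy (u : ℝ → ℝ → ℝ → ℝ) (x y t : ℝ) : ℝ := deriv (fun s => pdy u x s t) y

/-- Mixed second partial derivative `u_{xy}` (first `x`, then `y`). -/
def pdxy (u : ℝ → ℝ → ℝ → ℝ) (x y t : ℝ) : ℝ := deriv (fun s => pdx u x s t) y

/-- The norm of the spatial gradient, `|∇u| = (u_x² + u_y²)^{1/2}`. -/
def gradNorm (u : ℝ → ℝ → ℝ → ℝ) (x y t : ℝ) : ℝ :=
  Real.sqrt ((pdx u x y t) ^ 2 + (pdy u x y t) ^ 2)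

/-- `C^{2,1}`-type regularity of `u` at the point `(x,y,t)`: twice (continuously)
differentiable in the space variables and once in time. -/
def C21At (u : ℝ → ℝ → ℝ → ℝ) (x y t : ℝ) : Prop :=
  DifferentiableAt ℝ (fun s => u s y t) x ∧
  DifferentiableAt ℝ (fun s => u x s t) y ∧
  DifferentiableAt ℝ (fun s => u x y s) t ∧
  DifferentiableAt ℝ (fun s => pdx u s y t) x ∧
  DifferentiableAt ℝ (fun s => pdy u x s t) y ∧
  DifferentiableAt ℝ (fun s => pdx u x s t) y ∧
  ContinuousAt (fun q : ℝ × ℝ × ℝ => u q.1 q.2.1 q.2.2) (x, y, t) ∧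
  ContinuousAt (fun q : ℝ × ℝ × ℝ => pdx u q.1 q.2.1 q.2.2) (x, y, t) ∧
  ContinuousAt (fun q : ℝ × ℝ × ℝ => pdy u q.1 q.2.1 q.2.2) (x, y, t) ∧
  ContinuousAt (fun q : ℝ × ℝ × ℝ => pdt u q.1 q.2.1 q.2.2) (x, y, t) ∧
  ContinuousAt (fun q : ℝ × ℝ × ℝ => pdxx u q.1 q.2.1 q.2.2) (x, y, t) ∧
  ContinuousAt (fun q : ℝ × ℝ × ℝ => pdyy u q.1 q.2.1 q.2.2) (x, y, t) ∧
  ContinuousAt (fun q : ℝ × ℝ × ℝ => pdxy u q.1 q.2.1 q.2.2) (x, y, t)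

/-- `u` is a nonnegative classical solution of `u_t - Δu = |∇u|^p` in
`Q_T = ω × (0,T)`, `ω = (-L,L) × (0,L)`, with `u = 0` on `Γ_T = (-L,L) × {0} × (0,T)`. -/
structure ClassicalSolution (p L T : ℝ) (u : ℝ → ℝ → ℝ → ℝ) : Prop where
  nonneg : ∀ ⦃x y t : ℝ⦄, |x| ≤ L → y ∈ Icc (0:ℝ) L → t ∈ Ioo 0 T → 0 ≤ u x y t
  smooth : ∀ ⦃x y t : ℝ⦄, |x| ≤ L → y ∈ Icc (0:ℝ) L → t ∈ Ioo 0 T → C21At u x y t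
  pde : ∀ ⦃x y t : ℝ⦄, |x| < L → y ∈ Ioo (0:ℝ) L → t ∈ Ioo 0 T →
    pdt u x y t - (pdxx u x y t + pdyy u x y t) = gradNorm u x y t ^ p
  bc : ∀ ⦃x t : ℝ⦄, |x| < L → t ∈ Ioo 0 T → u x 0 t = 0

/-- `u` has an isolated gradient blow-up point at `(0,0,T)`:
`limsup |∇u| = ∞` at `(0,0,T)` while `∇u` stays bounded on `K × (0,T)` for every
compact `K ⊆ ω̄ \ {(0,0)}`. -/
structure IsolatedGBU (L T : ℝ) (u : ℝ → ℝ → ℝ → ℝ) : Prop where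
  blowup : ∀ M : ℝ, ∀ δ > (0:ℝ), ∃ x y t : ℝ, |x| ≤ L ∧ y ∈ Icc (0:ℝ) L ∧
    t ∈ Ioo 0 T ∧ |x| < δ ∧ |y| < δ ∧ T - δ < t ∧ M < gradNorm u x y t
  bounded : ∀ K : Set (ℝ × ℝ), IsCompact K →
    K ⊆ (Icc (-L) L ×ˢ Icc (0:ℝ) L) \ {((0:ℝ), (0:ℝ))} →
    ∃ M : ℝ, ∀ q ∈ K, ∀ t ∈ Ioo (0:ℝ) T, gradNorm u q.1 q.2 t ≤ M

/-- `u` extends as a `C^{2,1}` function to `(ω̄' × [T/2,T]) \ {(0,0,T)}`,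
`ω' = (-L/2,L/2) × (0,L/2)`; values and derivatives at `t = T` refer to this extension. -/
def ExtC21 (L T : ℝ) (u : ℝ → ℝ → ℝ → ℝ) : Prop :=
  ∀ ⦃x y t : ℝ⦄, |x| ≤ L / 2 → y ∈ Icc (0:ℝ) (L / 2) → t ∈ Icc (T / 2) T →
    ¬(x = 0 ∧ y = 0 ∧ t = T) → C21At u x y t

/-- The monotonicity condition `x·u_x ≤ 0` in `Q_T`. -/
def MonCond (L T : ℝ) (u : ℝ → ℝ → ℝ → ℝ) : Prop :=
  ∀ ⦃x y t : ℝ⦄, |x| < L → y ∈ Ioo (0:ℝ) L → t ∈ Ioo 0 T → x * pdx u x y t ≤ 0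

set_option linter.all false


/-! basic calculus -/
lemma snd_deriv_min {f f' : ℝ → ℝ} {a b x0 f'' : ℝ} (ha : a < x0) (hb : x0 < b)
    (h1 : ∀ x ∈ Ioo a b, HasDerivAt f (f' x) x) (h2 : HasDerivAt f' f'' x0)
    (hmin : ∀ x ∈ Ioo a b, f x0 ≤ f x) : f' x0 = 0 ∧ 0 ≤ f'' := by
  have hnh : Ioo a b ∈ nhds x0 := Ioo_mem_nhds ha hb
  have hloc : IsLocalMin f x0 := by
    filter_upwards [hnh] with x hx using hmin x hx
  have h0 : f' x0 = 0 := hloc.hasDerivAt_eq_zero (h1 x0 ⟨ha, hb⟩)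
  refine ⟨h0, ?_⟩
  by_contra hneg
  push Not at hneg
  -- f' < 0 on right nbhd
  have hev : ∀ᶠ x in nhdsWithin x0 (Ioi x0), f' x < 0 := by
    have hs := (hasDerivAt_iff_tendsto_slope.mp h2)
    have hs' : Tendsto (slope f' x0) (nhdsWithin x0 (Ioi x0)) (nhds f'') :=
      hs.mono_left (nhdsWithin_mono _ (fun x hx => ne_of_gt hx))
    have := hs'.eventually (gt_mem_nhds hneg)
    filter_upwards [this, self_mem_nhdsWithin] with x hx hx0
    have hx0' : 0 < x - x0 := sub_pos.mpr hx0
    rw [slope_def_field, h0, sub_zero] at hx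
    by_contra hc
    push Not at hc
    have := div_nonneg hc hx0'.le
    linarith
  obtain ⟨c, hc, hcs⟩ := (mem_nhdsGT_iff_exists_Ioo_subset).mp hev
  have hc' : x0 < c := hc
  set d := min ((x0 + c)/2) ((x0+b)/2) with hd
  have hd1 : x0 < d := lt_min (by linarith) (by linarith)
  have hd2 : d < c := lt_of_le_of_lt (min_le_left _ _) (by linarith)
  have hd3 : d < b := lt_of_le_of_lt (min_le_right _ _) (by linarith)
  have hsa : StrictAntiOn f (Icc x0 d) := by
    apply strictAntiOn_of_deriv_neg (convex_Icc _ _)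
    · intro x hx
      exact (h1 x ⟨by linarith [hx.1], by linarith [hx.2]⟩).continuousAt.continuousWithinAt
    · intro x hx
      rw [interior_Icc] at hx
      rw [(h1 x ⟨by linarith [hx.1], by linarith [hx.2]⟩).deriv]
      exact hcs ⟨hx.1, by linarith [hx.2]⟩
  have := hsa (left_mem_Icc.mpr hd1.le) (right_mem_Icc.mpr hd1.le) hd1
  have := hmin d ⟨by linarith, hd3⟩
  linarith

lemma left_deriv_min {f : ℝ → ℝ} {a t0 f' : ℝ} (ha : a < t0)
    (h1 : HasDerivAt f f' t0) (hmin : ∀ t ∈ Ioo a t0, f t0 ≤ f t) : f' ≤ 0 := by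
  have hs := (hasDerivAt_iff_tendsto_slope.mp h1)
  have hs' : Tendsto (slope f t0) (nhdsWithin t0 (Iio t0)) (nhds f') :=
    hs.mono_left (nhdsWithin_mono _ (fun x hx => ne_of_lt hx))
  refine le_of_tendsto hs' ?_
  have : Ioo a t0 ∈ nhdsWithin t0 (Iio t0) := Ioo_mem_nhdsLT ha
  filter_upwards [this] with t ht
  rw [slope_def_field]
  exact div_nonpos_of_nonneg_of_nonpos (by linarith [hmin t ht]) (by linarith [ht.2])

/-- convexity of `|P|^p`, tangent inequality. -/
lemma F_convex {p : ℝ} (hp : 2 < p) (a b c d : ℝ) :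
    (a^2+b^2)^(p/2) + p * (a^2+b^2)^(p/2-1) * (a*(c-a)+b*(d-b)) ≤ (c^2+d^2)^(p/2) := by
  set A := Real.sqrt (a^2+b^2) with hA
  set B := Real.sqrt (c^2+d^2) with hB
  have hA0 : 0 ≤ A := Real.sqrt_nonneg _
  have hB0 : 0 ≤ B := Real.sqrt_nonneg _
  have hA2 : a^2+b^2 = A^2 := (Real.sq_sqrt (by positivity)).symm
  have hB2 : c^2+d^2 = B^2 := (Real.sq_sqrt (by positivity)).symm
  have e1 : (a^2+b^2)^(p/2) = A^p := by
    rw [hA2, ← Real.rpow_natCast, ← Real.rpow_mul hA0]; congr 1; push_cast; ring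
  have e2 : (c^2+d^2)^(p/2) = B^p := by
    rw [hB2, ← Real.rpow_natCast, ← Real.rpow_mul hB0]; congr 1; push_cast; ring
  have e3 : (a^2+b^2)^(p/2-1) = A^(p-2) := by
    rw [hA2, ← Real.rpow_natCast, ← Real.rpow_mul hA0]; congr 1; push_cast; ring
  rw [e1, e2, e3]
  have hcs : a*c+b*d ≤ A*B := by
    have : (a*c+b*d)^2 ≤ (A*B)^2 := by
      rw [mul_pow, ← hA2, ← hB2]; nlinarith [sq_nonneg (a*d-b*c)]
    exact abs_le_of_sq_le_sq' this (by positivity) |>.2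
  have h1 : a*(c-a)+b*(d-b) ≤ A*B - A^2 := by rw [← hA2]; nlinarith
  have h2 : p * A^(p-2) * (a*(c-a)+b*(d-b)) ≤ p * A^(p-2) * (A*B-A^2) :=
    mul_le_mul_of_nonneg_left h1 (by positivity)
  rcases eq_or_lt_of_le hA0 with h0 | h0
  · rw [← h0, Real.zero_rpow (by linarith)] at *
    simp only [Real.zero_rpow (show p - 2 ≠ 0 by linarith)] at *
    have : 0 ≤ B^p := by positivity
    linarith
  have h3 : A^(p-2) * (A*B-A^2) = A^(p-1) * B - A^p := by
    have : A^(p-1) = A^(p-2)*A := by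
      rw [← Real.rpow_add_one h0.ne']; congr 1; ring
    have h' : A^p = A^(p-2)*A^2 := by
      rw [← Real.rpow_natCast A 2, ← Real.rpow_add h0]; congr 1; push_cast; ring
    rw [this, h']; ring
  have young : A^(p-1) * B ≤ (A^(p-1))^(p/(p-1)) / (p/(p-1)) + B^p/p :=
    Real.young_inequality_of_nonneg (by positivity) hB0
      (by
        rw [Real.holderConjugate_iff]
        constructor
        · rw [lt_div_iff₀ (by linarith)]; linarith
        · field_simp; ring)
  have e4 : (A^(p-1))^(p/(p-1)) = A^p := by
    rw [← Real.rpow_mul hA0]; congr 1; field_simp [show p - 1 ≠ 0 by linarith]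
  rw [e4] at young
  have hpp : 0 < p := by linarith
  have : p * (A^(p-1)*B) ≤ (p-1)*A^p + B^p := by
    have := mul_le_mul_of_nonneg_left young hpp.le
    have e5 : p * (A^p/(p/(p-1)) + B^p/p) = (p-1)*A^p + B^p := by
      field_simp
    linarith
  nlinarith

lemma F_midconvex {p : ℝ} (hp : 2 < p) (a b c d e f : ℝ) (h1 : a + c = 2 * e) (h2 : b + d = 2*f) :
    2 * (e^2+f^2)^(p/2) ≤ (a^2+b^2)^(p/2) + (c^2+d^2)^(p/2) := by
  have A := F_convex hp e f a b
  have B := F_convex hp e f c d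
  have : e*(a-e)+f*(b-f) + (e*(c-e)+f*(d-f)) = 0 := by
    rw [show a = 2*e - c by linarith, show b = 2*f-d by linarith]; ring
  have := congrArg (fun z => p * (e^2+f^2)^(p/2-1) * z) this
  simp only [mul_add, mul_zero] at this
  linarith


/-- derivative package at a point -/
def DerPk (D Dx Dy Dt Dxx Dyy : ℝ → ℝ → ℝ → ℝ) (x y t : ℝ) : Prop :=
  HasDerivAt (fun s => D s y t) (Dx x y t) x ∧ HasDerivAt (fun s => D x s t) (Dy x y t) y ∧
  HasDerivAt (fun s => D x y s) (Dt x y t) t ∧ HasDerivAt (fun s => Dx s y t) (Dxx x y t) x ∧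
  HasDerivAt (fun s => Dy x s t) (Dyy x y t) y

lemma box_min {D Dx Dy Dt Dxx Dyy : ℝ → ℝ → ℝ → ℝ} {a b c d t1 t2 x0 y0 t0 : ℝ}
    (hd : ∀ x ∈ Ioo a b, ∀ y ∈ Ioo c d, ∀ t ∈ Ioc t1 t2, DerPk D Dx Dy Dt Dxx Dyy x y t)
    (hx : x0 ∈ Ioo a b) (hy : y0 ∈ Ioo c d) (ht : t0 ∈ Ioc t1 t2)
    (hmin : ∀ x ∈ Icc a b, ∀ y ∈ Icc c d, ∀ t ∈ Icc t1 t2, D x0 y0 t0 ≤ D x y t) :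
    Dx x0 y0 t0 = 0 ∧ Dy x0 y0 t0 = 0 ∧ 0 ≤ Dxx x0 y0 t0 ∧ 0 ≤ Dyy x0 y0 t0 ∧
      Dt x0 y0 t0 ≤ 0 := by
  have h0 := hd x0 hx y0 hy t0 ht
  have hx' := Ioo_subset_Icc_self hx
  have hy' := Ioo_subset_Icc_self hy
  have ht' := Ioc_subset_Icc_self ht
  have A := snd_deriv_min (f := fun s => D s y0 t0) (f' := fun s => Dx s y0 t0) hx.1 hx.2
    (fun x hxx => (hd x hxx y0 hy t0 ht).1) h0.2.2.2.1
    (fun x hxx => hmin x (Ioo_subset_Icc_self hxx) y0 hy' t0 ht')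
  have B := snd_deriv_min (f := fun s => D x0 s t0) (f' := fun s => Dy x0 s t0) hy.1 hy.2
    (fun y hyy => (hd x0 hx y hyy t0 ht).2.1) h0.2.2.2.2
    (fun y hyy => hmin x0 hx' y (Ioo_subset_Icc_self hyy) t0 ht')
  have C := left_deriv_min (f := fun s => D x0 y0 s) ht.1 h0.2.2.1
    (fun t htt => hmin x0 hx' y0 hy' t ⟨htt.1.le, htt.2.le.trans ht.2⟩)
  exact ⟨A.1, B.1, A.2, B.2, C⟩

lemma box_exists_min {D : ℝ → ℝ → ℝ → ℝ} {a b c d t1 t2 : ℝ} (hab : a ≤ b) (hcd : c ≤ d)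
    (htt : t1 ≤ t2)
    (hcont : ContinuousOn (fun q : ℝ × ℝ × ℝ => D q.1 q.2.1 q.2.2)
      (Icc a b ×ˢ Icc c d ×ˢ Icc t1 t2)) :
    ∃ x0 ∈ Icc a b, ∃ y0 ∈ Icc c d, ∃ t0 ∈ Icc t1 t2,
      ∀ x ∈ Icc a b, ∀ y ∈ Icc c d, ∀ t ∈ Icc t1 t2, D x0 y0 t0 ≤ D x y t := by
  have hK : IsCompact (Icc a b ×ˢ Icc c d ×ˢ Icc t1 t2) :=
    isCompact_Icc.prod (isCompact_Icc.prod isCompact_Icc)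
  obtain ⟨q, hq, hm⟩ := hK.exists_isMinOn
    ⟨(a, c, t1), ⟨left_mem_Icc.mpr hab, left_mem_Icc.mpr hcd, left_mem_Icc.mpr htt⟩⟩ hcont
  refine ⟨q.1, hq.1, q.2.1, hq.2.1, q.2.2, hq.2.2, ?_⟩
  intro x hx y hy t ht
  exact hm (show (x, y, t) ∈ _ from ⟨hx, hy, ht⟩)

lemma box_mp {D Dx Dy Dt Dxx Dyy : ℝ → ℝ → ℝ → ℝ} {a b c d t1 t2 m : ℝ}
    (hcont : ContinuousOn (fun q : ℝ × ℝ × ℝ => D q.1 q.2.1 q.2.2)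
      (Icc a b ×ˢ Icc c d ×ˢ Icc t1 t2))
    (hd : ∀ x ∈ Ioo a b, ∀ y ∈ Ioo c d, ∀ t ∈ Ioc t1 t2, DerPk D Dx Dy Dt Dxx Dyy x y t)
    (hin : ∀ x ∈ Ioo a b, ∀ y ∈ Ioo c d, ∀ t ∈ Ioc t1 t2, Dx x y t = 0 → Dy x y t = 0 →
      Dxx x y t + Dyy x y t ≤ Dt x y t)
    (hb : ∀ x ∈ Icc a b, ∀ y ∈ Icc c d, ∀ t ∈ Icc t1 t2,
      (x = a ∨ x = b ∨ y = c ∨ y = d ∨ t = t1) → m ≤ D x y t) :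
    ∀ x ∈ Icc a b, ∀ y ∈ Icc c d, ∀ t ∈ Icc t1 t2, m ≤ D x y t := by
  intro x hx y hy t ht
  have key : ∀ μ > 0, m ≤ D x y t + μ * (t - t1) := by
    intro μ hμ
    obtain ⟨x0, hx0, y0, hy0, t0, ht0, hmin⟩ := box_exists_min
      (D := fun x y t => D x y t + μ * (t - t1)) (hx.1.trans hx.2) (hy.1.trans hy.2)
      (ht.1.trans ht.2) (by
        apply hcont.add
        fun_prop)
    have h1 := hmin x hx y hy t ht
    by_cases hpb : x0 = a ∨ x0 = b ∨ y0 = c ∨ y0 = d ∨ t0 = t1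
    · have := hb x0 hx0 y0 hy0 t0 ht0 hpb
      have h2 : 0 ≤ μ * (t0 - t1) := mul_nonneg hμ.le (by linarith [ht0.1])
      linarith
    · exfalso
      push Not at hpb
      obtain ⟨n1, n2, n3, n4, n5⟩ := hpb
      have hx0' : x0 ∈ Ioo a b := ⟨lt_of_le_of_ne hx0.1 (Ne.symm n1), lt_of_le_of_ne hx0.2 n2⟩
      have hy0' : y0 ∈ Ioo c d := ⟨lt_of_le_of_ne hy0.1 (Ne.symm n3), lt_of_le_of_ne hy0.2 n4⟩
      have ht0' : t0 ∈ Ioc t1 t2 := ⟨lt_of_le_of_ne ht0.1 (Ne.symm n5), ht0.2⟩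
      obtain ⟨r1, r2, r3, r4, r5⟩ := box_min (D := fun x y t => D x y t + μ * (t - t1))
        (Dx := Dx) (Dy := Dy) (Dt := fun x y t => Dt x y t + μ) (Dxx := Dxx) (Dyy := Dyy)
        (by
          intro x hx y hy t ht
          obtain ⟨e1, e2, e3, e4, e5⟩ := hd x hx y hy t ht
          refine ⟨e1.add_const _, e2.add_const _, ?_, e4, e5⟩
          have := ((hasDerivAt_id t).sub_const t1).const_mul μ
          exact (e3.fun_add this).congr_deriv (by ring)) hx0' hy0' ht0' hmin
      have := hin x0 hx0' y0 hy0' t0 ht0' r1 r2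
      linarith
  have hlim : Tendsto (fun μ : ℝ => D x y t + μ * (t - t1)) (nhdsWithin 0 (Ioi 0))
      (nhds (D x y t + 0 * (t - t1))) := by
    apply Tendsto.mono_left _ nhdsWithin_le_nhds
    exact (Continuous.tendsto (by fun_prop) 0)
  rw [zero_mul, add_zero] at hlim
  exact ge_of_tendsto hlim (by filter_upwards [self_mem_nhdsWithin] with μ hμ using key μ hμ)

/-- space-time domain without the singular point -/
def dom (R T1 T x y t : ℝ) : Prop :=
  |x| ≤ 2*R ∧ 0 ≤ y ∧ y ≤ 2*R ∧ T1 ≤ t ∧ t ≤ T ∧ ¬(x = 0 ∧ y = 0 ∧ t = T)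

structure Dat (p R T1 T : ℝ) (u ux uy ut uxx uyy : ℝ → ℝ → ℝ → ℝ) : Prop where
  hp : 2 < p
  hp3 : p ≤ 3
  hR : 0 < R
  hT : T1 < T
  der : ∀ ⦃x y t⦄, dom R T1 T x y t → DerPk u ux uy ut uxx uyy x y t
  cu : ∀ ⦃x y t⦄, dom R T1 T x y t →
    ContinuousAt (fun q : ℝ × ℝ × ℝ => u q.1 q.2.1 q.2.2) (x, y, t)
  cux : ∀ ⦃x y t⦄, dom R T1 T x y t →
    ContinuousAt (fun q : ℝ × ℝ × ℝ => ux q.1 q.2.1 q.2.2) (x, y, t)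
  cuy : ∀ ⦃x y t⦄, dom R T1 T x y t →
    ContinuousAt (fun q : ℝ × ℝ × ℝ => uy q.1 q.2.1 q.2.2) (x, y, t)
  cut : ∀ ⦃x y t⦄, dom R T1 T x y t →
    ContinuousAt (fun q : ℝ × ℝ × ℝ => ut q.1 q.2.1 q.2.2) (x, y, t)
  cuxx : ∀ ⦃x y t⦄, dom R T1 T x y t →
    ContinuousAt (fun q : ℝ × ℝ × ℝ => uxx q.1 q.2.1 q.2.2) (x, y, t)
  cuyy : ∀ ⦃x y t⦄, dom R T1 T x y t →
    ContinuousAt (fun q : ℝ × ℝ × ℝ => uyy q.1 q.2.1 q.2.2) (x, y, t)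
  pde : ∀ ⦃x y t⦄, dom R T1 T x y t → 0 < y → t < T →
    ut x y t - (uxx x y t + uyy x y t) = ((ux x y t)^2 + (uy x y t)^2)^(p/2)
  bc : ∀ ⦃x t⦄, |x| ≤ 2*R → T1 ≤ t → t < T → u x 0 t = 0
  nn : ∀ ⦃x y t⦄, dom R T1 T x y t → t < T → 0 ≤ u x y t
  mon : ∀ ⦃x y t⦄, dom R T1 T x y t → 0 < y → t < T → x * ux x y t ≤ 0
  blow : ∀ M : ℝ, ∀ δ > (0:ℝ), ∃ x y t : ℝ, dom R T1 T x y t ∧ |x| < δ ∧ y < δ ∧ T - δ < t ∧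
    t < T ∧ M < (ux x y t)^2 + (uy x y t)^2

/-- boundedness of continuous functions away from the singular point -/
lemma bdd_away {R T1 T r T' : ℝ} (hr : 0 < r) (hT' : T' < T)
    {f : ℝ → ℝ → ℝ → ℝ}
    (hc : ∀ ⦃x y t⦄, dom R T1 T x y t →
      ContinuousAt (fun q : ℝ × ℝ × ℝ => f q.1 q.2.1 q.2.2) (x, y, t)) :
    ∃ M > 0, ∀ x y t, |x| ≤ 2*R → 0 ≤ y → y ≤ 2*R → T1 ≤ t → t ≤ T →
      (r ≤ |x| ∨ r ≤ y ∨ t ≤ T') → |f x y t| ≤ M := by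
  set S : Set (ℝ × ℝ × ℝ) := (Icc (-(2*R)) (2*R) ×ˢ Icc 0 (2*R) ×ˢ Icc T1 T) ∩
    {q | r ≤ |q.1| ∨ r ≤ q.2.1 ∨ q.2.2 ≤ T'} with hS
  have hcl : IsClosed {q : ℝ × ℝ × ℝ | r ≤ |q.1| ∨ r ≤ q.2.1 ∨ q.2.2 ≤ T'} := by
    refine IsClosed.union ?_ (IsClosed.union ?_ ?_)
    · exact isClosed_le (f := fun _ : ℝ × ℝ × ℝ => r) (g := fun q => |q.1|) (by fun_prop) (by fun_prop)
    · exact isClosed_le (f := fun _ : ℝ × ℝ × ℝ => r) (g := fun q => q.2.1) (by fun_prop) (by fun_prop)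
    · exact isClosed_le (f := fun q : ℝ × ℝ × ℝ => q.2.2) (g := fun _ => T') (by fun_prop) (by fun_prop)
  have hK : IsCompact S :=
    (isCompact_Icc.prod (isCompact_Icc.prod isCompact_Icc)).inter_right hcl
  have hf : ContinuousOn (fun q : ℝ × ℝ × ℝ => f q.1 q.2.1 q.2.2) S := by
    rintro ⟨x, y, t⟩ ⟨⟨h1, h2, h3⟩, h4⟩
    simp only [Set.mem_ofPred_eq] at *
    refine (hc (x := x) (y := y) (t := t)
      ⟨abs_le.mpr h1, h2.1, h2.2, h3.1, h3.2, ?_⟩).continuousWithinAt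
    rintro ⟨rfl, rfl, rfl⟩
    rcases h4 with h4 | h4 | h4
    · simp at h4; linarith
    · linarith
    · linarith
  obtain ⟨M, hM⟩ := hK.exists_bound_of_continuousOn hf
  refine ⟨max M 1, by positivity, ?_⟩
  intro x y t h1 h2 h3 h4 h5 h6
  exact (hM (x, y, t) ⟨⟨abs_le.mp h1, ⟨h2, h3⟩, ⟨h4, h5⟩⟩, h6⟩).trans (le_max_left _ _)


section
variable {p R T1 T : ℝ} {u ux uy ut uxx uyy : ℝ → ℝ → ℝ → ℝ}

lemma right_deriv_ge {f : ℝ → ℝ} {t f' c h0 : ℝ} (h : HasDerivAt f f' t) (hh : 0 < h0)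
    (hc : ∀ s, 0 < s → s < h0 → c * s ≤ f (t + s) - f t) : c ≤ f' := by
  have hs := (hasDerivAt_iff_tendsto_slope.mp h)
  have hs' : Tendsto (slope f t) (nhdsWithin t (Ioi t)) (nhds f') :=
    hs.mono_left (nhdsWithin_mono _ (fun x hx => ne_of_gt hx))
  refine ge_of_tendsto hs' ?_
  have : Ioo t (t+h0) ∈ nhdsWithin t (Ioi t) := Ioo_mem_nhdsGT (by linarith)
  filter_upwards [this] with s hs
  rw [slope_def_field, le_div_iff₀ (by linarith [hs.1])]
  have := hc (s - t) (by linarith [hs.1]) (by linarith [hs.2])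
  rwa [add_sub_cancel] at this

lemma sym_diff_ge {f f' f'' : ℝ → ℝ} {x h K : ℝ} (hh : 0 ≤ h)
    (h1 : ∀ s ∈ Icc (x-h) (x+h), HasDerivAt f (f' s) s)
    (h2 : ∀ s ∈ Icc (x-h) (x+h), HasDerivAt f' (f'' s) s)
    (h3 : ∀ s ∈ Icc (x-h) (x+h), -K ≤ f'' s) :
    -K * h^2 ≤ f (x+h) + f (x-h) - 2 * f x := by
  have hcv : ConvexOn ℝ (Icc (x-h) (x+h)) (fun s => f s + K/2 * s^2) := by
    apply convexOn_of_hasDerivWithinAt2_nonneg (convex_Icc _ _)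
      (f' := fun s => f' s + K * s) (f'' := fun s => f'' s + K)
    · intro s hs
      exact ((h1 s hs).continuousAt.add (by fun_prop)).continuousWithinAt
    · intro s hs
      have hs' := interior_subset hs
      have : HasDerivAt (fun s : ℝ => K/2*s^2) (K * s) s := by
        have := (hasDerivAt_pow 2 s).const_mul (K/2)
        exact this.congr_deriv (by push_cast; ring)
      exact ((h1 s hs').fun_add this).hasDerivWithinAt
    · intro s hs
      have hs' := interior_subset hs
      have : HasDerivAt (fun s : ℝ => K*s) (K) s := by
        exact ((hasDerivAt_id s).const_mul K).congr_deriv (by ring)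
      exact ((h2 s hs').fun_add this).hasDerivWithinAt
    · intro s hs
      have := h3 s (interior_subset hs)
      linarith
  have := hcv.2 (show x-h ∈ Icc (x-h) (x+h) from ⟨le_refl _, by linarith⟩)
    (show x+h ∈ Icc (x-h) (x+h) from ⟨by linarith, le_refl _⟩)
    (show (0:ℝ) ≤ 1/2 by norm_num) (show (0:ℝ) ≤ 1/2 by norm_num) (by norm_num)
  simp only [smul_eq_mul] at this
  rw [show 1/2*(x-h)+1/2*(x+h) = x by ring] at this
  nlinarith

lemma sym_diff_deriv {f f' : ℝ → ℝ} {x h0 K f'' : ℝ} (hh : 0 < h0)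
    (h1 : ∀ s ∈ Ioo (x-h0) (x+h0), HasDerivAt f (f' s) s)
    (h2 : HasDerivAt f' f'' x)
    (h3 : ∀ h, 0 < h → h < h0 → -K * h^2 ≤ f (x+h) + f (x-h) - 2 * f x) : -K ≤ f'' := by
  have h := snd_deriv_min (f := fun s => f (x+s) + f (x-s) + K*s^2)
    (f' := fun s => f' (x+s) - f' (x-s) + 2*K*s) (a := -h0) (b := h0) (x0 := 0)
    (f'' := f'' + f'' + 2*K) (by linarith) hh ?_ ?_ ?_
  · linarith [h.2]
  · intro s hs
    have e1 : HasDerivAt (fun s => f (x+s)) (f' (x+s)) s :=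
      HasDerivAt.comp_const_add x s (h1 (x+s) ⟨by linarith [hs.1], by linarith [hs.2]⟩)
    have e2 : HasDerivAt (fun s => f (x-s)) (-f' (x-s)) s :=
      HasDerivAt.comp_const_sub x s (h1 (x-s) ⟨by linarith [hs.2], by linarith [hs.1]⟩)
    have e3 : HasDerivAt (fun s : ℝ => K*s^2) (2*K*s) s :=
      ((hasDerivAt_pow 2 s).const_mul K).congr_deriv (by push_cast; ring)
    exact ((e1.fun_add e2).fun_add e3).congr_deriv (by ring)
  · have e1 : HasDerivAt (fun s => f' (x+s)) f'' 0 :=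
      HasDerivAt.comp_const_add x 0 (by simpa using h2)
    have e2 : HasDerivAt (fun s => f' (x-s)) (-f'') 0 :=
      HasDerivAt.comp_const_sub x 0 (by simpa using h2)
    have e3 : HasDerivAt (fun s : ℝ => 2*K*s) (2*K) 0 :=
      ((hasDerivAt_id (0:ℝ)).const_mul (2*K)).congr_deriv (by ring)
    exact ((e1.fun_sub e2).fun_add e3).congr_deriv (by ring)
  · intro s hs
    simp only [add_zero, sub_zero]
    rcases lt_trichotomy s 0 with h | h | h
    · have := h3 (-s) (by linarith) (by linarith [hs.1])
      rw [show x + -s = x - s by ring, show x - -s = x + s by ring] at this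
      nlinarith
    · subst h; simp
    · have := h3 s h hs.2
      nlinarith

lemma dom_lt {x y t : ℝ} (hx : |x| ≤ 2*R) (h0 : 0 ≤ y) (hy : y ≤ 2*R) (h1 : T1 ≤ t) (ht : t < T) :
    dom R T1 T x y t := ⟨hx, h0, hy, h1, ht.le, by rintro ⟨-, -, rfl⟩; exact lt_irrefl _ ht⟩

lemma tdiff (H : Dat p R T1 T u ux uy ut uxx uyy) {σ M h t2 : ℝ}
    (hσ : σ = 1 ∨ σ = -1) (hh : 0 < h) (hh' : h ≤ (T - T1)/2)
    (ht2 : t2 + h < T)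
    (hM : ∀ x y t, |x| ≤ 2*R → 0 ≤ y → y ≤ 2*R → T1 ≤ t → t ≤ T →
      (R/2 ≤ |x| ∨ R/2 ≤ y ∨ t ≤ (T1+T)/2) → |ut x y t| ≤ M) :
    ∀ x ∈ Icc (-R) R, ∀ y ∈ Icc 0 R, ∀ t ∈ Icc T1 t2,
      -M * h ≤ σ * (u x y (t+h) - u x y t) := by
  have hR := H.hR
  have hσ0 : σ ≠ 0 := by rcases hσ with h | h <;> rw [h] <;> norm_num
  have hdom : ∀ x ∈ Icc (-R) R, ∀ y ∈ Icc 0 R, ∀ t, T1 ≤ t → t < T → dom R T1 T x y t := by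
    intro x hx y hy t h1 h2
    exact dom_lt (by rw [abs_le]; constructor <;> linarith [hx.1, hx.2]) hy.1
      (by linarith [hy.2]) h1 h2
  apply box_mp (Dx := fun x y t => σ * (ux x y (t+h) - ux x y t))
    (Dy := fun x y t => σ * (uy x y (t+h) - uy x y t))
    (Dt := fun x y t => σ * (ut x y (t+h) - ut x y t))
    (Dxx := fun x y t => σ * (uxx x y (t+h) - uxx x y t))
    (Dyy := fun x y t => σ * (uyy x y (t+h) - uyy x y t))
  · rintro ⟨x, y, t⟩ ⟨hx, hy, ht⟩
    simp only at hx hy ht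
    apply ContinuousAt.continuousWithinAt
    have c1 := H.cu (hdom x hx y hy t ht.1 (by linarith [ht.2]))
    have c2 := H.cu (hdom x hx y hy (t+h) (by linarith [ht.1]) (by linarith [ht.2]))
    have c3 : ContinuousAt (fun q : ℝ × ℝ × ℝ => u q.1 q.2.1 (q.2.2 + h)) (x, y, t) := by
      exact ContinuousAt.comp (g := fun q : ℝ × ℝ × ℝ => u q.1 q.2.1 q.2.2)
        (f := fun q : ℝ × ℝ × ℝ => (q.1, q.2.1, q.2.2 + h)) (x := (x, y, t)) c2 (by fun_prop)
    exact continuousAt_const.mul (c3.sub c1)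
  · intro x hx y hy t ht
    have hx := Ioo_subset_Icc_self hx
    have hy := Ioo_subset_Icc_self hy
    obtain ⟨a1, a2, a3, a4, a5⟩ := H.der (hdom x hx y hy t ht.1.le (by linarith [ht.2]))
    obtain ⟨b1, b2, b3, b4, b5⟩ :=
      H.der (hdom x hx y hy (t+h) (by linarith [ht.1]) (by linarith [ht.2]))
    refine ⟨(b1.fun_sub a1).const_mul σ, (b2.fun_sub a2).const_mul σ, ?_,
      (b4.fun_sub a4).const_mul σ, (b5.fun_sub a5).const_mul σ⟩
    exact ((HasDerivAt.comp_add_const t h b3).fun_sub a3).const_mul σ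
  · intro x hx y hy t ht e1 e2
    have hx := Ioo_subset_Icc_self hx
    have hy' := Ioo_subset_Icc_self hy
    have p1 := H.pde (hdom x hx y hy' t ht.1.le (by linarith [ht.2])) hy.1 (by linarith [ht.2])
    have p2 := H.pde (hdom x hx y hy' (t+h) (by linarith [ht.1]) (by linarith [ht.2])) hy.1
      (by linarith [ht.2])
    have e1' : ux x y (t+h) = ux x y t := by
      have := (mul_eq_zero.mp e1).resolve_left hσ0; linarith
    have e2' : uy x y (t+h) = uy x y t := by
      have := (mul_eq_zero.mp e2).resolve_left hσ0; linarith
    rw [e1', e2', ← p1] at p2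
    have : ut x y (t+h) - ut x y t = (uxx x y (t+h) - uxx x y t) + (uyy x y (t+h) - uyy x y t) := by
      linarith
    simp only [this]
    linarith
  · intro x hx y hy t ht hb
    by_cases hy0 : y = 0
    · subst hy0
      have hx2 : |x| ≤ 2*R := by rw [abs_le]; constructor <;> linarith [hx.1, hx.2]
      rw [H.bc hx2 ht.1 (by linarith [ht.2]), H.bc hx2 (by linarith [ht.1]) (by linarith [ht.2])]
      have : 0 ≤ M := (abs_nonneg _).trans (hM 0 (2*R) T1 (by simp; linarith) (by linarith) le_rfl
        le_rfl H.hT.le (Or.inr (Or.inl (by linarith))))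
      nlinarith
    have hbd : ∀ s ∈ Icc t (t+h), |ut x y s| ≤ M := by
      intro s hs
      apply hM x y s (by rw [abs_le]; constructor <;> linarith [hx.1, hx.2]) hy.1
        (by linarith [hy.2]) (by linarith [hs.1, ht.1]) (by linarith [hs.2, ht.2])
      rcases hb with hb | hb | hb | hb | hb
      · left; rw [hb, abs_neg, abs_of_pos hR]; linarith
      · left; rw [hb, abs_of_pos hR]; linarith
      · exact absurd hb hy0
      · right; left; linarith
      · right; right; linarith [hs.2]
    have := (convex_Icc t (t+h)).norm_image_sub_le_of_norm_hasDerivWithin_le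
      (f := fun s => u x y s) (f' := fun s => ut x y s) (C := M)
      (fun s hs => (H.der (hdom x hx y hy s (by linarith [hs.1, ht.1])
        (by linarith [hs.2, ht.2]))).2.2.1.hasDerivWithinAt)
      (fun s hs => hbd s hs) (left_mem_Icc.mpr (by linarith)) (right_mem_Icc.mpr (by linarith))
    simp only [Real.norm_eq_abs, add_sub_cancel_left, abs_of_pos hh] at this
    have := abs_le.mp this
    rcases hσ with h | h <;> rw [h] <;> linarith

lemma ut_bdd (H : Dat p R T1 T u ux uy ut uxx uyy) :
    ∃ K > 0, ∀ x y t, |x| ≤ R → 0 ≤ y → y ≤ R → T1 ≤ t → t < T → |ut x y t| ≤ K := by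
  have hR := H.hR
  have hT := H.hT
  obtain ⟨M, hM0, hM⟩ := bdd_away (r := R/2) (T' := (T1+T)/2) (by linarith) (by linarith) H.cut
  refine ⟨M, hM0, ?_⟩
  intro x y t hx hy hy' ht ht'
  have hd := (H.der (dom_lt (R := R) (T1 := T1) (T := T) (x := x) (y := y) (t := t)
    (by linarith) hy (by linarith) ht ht')).2.2.1
  have key : ∀ σ : ℝ, (σ = 1 ∨ σ = -1) → -M ≤ σ * ut x y t := by
    intro σ hσ
    apply right_deriv_ge (h0 := min ((T-T1)/2) (T - t)) (hd.const_mul σ)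
      (lt_min (by linarith) (by linarith))
    intro s hs hs'
    have := tdiff H hσ hs (hs'.le.trans (min_le_left _ _)) (t2 := t)
      (by linarith [hs'.trans_le (min_le_right _ _)]) hM x (abs_le.mp hx) y ⟨hy, hy'⟩ t ⟨ht, le_rfl⟩
    linarith
  have k1 := key 1 (Or.inl rfl)
  have k2 := key (-1) (Or.inr rfl)
  rw [abs_le]; constructor <;> linarith

lemma xdiff (H : Dat p R T1 T u ux uy ut uxx uyy) {M h t2 : ℝ}
    (hh : 0 < h) (hh' : h < R/2) (ht2 : t2 < T)
    (hM : ∀ x y t, |x| ≤ 2*R → 0 ≤ y → y ≤ 2*R → T1 ≤ t → t ≤ T →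
      (R/2 ≤ |x| ∨ R/2 ≤ y ∨ t ≤ (T1+T)/2) → |uxx x y t| ≤ M) :
    ∀ x ∈ Icc (-R) R, ∀ y ∈ Icc 0 R, ∀ t ∈ Icc T1 t2,
      -M * h^2 ≤ u (x+h) y t + u (x-h) y t - 2 * u x y t := by
  have hR := H.hR
  have hdom : ∀ x, -(3*R/2) ≤ x → x ≤ 3*R/2 → ∀ y ∈ Icc 0 R, ∀ t ∈ Icc T1 t2,
      dom R T1 T x y t := by
    intro x hx hx' y hy t ht
    exact dom_lt (by rw [abs_le]; constructor <;> linarith) hy.1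
      (by linarith [hy.2]) ht.1 (by linarith [ht.2])
  have hM0 : 0 ≤ M := (abs_nonneg _).trans (hM 0 (2*R) T1 (by simp; linarith) (by linarith) le_rfl
        le_rfl H.hT.le (Or.inr (Or.inl (by linarith))))
  apply box_mp (Dx := fun x y t => ux (x+h) y t + ux (x-h) y t - 2 * ux x y t)
    (Dy := fun x y t => uy (x+h) y t + uy (x-h) y t - 2 * uy x y t)
    (Dt := fun x y t => ut (x+h) y t + ut (x-h) y t - 2 * ut x y t)
    (Dxx := fun x y t => uxx (x+h) y t + uxx (x-h) y t - 2 * uxx x y t)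
    (Dyy := fun x y t => uyy (x+h) y t + uyy (x-h) y t - 2 * uyy x y t)
  · rintro ⟨x, y, t⟩ ⟨hx, hy, ht⟩
    simp only at hx hy ht
    apply ContinuousAt.continuousWithinAt
    have c1 := H.cu (hdom x (by linarith [hx.1]) (by linarith [hx.2]) y hy t ht)
    have c2 := H.cu (hdom (x+h) (by linarith [hx.1]) (by linarith [hx.2]) y hy t ht)
    have c3 := H.cu (hdom (x-h) (by linarith [hx.1]) (by linarith [hx.2]) y hy t ht)
    have c2' : ContinuousAt (fun q : ℝ × ℝ × ℝ => u (q.1+h) q.2.1 (q.2.2)) (x, y, t) := by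
      exact ContinuousAt.comp (g := fun q : ℝ × ℝ × ℝ => u q.1 q.2.1 q.2.2)
        (f := fun q : ℝ × ℝ × ℝ => (q.1+h, q.2.1, q.2.2)) (x := (x, y, t)) c2 (by fun_prop)
    have c3' : ContinuousAt (fun q : ℝ × ℝ × ℝ => u (q.1-h) q.2.1 (q.2.2)) (x, y, t) := by
      exact ContinuousAt.comp (g := fun q : ℝ × ℝ × ℝ => u q.1 q.2.1 q.2.2)
        (f := fun q : ℝ × ℝ × ℝ => (q.1-h, q.2.1, q.2.2)) (x := (x, y, t)) c3 (by fun_prop)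
    exact (c2'.add c3').sub (continuousAt_const.mul c1)
  · intro x hx y hy t ht
    have hy := Ioo_subset_Icc_self hy
    have ht := Ioc_subset_Icc_self ht
    obtain ⟨a1, a2, a3, a4, a5⟩ := H.der (hdom x (by linarith [hx.1]) (by linarith [hx.2]) y hy t ht)
    obtain ⟨b1, b2, b3, b4, b5⟩ :=
      H.der (hdom (x+h) (by linarith [hx.1]) (by linarith [hx.2]) y hy t ht)
    obtain ⟨c1, c2, c3, c4, c5⟩ :=
      H.der (hdom (x-h) (by linarith [hx.1]) (by linarith [hx.2]) y hy t ht)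
    refine ⟨?_, (b2.fun_add c2).fun_sub (a2.const_mul 2), (b3.fun_add c3).fun_sub (a3.const_mul 2),
      ?_, (b5.fun_add c5).fun_sub (a5.const_mul 2)⟩
    · exact ((HasDerivAt.comp_add_const x h b1).fun_add
        (HasDerivAt.comp_sub_const x h c1)).fun_sub (a1.const_mul 2)
    · exact ((HasDerivAt.comp_add_const x h b4).fun_add
        (HasDerivAt.comp_sub_const x h c4)).fun_sub (a4.const_mul 2)
  · intro x hx y hy t ht e1 e2
    have hy' := Ioo_subset_Icc_self hy
    have ht' := Ioc_subset_Icc_self ht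
    have p1 := H.pde (hdom x (by linarith [hx.1]) (by linarith [hx.2]) y hy' t ht') hy.1
      (by linarith [ht.2])
    have p2 := H.pde (hdom (x+h) (by linarith [hx.1]) (by linarith [hx.2]) y hy' t ht') hy.1
      (by linarith [ht.2])
    have p3 := H.pde (hdom (x-h) (by linarith [hx.1]) (by linarith [hx.2]) y hy' t ht') hy.1
      (by linarith [ht.2])
    have := F_midconvex H.hp (ux (x+h) y t) (uy (x+h) y t) (ux (x-h) y t) (uy (x-h) y t)
      (ux x y t) (uy x y t) (by linarith) (by linarith)
    linarith
  · intro x hx y hy t ht hb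
    by_cases hy0 : y = 0
    · subst hy0
      have hx2 : |x| ≤ 2*R := by rw [abs_le]; constructor <;> linarith [hx.1, hx.2]
      have hx3 : |x+h| ≤ 2*R := by rw [abs_le]; constructor <;> linarith [hx.1, hx.2]
      have hx4 : |x-h| ≤ 2*R := by rw [abs_le]; constructor <;> linarith [hx.1, hx.2]
      have : t < T := by linarith [ht.2]
      rw [H.bc hx2 ht.1 this, H.bc hx3 ht.1 this, H.bc hx4 ht.1 this]
      nlinarith [sq_nonneg h]
    refine sym_diff_ge (f := fun s => u s y t) (f' := fun s => ux s y t)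
      (f'' := fun s => uxx s y t) hh.le ?_ ?_ ?_
    · intro s hs
      exact (H.der (hdom s (by linarith [hx.1, hs.1]) (by linarith [hx.2, hs.2]) y hy t ht)).1
    · intro s hs
      exact (H.der (hdom s (by linarith [hx.1, hs.1]) (by linarith [hx.2, hs.2]) y hy t ht)).2.2.2.1
    · intro s hs
      have hd := hdom s (by linarith [hx.1, hs.1]) (by linarith [hx.2, hs.2]) y hy t ht
      refine (abs_le.mp (hM s y t hd.1 hy.1 (by linarith [hy.2]) ht.1 (by linarith [ht.2]) ?_)).1
      rcases hb with hb | hb | hb | hb | hb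
      · left; rw [le_abs]; right; linarith [hs.2]
      · left; rw [le_abs]; left; linarith [hs.1]
      · exact absurd hb hy0
      · right; left; linarith
      · right; right; linarith [H.hT]

lemma uxx_bdd (H : Dat p R T1 T u ux uy ut uxx uyy) :
    ∃ K > 0, ∀ x y t, |x| ≤ R → 0 ≤ y → y ≤ R → T1 ≤ t → t < T → -K ≤ uxx x y t := by
  have hR := H.hR
  have hT := H.hT
  obtain ⟨M, hM0, hM⟩ := bdd_away (r := R/2) (T' := (T1+T)/2) (by linarith) (by linarith) H.cuxx
  refine ⟨M, hM0, ?_⟩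
  intro x y t hx hy hy' ht ht'
  have hx' := abs_le.mp hx
  apply sym_diff_deriv (f := fun s => u s y t) (f' := fun s => ux s y t) (x := x) (h0 := R/2)
    (by linarith)
  · intro s hs
    exact (H.der (dom_lt (by rw [abs_le]; constructor <;> linarith [hs.1, hs.2]) hy (by linarith)
      ht ht')).1
  · exact (H.der (dom_lt (by linarith) hy (by linarith) ht ht')).2.2.2.1
  · intro h h1 h2
    exact xdiff H h1 h2 ht' hM x hx' y ⟨hy, hy'⟩ t ⟨ht, le_rfl⟩

structure Est (p R T1 T K : ℝ) (u ux uy ut uxx uyy : ℝ → ℝ → ℝ → ℝ) : Prop where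
  hK : 1 ≤ K
  hut : ∀ x y t, |x| ≤ R → 0 ≤ y → y ≤ R → T1 ≤ t → t < T → |ut x y t| ≤ K
  huxx : ∀ x y t, |x| ≤ R → 0 ≤ y → y ≤ R → T1 ≤ t → t < T → -K ≤ uxx x y t
  hux0 : ∀ y t, 0 ≤ y → y ≤ R → T1 ≤ t → t < T → ux 0 y t = 0
  hux : ∀ x y t, |x| ≤ R → 0 ≤ y → y ≤ R → T1 ≤ t → t < T → |ux x y t| ≤ K * |x|
  hmon : ∀ x y t, |x| ≤ R → 0 ≤ y → y ≤ R → T1 ≤ t → t < T → x * ux x y t ≤ 0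
  huy : ∀ x y t, |x| ≤ R → 0 ≤ y → y ≤ R → T1 ≤ t → t < T → -K ≤ uy x y t

lemma ux_bot (H : Dat p R T1 T u ux uy ut uxx uyy) {x t : ℝ} (hx : |x| ≤ R) (h1 : T1 ≤ t)
    (h2 : t < T) : ux x 0 t = 0 := by
  have hR := H.hR
  have hd := (H.der (dom_lt (R := R) (T1 := T1) (T := T) (x := x) (y := 0) (t := t)
    (by linarith) le_rfl (by linarith) h1 h2)).1
  have : (fun s => u s 0 t) =ᶠ[nhds x] fun _ => 0 := by
    have hx' := abs_le.mp hx
    filter_upwards [Ioo_mem_nhds (show -(2*R) < x by linarith) (show x < 2*R by linarith)] with s hs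
    exact H.bc (abs_le.mpr ⟨hs.1.le, hs.2.le⟩) h1 h2
  exact hd.unique ((hasDerivAt_const x (0:ℝ)).congr_of_eventuallyEq this)

lemma exists_est (H : Dat p R T1 T u ux uy ut uxx uyy) :
    ∃ K, Est p R T1 T K u ux uy ut uxx uyy := by
  have hR := H.hR
  have hT := H.hT
  obtain ⟨K1, hK1, h1⟩ := ut_bdd H
  obtain ⟨K2, hK2, h2⟩ := uxx_bdd H
  obtain ⟨M, hM0, hM⟩ := bdd_away (r := R) (T' := (T1+T)/2) (by linarith) (by linarith) H.cuy
  have hmon : ∀ x y t, |x| ≤ R → 0 ≤ y → y ≤ R → T1 ≤ t → t < T → x * ux x y t ≤ 0 := by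
    intro x y t hx hy hy' ht ht'
    rcases eq_or_lt_of_le hy with h | h
    · rw [← h, ux_bot H hx ht ht', mul_zero]
    · exact H.mon (dom_lt (by linarith) hy (by linarith) ht ht') h ht'
  have hux0 : ∀ y t, 0 ≤ y → y ≤ R → T1 ≤ t → t < T → ux 0 y t = 0 := by
    intro y t hy hy' ht ht'
    have hc : ContinuousAt (fun s => ux s y t) 0 :=
      (H.der (dom_lt (by simp; linarith) hy (by linarith) ht ht')).2.2.2.1.continuousAt
    apply le_antisymm
    · refine le_of_tendsto (hc.tendsto.mono_left (nhdsWithin_le_nhds (s := Ioi 0))) ?_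
      filter_upwards [Ioo_mem_nhdsGT hR] with s hs
      have := hmon s y t (by rw [abs_of_pos hs.1]; exact hs.2.le) hy hy' ht ht'
      exact nonpos_of_mul_nonpos_right this hs.1
    · refine ge_of_tendsto (hc.tendsto.mono_left (nhdsWithin_le_nhds (s := Iio 0))) ?_
      filter_upwards [Ioo_mem_nhdsLT (show -R < 0 by linarith)] with s hs
      have := hmon s y t (by rw [abs_of_neg hs.2]; linarith [hs.1]) hy hy' ht ht'
      have hs2 := hs.2
      by_contra hc
      push Not at hc
      nlinarith
  have hux : ∀ x y t, |x| ≤ R → 0 ≤ y → y ≤ R → T1 ≤ t → t < T → |ux x y t| ≤ K2 * |x| := by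
    intro x y t hx hy hy' ht ht'
    have hmo : MonotoneOn (fun s => ux s y t + K2 * s) (Icc (-R) R) := by
      apply monotoneOn_of_hasDerivWithinAt_nonneg (convex_Icc _ _)
        (f' := fun s => uxx s y t + K2)
      · intro s hs
        have := (H.der (dom_lt (R := R) (T1 := T1) (T := T) (x := s) (y := y) (t := t)
          (by linarith [abs_le.mpr hs]) hy (by linarith) ht ht')).2.2.2.1.continuousAt
        exact (this.add (by fun_prop)).continuousWithinAt
      · intro s hs
        have hs := interior_subset hs
        have := (H.der (dom_lt (R := R) (T1 := T1) (T := T) (x := s) (y := y) (t := t)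
          (by linarith [abs_le.mpr hs]) hy (by linarith) ht ht')).2.2.2.1
        exact (this.fun_add (((hasDerivAt_id s).const_mul K2).congr_deriv
          (mul_one K2))).hasDerivWithinAt
      · intro s hs
        have hs := interior_subset hs
        linarith [h2 s y t (abs_le.mpr hs) hy hy' ht ht']
    have e0 := hux0 y t hy hy' ht ht'
    have em := hmon x y t hx hy hy' ht ht'
    have hx' := abs_le.mp hx
    rcases lt_trichotomy x 0 with h | h | h
    · have := hmo (show x ∈ Icc (-R) R from hx') (show (0:ℝ) ∈ Icc (-R) R from ⟨by linarith, hR.le⟩) h.le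
      simp only [e0] at this
      rw [abs_of_neg h, abs_le]
      constructor
      · by_contra hc
        push Not at hc
        nlinarith
      · nlinarith
    · subst h; simp [e0]
    · have := hmo (show (0:ℝ) ∈ Icc (-R) R from ⟨by linarith, hR.le⟩) (show x ∈ Icc (-R) R from hx') h.le
      simp only [e0] at this
      rw [abs_of_pos h, abs_le]
      constructor
      · nlinarith
      · have := nonpos_of_mul_nonpos_right em h
        nlinarith
  have huy : ∀ x y t, |x| ≤ R → 0 ≤ y → y ≤ R → T1 ≤ t → t < T →
      -(M + (K1+K2)*R) ≤ uy x y t := by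
    intro x y t hx hy hy' ht ht'
    have han : AntitoneOn (fun s => uy x s t - (K1+K2)*s) (Icc 0 R) := by
      apply antitoneOn_of_hasDerivWithinAt_nonpos (convex_Icc _ _)
        (f' := fun s => uyy x s t - (K1+K2))
      · intro s hs
        have := (H.der (dom_lt (R := R) (T1 := T1) (T := T) (x := x) (y := s) (t := t)
          (by linarith) hs.1 (by linarith [hs.2]) ht ht')).2.2.2.2.continuousAt
        exact (this.sub (by fun_prop)).continuousWithinAt
      · intro s hs
        have hs := interior_subset hs
        have := (H.der (dom_lt (R := R) (T1 := T1) (T := T) (x := x) (y := s) (t := t)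
          (by linarith) hs.1 (by linarith [hs.2]) ht ht')).2.2.2.2
        exact (this.fun_sub (((hasDerivAt_id s).const_mul (K1+K2)).congr_deriv
          (mul_one _))).hasDerivWithinAt
      · intro s hs
        rw [interior_Icc] at hs
        have := H.pde (dom_lt (R := R) (T1 := T1) (T := T) (x := x) (y := s) (t := t)
          (by linarith) hs.1.le (by linarith [hs.2]) ht ht') hs.1 ht'
        have F0 : 0 ≤ ((ux x s t)^2 + (uy x s t)^2)^(p/2) := by positivity
        have a1 := (abs_le.mp (h1 x s t hx hs.1.le hs.2.le ht ht')).2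
        have a2 := h2 x s t hx hs.1.le hs.2.le ht ht'
        linarith
    have := han ⟨hy, hy'⟩ (right_mem_Icc.mpr hR.le) hy'
    simp only at this
    have b := (abs_le.mp (hM x R t (by linarith) hR.le (by linarith) ht ht'.le
      (Or.inr (Or.inl le_rfl)))).1
    have : (K1+K2)*y ≥ 0 := by positivity
    linarith
  set K := max (max 1 K1) (max K2 (M + (K1+K2)*R)) with hK
  have k0 : 1 ≤ K := (le_max_left _ _).trans (le_max_left _ _)
  have k1 : K1 ≤ K := (le_max_right _ _).trans (le_max_left _ _)
  have k2 : K2 ≤ K := (le_max_left _ _).trans (le_max_right _ _)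
  have k3 : M + (K1+K2)*R ≤ K := (le_max_right _ _).trans (le_max_right _ _)
  refine ⟨K, k0, ?_, ?_, hux0, ?_, hmon, ?_⟩
  · intro x y t a b c d e; exact (h1 x y t a b c d e).trans k1
  · intro x y t a b c d e; linarith [h2 x y t a b c d e]
  · intro x y t a b c d e
    exact (hux x y t a b c d e).trans (mul_le_mul_of_nonneg_right k2 (abs_nonneg _))
  · intro x y t a b c d e; linarith [huy x y t a b c d e]
end


def bt (p : ℝ) : ℝ := 1/(p-1)
def W (p s : ℝ) : ℝ := bt p ^ bt p * s ^ (-bt p)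
def U (p s : ℝ) : ℝ := bt p ^ bt p / (1 - bt p) * s ^ (1 - bt p)

section WU
variable {p : ℝ} (hp : 2 < p)
include hp

lemma bt_pos : 0 < bt p := by unfold bt; apply div_pos <;> linarith
lemma bt_lt : bt p < 1 := by unfold bt; rw [div_lt_one] <;> linarith
lemma bt_mul : bt p * (p-1) = 1 := by unfold bt; field_simp [show p-1 ≠ 0 by linarith]
lemma dp_pos : 0 < bt p ^ bt p := rpow_pos_of_pos (bt_pos hp) _

lemma W_pos {s : ℝ} (hs : 0 < s) : 0 < W p s := mul_pos (dp_pos hp) (rpow_pos_of_pos hs _)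

lemma W_pow1 {s : ℝ} (hs : 0 < s) : W p s ^ (p-1) = bt p / s := by
  have hb := bt_pos hp
  unfold W
  rw [mul_rpow (dp_pos hp).le (rpow_nonneg hs.le _), ← rpow_mul hb.le, ← rpow_mul hs.le, bt_mul hp,
    rpow_one, neg_mul, bt_mul hp, rpow_neg_one, div_eq_mul_inv]

lemma W_powp {s : ℝ} (hs : 0 < s) : W p s ^ p = W p s * (bt p / s) := by
  rw [← W_pow1 hp hs, ← rpow_one_add' (W_pos hp hs).le (by linarith)]
  congr 1; ring

lemma W_pow2 {s : ℝ} (hs : 0 < s) : W p s ^ (p-2) = (bt p) ^ (1 - bt p) * s ^ (-(1 - bt p)) := by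
  have hb := bt_pos hp
  have e : p - 2 = (p-1)*(1 - bt p) := by
    have := bt_mul hp
    linear_combination this
  rw [e, rpow_mul (W_pos hp hs).le, W_pow1 hp hs, div_rpow hb.le hs.le, rpow_neg hs.le,
    div_eq_mul_inv]

lemma W_der {s : ℝ} (hs : 0 < s) : HasDerivAt (W p) (-(W p s ^ p)) s := by
  have := ((hasDerivAt_rpow_const (x := s) (p := -bt p) (Or.inl hs.ne')).const_mul (bt p ^ bt p))
  refine this.congr_deriv ?_
  rw [W_powp hp hs, rpow_sub_one hs.ne']
  unfold W
  ring

lemma U_der {s : ℝ} (hs : 0 < s) : HasDerivAt (U p) (W p s) s := by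
  have := ((hasDerivAt_rpow_const (x := s) (p := 1-bt p) (Or.inl hs.ne')).const_mul
    (bt p ^ bt p / (1 - bt p)))
  refine this.congr_deriv ?_
  have := bt_lt hp
  unfold W
  rw [show 1 - bt p - 1 = - bt p by ring]
  field_simp [show 1 - bt p ≠ 0 by linarith]

lemma U_zero : U p 0 = 0 := by
  have := bt_lt hp
  unfold U; rw [zero_rpow (by linarith), mul_zero]

lemma U_cont : Continuous (U p) := by
  have := bt_lt hp
  unfold U
  exact continuous_const.mul (continuous_id.rpow_const (fun _ => Or.inr (by linarith)))

lemma U_nonneg {s : ℝ} (hs : 0 ≤ s) : 0 ≤ U p s := by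
  have := bt_lt hp
  unfold U
  exact mul_nonneg (div_nonneg (dp_pos hp).le (by linarith)) (rpow_nonneg hs _)

lemma U_mono {s r : ℝ} (hs : 0 ≤ s) (h : s ≤ r) : U p s ≤ U p r := by
  have := bt_lt hp
  unfold U
  exact mul_le_mul_of_nonneg_left (rpow_le_rpow hs h (by linarith))
    (div_nonneg (dp_pos hp).le (by linarith))

lemma W_anti {s r : ℝ} (hs : 0 < s) (h : s ≤ r) : W p r ≤ W p s := by
  unfold W
  exact mul_le_mul_of_nonneg_left (rpow_le_rpow_of_nonpos hs h (by linarith [bt_pos hp]))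
    (dp_pos hp).le

lemma W_anti' {s r : ℝ} (hs : 0 < s) (h : s < r) : W p r < W p s := by
  unfold W
  exact mul_lt_mul_of_pos_left (rpow_lt_rpow_of_neg hs h (by linarith [bt_pos hp]))
    (dp_pos hp)

/-- explicit inverse -/
lemma W_large (M : ℝ) {δ : ℝ} (hδ : 0 < δ) : ∃ A, 0 < A ∧ A < δ ∧ M ≤ W p A := by
  have h1 : Tendsto (fun s : ℝ => s ^ (-bt p)) (nhdsWithin 0 (Ioi 0)) atTop :=
    tendsto_rpow_neg_nhdsGT_zero (by linarith [bt_pos hp])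
  have h2 : Tendsto (fun s : ℝ => W p s) (nhdsWithin 0 (Ioi 0)) atTop :=
    h1.const_mul_atTop (dp_pos hp)
  have h3 := h2.eventually (eventually_ge_atTop M)
  have h4 : ∀ᶠ s in nhdsWithin (0:ℝ) (Ioi 0), s ∈ Ioo 0 δ := Ioo_mem_nhdsGT hδ
  obtain ⟨A, hA, hB⟩ := (h3.and h4).exists
  exact ⟨A, hB.1, hB.2, hA⟩

lemma W_contAt {s : ℝ} (hs : 0 < s) : ContinuousAt (W p) s := (W_der hp hs).continuousAt

lemma U_eq {s : ℝ} (hs : 0 < s) : U p s = W p s * s / (1 - bt p) := by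
  unfold U W
  rw [show 1 - bt p = -bt p + 1 by ring, rpow_add hs, rpow_one]
  ring
end WU

/-- one-sided comparison -/
lemma cmp_nonpos {f f' : ℝ → ℝ} {Y : ℝ} (hc : ContinuousOn f (Icc 0 Y))
    (hd : ∀ y ∈ Ioo 0 Y, HasDerivAt f (f' y) y) (h0 : f 0 ≤ 0)
    (h : ∀ y ∈ Ioo 0 Y, 0 < f y → f' y ≤ 0) : ∀ y ∈ Icc 0 Y, f y ≤ 0 := by
  intro y1 hy1
  by_contra hpos
  push Not at hpos
  set S : Set ℝ := Icc 0 y1 ∩ f ⁻¹' (Iic 0) with hS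
  have hcl : IsClosed S := (hc.mono (Icc_subset_Icc_right hy1.2)).preimage_isClosed_of_isClosed
    isClosed_Icc isClosed_Iic
  have hne : S.Nonempty := ⟨0, ⟨le_rfl, hy1.1⟩, h0⟩
  have hbd : BddAbove S := ⟨y1, fun z hz => hz.1.2⟩
  have hmem := hcl.csSup_mem hne hbd
  set s := sSup S with hs
  have hlt : s < y1 := by
    rcases eq_or_lt_of_le hmem.1.2 with e | e
    · exfalso
      have := hmem.2
      rw [e] at this
      exact absurd this (not_le.mpr hpos)
    · exact e
  have hgt : ∀ z ∈ Ioo s y1, 0 < f z := by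
    intro z hz
    by_contra hc
    push Not at hc
    have : z ≤ s := le_csSup hbd ⟨⟨by linarith [hmem.1.1, hz.1], hz.2.le⟩, hc⟩
    linarith [hz.1]
  have hanti : AntitoneOn f (Icc s y1) := by
    apply antitoneOn_of_hasDerivWithinAt_nonpos (convex_Icc _ _) (f' := f')
    · exact hc.mono (Icc_subset_Icc hmem.1.1 hy1.2)
    · intro z hz
      rw [interior_Icc] at hz
      exact (hd z ⟨by linarith [hmem.1.1, hz.1], by linarith [hz.2, hy1.2]⟩).hasDerivWithinAt
    · intro z hz
      rw [interior_Icc] at hz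
      exact h z ⟨by linarith [hmem.1.1, hz.1], by linarith [hz.2, hy1.2]⟩ (hgt z hz)
  have := hanti (left_mem_Icc.mpr hlt.le) (right_mem_Icc.mpr hlt.le) hlt.le
  have h3 : f s ≤ 0 := hmem.2
  linarith

lemma incr_le {f g f' g' : ℝ → ℝ} {Y : ℝ} (hf : ContinuousOn f (Icc 0 Y))
    (hg : ContinuousOn g (Icc 0 Y))
    (hdf : ∀ y ∈ Ioo 0 Y, HasDerivAt f (f' y) y) (hdg : ∀ y ∈ Ioo 0 Y, HasDerivAt g (g' y) y)
    (h0 : f 0 ≤ g 0) (h : ∀ y ∈ Ioo 0 Y, f' y ≤ g' y) : ∀ y ∈ Icc 0 Y, f y ≤ g y := by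
  intro y hy
  have := cmp_nonpos (f := fun y => f y - g y) (f' := fun y => f' y - g' y) (Y := Y) (hf.sub hg)
    (fun y hy => (hdf y hy).fun_sub (hdg y hy)) (by linarith) (fun y hy _ => by linarith [h y hy]) y hy
  linarith

section ODE
variable {p : ℝ} (hp : 2 < p) {v v' : ℝ → ℝ} {Y A c : ℝ}
include hp

lemma WA_der {y : ℝ} (h : 0 < y + A) : HasDerivAt (fun y => W p (y+A)) (-(W p (y+A))^p) y :=
  HasDerivAt.comp_add_const y A (W_der hp h)

lemma ode_up (hA : 0 < A) (hc0 : 0 ≤ c) (hc : ContinuousOn v (Icc 0 Y))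
    (hd : ∀ y ∈ Ioo 0 Y, HasDerivAt v (v' y) y)
    (h : ∀ y ∈ Ioo 0 Y, v' y ≤ c - (max (v y) 0)^p) (h0 : v 0 ≤ W p A) :
    ∀ y ∈ Icc 0 Y, v y ≤ W p (y+A) + c * y := by
  intro y hy
  have := cmp_nonpos (f := fun y => v y - (W p (y+A) + c * y))
    (f' := fun y => v' y - (-(W p (y+A))^p + c)) (Y := Y) ?_ ?_ ?_ ?_ y hy
  · linarith
  · apply hc.sub
    apply ContinuousOn.add
    · intro z hz
      exact (WA_der hp (by linarith [hz.1])).continuousAt.continuousWithinAt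
    · fun_prop
  · intro z hz
    exact (hd z hz).fun_sub ((WA_der hp (by linarith [hz.1])).fun_add
      (((hasDerivAt_id z).const_mul c).congr_deriv (mul_one _)))
  · simp; exact h0
  · intro z hz hpos
    have h1 := h z hz
    have hw := W_pos hp (show 0 < z + A by linarith [hz.1])
    have h2 : 0 ≤ c * z := mul_nonneg hc0 hz.1.le
    have h3 : W p (z+A) ≤ max (v z) 0 := le_max_of_le_left (by linarith)
    have := rpow_le_rpow hw.le h3 (show 0 ≤ p by linarith)
    linarith

lemma ode_low {Φ φ : ℝ → ℝ} (hA : 0 < A) (hc : ContinuousOn v (Icc 0 Y))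
    (hΦ : ContinuousOn Φ (Icc 0 Y)) (hd : ∀ y ∈ Ioo 0 Y, HasDerivAt v (v' y) y)
    (hdΦ : ∀ y ∈ Ioo 0 Y, HasDerivAt Φ (φ y) y) (hΦ0 : ∀ y ∈ Icc 0 Y, 0 ≤ Φ y)
    (h : ∀ y ∈ Ioo 0 Y, - (max (v y) 0)^p - φ y ≤ v' y) (h0 : W p A ≤ v 0) :
    ∀ y ∈ Icc 0 Y, W p (y+A) - Φ y ≤ v y := by
  intro y hy
  have := cmp_nonpos (f := fun y => W p (y+A) - Φ y - v y)
    (f' := fun y => -(W p (y+A))^p - φ y - v' y) (Y := Y) ?_ ?_ ?_ ?_ y hy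
  · linarith
  · refine ContinuousOn.sub (ContinuousOn.sub ?_ hΦ) hc
    · intro z hz
      exact (WA_der hp (by linarith [hz.1])).continuousAt.continuousWithinAt
  · intro z hz
    exact ((WA_der hp (by linarith [hz.1])).fun_sub (hdΦ z hz)).fun_sub (hd z hz)
  · simp; linarith [hΦ0 0 ⟨le_rfl, hy.1.trans hy.2⟩]
  · intro z hz hpos
    have h1 := h z hz
    have hw := W_pos hp (show 0 < z + A by linarith [hz.1])
    have h2 := hΦ0 z (Ioo_subset_Icc_self hz)
    have h3 : max (v z) 0 ≤ W p (z+A) := max_le (by linarith) hw.le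
    have := rpow_le_rpow (le_max_right _ _) h3 (show 0 ≤ p by linarith)
    linarith
end ODE


/-- inner domain without the singular point -/
def ed (R T1 T x y t : ℝ) : Prop :=
  |x| ≤ R ∧ 0 ≤ y ∧ y ≤ R ∧ T1 ≤ t ∧ t ≤ T ∧ ¬(x = 0 ∧ y = 0 ∧ t = T)

structure Ex (p R T1 T K : ℝ) (u ux uy ut uxx uyy : ℝ → ℝ → ℝ → ℝ) : Prop where
  hK : 1 ≤ K
  hut : ∀ ⦃x y t⦄, ed R T1 T x y t → |ut x y t| ≤ K
  huxx : ∀ ⦃x y t⦄, ed R T1 T x y t → -K ≤ uxx x y t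
  hux0 : ∀ ⦃y t⦄, ed R T1 T 0 y t → ux 0 y t = 0
  hux : ∀ ⦃x y t⦄, ed R T1 T x y t → |ux x y t| ≤ K * |x|
  hmon : ∀ ⦃x y t⦄, ed R T1 T x y t → x * ux x y t ≤ 0
  huy : ∀ ⦃x y t⦄, ed R T1 T x y t → -K ≤ uy x y t
  pde : ∀ ⦃x y t⦄, ed R T1 T x y t → 0 < y →
    ut x y t - (uxx x y t + uyy x y t) = ((ux x y t)^2 + (uy x y t)^2)^(p/2)
  bc : ∀ ⦃x t⦄, ed R T1 T x 0 t → u x 0 t = 0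
  der : ∀ ⦃x y t⦄, ed R T1 T x y t → DerPk u ux uy ut uxx uyy x y t

section
variable {p R T1 T K : ℝ} {u ux uy ut uxx uyy : ℝ → ℝ → ℝ → ℝ}

lemma ed.dom {x y t : ℝ} (hR : 0 < R) (h : ed R T1 T x y t) : dom R T1 T x y t :=
  ⟨by linarith [h.1], h.2.1, by linarith [h.2.2.1], h.2.2.2.1, h.2.2.2.2.1, h.2.2.2.2.2⟩

lemma ed_lt {x y t : ℝ} (hx : |x| ≤ R) (h0 : 0 ≤ y) (hy : y ≤ R) (h1 : T1 ≤ t) (ht : t < T) :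
    ed R T1 T x y t := ⟨hx, h0, hy, h1, ht.le, by rintro ⟨-, -, rfl⟩; exact lt_irrefl _ ht⟩

lemma tend_T {f : ℝ → ℝ → ℝ → ℝ} {x y T : ℝ}
    (h : ContinuousAt (fun q : ℝ × ℝ × ℝ => f q.1 q.2.1 q.2.2) (x, y, T)) :
    Tendsto (fun t => f x y t) (nhdsWithin T (Iio T)) (nhds (f x y T)) := by
  have : ContinuousAt (fun t => f x y t) T :=
    ContinuousAt.comp (g := fun q : ℝ × ℝ × ℝ => f q.1 q.2.1 q.2.2)
        (f := fun t => (x, y, t)) (x := T) h (by fun_prop)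
  exact this.tendsto.mono_left nhdsWithin_le_nhds

/-- closed inequalities pass to `t = T` -/
lemma le_T {f g : ℝ → ℝ} {T1 T a b t : ℝ} (hT : T1 < T) (h1 : T1 ≤ t) (ht : t ≤ T)
    (h : ∀ s, T1 ≤ s → s < T → f s ≤ g s)
    (hf : t = T → Tendsto f (nhdsWithin T (Iio T)) (nhds (f T)))
    (hg : t = T → Tendsto g (nhdsWithin T (Iio T)) (nhds (g T))) : f t ≤ g t := by
  rcases eq_or_lt_of_le ht with e | e
  · have hf := hf e
    have hg := hg e
    subst e
    refine le_of_tendsto_of_tendsto hf hg ?_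
    filter_upwards [Ioo_mem_nhdsLT hT] with s hs
    exact h s hs.1.le hs.2
  · exact h t h1 e

lemma exists_ex (H : Dat p R T1 T u ux uy ut uxx uyy) :
    ∃ K, Ex p R T1 T K u ux uy ut uxx uyy := by
  obtain ⟨K, E⟩ := exists_est H
  have hp := H.hp
  refine ⟨K, E.hK, ?_, ?_, ?_, ?_, ?_, ?_, ?_, ?_, fun x y t h => H.der (h.dom H.hR)⟩
  · intro x y t h
    have hd := h.dom H.hR
    obtain ⟨a, b, c, d, e, -⟩ := h
    refine le_T (f := fun s => |ut x y s|) (g := fun _ => K) (a := 0) (b := 0) H.hT d e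
      (fun s h1 h2 => E.hut x y s a b c h1 h2) ?_ ?_
    · intro h; subst h
      exact (tend_T (H.cut hd)).abs
    · intro _; exact tendsto_const_nhds
  · intro x y t h
    have hd := h.dom H.hR
    obtain ⟨a, b, c, d, e, -⟩ := h
    refine le_T (g := fun s => uxx x y s) (f := fun _ => -K) (a := 0) (b := 0) H.hT d e
      (fun s h1 h2 => E.huxx x y s a b c h1 h2) ?_ ?_
    · intro _; exact tendsto_const_nhds
    · intro h; subst h
      exact (tend_T (H.cuxx hd))
  · intro y t h
    have hd := h.dom H.hR
    obtain ⟨a, b, c, d, e, -⟩ := h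
    have := le_T (f := fun s => |ux 0 y s|) (g := fun _ => 0) (a := 0) (b := 0) H.hT d e
      (fun s h1 h2 => by rw [E.hux0 y s b c h1 h2, abs_zero]) ?_ ?_
    · exact abs_nonpos_iff.mp this
    · intro h; subst h
      exact (tend_T (H.cux hd)).abs
    · intro _; exact tendsto_const_nhds
  · intro x y t h
    have hd := h.dom H.hR
    obtain ⟨a, b, c, d, e, -⟩ := h
    refine le_T (f := fun s => |ux x y s|) (g := fun _ => K * |x|) (a := 0) (b := 0) H.hT d e
      (fun s h1 h2 => E.hux x y s a b c h1 h2) ?_ ?_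
    · intro h; subst h
      exact (tend_T (H.cux hd)).abs
    · intro _; exact tendsto_const_nhds
  · intro x y t h
    have hd := h.dom H.hR
    obtain ⟨a, b, c, d, e, -⟩ := h
    refine le_T (f := fun s => x * ux x y s) (g := fun _ => 0) (a := 0) (b := 0) H.hT d e
      (fun s h1 h2 => E.hmon x y s a b c h1 h2) ?_ ?_
    · intro h; subst h
      exact (tend_T (H.cux hd)).const_mul x
    · intro _; exact tendsto_const_nhds
  · intro x y t h
    have hd := h.dom H.hR
    obtain ⟨a, b, c, d, e, -⟩ := h
    refine le_T (g := fun s => uy x y s) (f := fun _ => -K) (a := 0) (b := 0) H.hT d e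
      (fun s h1 h2 => E.huy x y s a b c h1 h2) ?_ ?_
    · intro _; exact tendsto_const_nhds
    · intro h; subst h
      exact (tend_T (H.cuy hd))
  · intro x y t h hy
    have hd := h.dom H.hR
    have hR := H.hR
    obtain ⟨a, b, c, d, e, -⟩ := h
    have key := le_T (f := fun s => |ut x y s - (uxx x y s + uyy x y s) -
      ((ux x y s)^2 + (uy x y s)^2)^(p/2)|) (g := fun _ => 0) (a := 0) (b := 0) H.hT d e
      (fun s h1 h2 => by
        rw [H.pde (dom_lt (by linarith) b (by linarith) h1 h2) hy h2, sub_self, abs_zero]) ?_ ?_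
    · have := abs_nonpos_iff.mp key
      linarith
    · intro h; subst h
      exact (((tend_T (H.cut hd)).sub ((tend_T (H.cuxx hd)).add (tend_T (H.cuyy hd)))).sub
        ((((tend_T (H.cux hd)).pow 2).add ((tend_T (H.cuy hd)).pow 2)).rpow_const
          (Or.inr (by linarith)))).abs
    · intro _; exact tendsto_const_nhds
  · intro x t h
    have hd := h.dom H.hR
    have hR := H.hR
    obtain ⟨a, b, c, d, e, -⟩ := h
    have key := le_T (f := fun s => |u x 0 s|) (g := fun _ => 0) (a := 0) (b := 0) H.hT d e
      (fun s h1 h2 => by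
        rw [H.bc (by linarith) h1 h2, abs_zero]) ?_ ?_
    · exact abs_nonpos_iff.mp key
    · intro h; subst h
      exact (tend_T (H.cu hd)).abs
    · intro _; exact tendsto_const_nhds

/-- a vertical line avoiding the singularity -/
def gl (R T1 T x t : ℝ) : Prop := |x| ≤ R ∧ T1 ≤ t ∧ t ≤ T ∧ ¬(x = 0 ∧ t = T)

lemma gl.ed {x t : ℝ} (h : gl R T1 T x t) {y : ℝ} (h0 : 0 ≤ y) (hy : y ≤ R) : ed R T1 T x y t :=
  ⟨h.1, h0, hy, h.2.1, h.2.2.1, fun hh => h.2.2.2 ⟨hh.1, hh.2.2⟩⟩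

lemma gl_lt {x t : ℝ} (h : |x| ≤ R) (h1 : T1 ≤ t) (h2 : t < T) : gl R T1 T x t :=
  ⟨h, h1, h2.le, fun hh => h2.ne hh.2⟩

variable (H : Dat p R T1 T u ux uy ut uxx uyy) (E : Ex p R T1 T K u ux uy ut uxx uyy)
include H E

lemma v_cont {x t : ℝ} (h : gl R T1 T x t) : ContinuousOn (fun y => uy x y t) (Icc 0 R) :=
  fun _ hy => (E.der (h.ed hy.1 hy.2)).2.2.2.2.continuousAt.continuousWithinAt

lemma u_cont {x t : ℝ} (h : gl R T1 T x t) : ContinuousOn (fun y => u x y t) (Icc 0 R) :=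
  fun _ hy => (E.der (h.ed hy.1 hy.2)).2.1.continuousAt.continuousWithinAt

lemma pow_ge_v (hp : 2 < p) (a v : ℝ) : (max v 0)^p ≤ (a^2+v^2)^(p/2) := by
  have : (max v 0)^p = ((max v 0)^2)^(p/2) := by
    rw [← rpow_natCast, ← rpow_mul (le_max_right _ _)]; congr 1; push_cast; ring
  rw [this]
  apply rpow_le_rpow (sq_nonneg _) _ (by linarith)
  rcases max_cases v 0 with h | h <;> rw [h.1] <;> nlinarith [sq_nonneg a, sq_nonneg v]

lemma uyy_le {x t y : ℝ} (h : gl R T1 T x t) (hy : y ∈ Ioo 0 R) :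
    uyy x y t ≤ 2*K - (max (uy x y t) 0)^p := by
  have he := h.ed hy.1.le hy.2.le
  have := E.pde he hy.1
  have h1 := (abs_le.mp (E.hut he)).2
  have h2 := E.huxx he
  have h3 := pow_ge_v H E H.hp (ux x y t) (uy x y t)
  linarith

lemma F4 {x t A : ℝ} (h : gl R T1 T x t) (hA : 0 < A) (h0 : uy x 0 t ≤ W p A) :
    ∀ y ∈ Icc 0 R, uy x y t ≤ W p (y+A) + 2*K*y :=
  ode_up (v := fun y => uy x y t) (v' := fun y => uyy x y t) H.hp hA (by linarith [E.hK])
    (v_cont H E h) (fun y hy => (E.der (h.ed hy.1.le hy.2.le)).2.2.2.2)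
    (fun y hy => uyy_le H E h hy) h0

omit H E in
lemma Ksq_der (K y : ℝ) : HasDerivAt (fun y : ℝ => K*y^2) (2*K*y) y :=
  ((hasDerivAt_pow 2 y).const_mul K).congr_deriv (by push_cast; ring)

lemma F4u {x t A : ℝ} (h : gl R T1 T x t) (hA : 0 < A) (h0 : uy x 0 t ≤ W p A) :
    ∀ y ∈ Icc 0 R, u x y t ≤ U p (y+A) - U p A + K*y^2 := by
  have hR := H.hR
  refine incr_le (f := fun y => u x y t) (f' := fun y => uy x y t)
    (g := fun y => U p (y+A) - U p A + K*y^2)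
    (g' := fun y => W p (y+A) + 2*K*y) (u_cont H E h) ?_
    (fun y hy => (E.der (h.ed hy.1.le hy.2.le)).2.1) ?_ ?_ ?_
  · have := U_cont H.hp
    exact Continuous.continuousOn (by fun_prop)
  · intro y hy
    have := HasDerivAt.comp_add_const y A (U_der H.hp (show 0 < y + A by linarith [hy.1]))
    exact (this.sub_const _).fun_add (Ksq_der K y)
  · simp [E.bc (h.ed le_rfl hR.le)]
  · intro y hy
    exact F4 H E h hA h0 y (Ioo_subset_Icc_self hy)

lemma F4' {x t y : ℝ} (h : gl R T1 T x t) (hy : 0 < y) (hy' : y ≤ R) :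
    uy x y t ≤ W p y + 2*K*y := by
  obtain ⟨A, hA, -, h0⟩ := W_large H.hp (uy x 0 t) one_pos
  have := F4 H E h hA h0 y ⟨hy.le, hy'⟩
  have := W_anti H.hp hy (show y ≤ y + A by linarith)
  linarith

lemma F4u' {x t : ℝ} (h : gl R T1 T x t) :
    ∀ y ∈ Icc 0 R, u x y t ≤ U p y + K*y^2 := by
  have hR := H.hR
  refine incr_le (f := fun y => u x y t) (f' := fun y => uy x y t)
    (g := fun y => U p y + K*y^2)
    (g' := fun y => W p y + 2*K*y) (u_cont H E h) ?_
    (fun y hy => (E.der (h.ed hy.1.le hy.2.le)).2.1) ?_ ?_ ?_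
  · have := U_cont H.hp
    exact Continuous.continuousOn (by fun_prop)
  · intro y hy
    exact (U_der H.hp hy.1).fun_add (Ksq_der K y)
  · simp [E.bc (h.ed le_rfl hR.le), U_zero H.hp]
  · intro y hy
    exact F4' H E h hy.1 hy.2.le

lemma uxx_zero {t y : ℝ} (hy0 : 0 ≤ y) (hy : y ≤ R) (h1 : T1 ≤ t) (h2 : t < T) :
    uxx 0 y t ≤ 0 := by
  have hR := H.hR
  have hd := (E.der (ed_lt (R := R) (T1 := T1) (T := T) (x := 0) (by simp; linarith) hy0 hy h1 h2)).2.2.2.1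
  have e0 := E.hux0 (ed_lt (R := R) (T1 := T1) (T := T) (x := 0) (by simp; linarith) hy0 hy h1 h2)
  have := right_deriv_ge (h0 := R) (c := 0) (hd.const_mul (-1)) hR ?_
  · linarith
  · intro s hs hs'
    rw [zero_add, e0]
    have := E.hmon (ed_lt (R := R) (T1 := T1) (T := T) (x := s) (by rw [abs_of_pos hs]; exact hs'.le) hy0 hy h1 h2)
    have := nonpos_of_mul_nonpos_right this hs
    linarith

lemma F3 {t A : ℝ} (hA : 0 < A) (h1 : T1 ≤ t) (h2 : t < T) (h0 : W p A ≤ uy 0 0 t) :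
    ∀ y ∈ Icc 0 R, W p (y+A) - (K+K^p)*y ≤ uy 0 y t := by
  have hR := H.hR
  have hK := E.hK
  have hp := H.hp
  have hg : gl R T1 T 0 t := gl_lt (by simp; linarith) h1 h2
  refine ode_low (v := fun y => uy 0 y t) (v' := fun y => uyy 0 y t) (Φ := fun y => (K+K^p)*y)
    (φ := fun _ => K+K^p) H.hp hA (v_cont H E hg) (by fun_prop)
    (fun y hy => (E.der (hg.ed hy.1.le hy.2.le)).2.2.2.2) ?_ ?_ ?_ h0
  · intro y _
    exact ((hasDerivAt_id y).const_mul (K+K^p)).congr_deriv (mul_one _)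
  · intro y hy
    have := hy.1
    positivity
  · intro y hy
    have he := hg.ed hy.1.le hy.2.le
    have e1 := E.pde he hy.1
    have e2 := uxx_zero H E hy.1.le hy.2.le h1 h2
    have e3 := (abs_le.mp (E.hut he)).1
    rw [E.hux0 he] at e1
    have e4 := E.huy he
    have e5 : ((0:ℝ)^2 + (uy 0 y t)^2)^(p/2) ≤ (max (uy 0 y t) 0)^p + K^p := by
      have : ((0:ℝ)^2 + (uy 0 y t)^2)^(p/2) = |uy 0 y t|^p := by
        rw [zero_pow two_ne_zero, zero_add, ← sq_abs, ← rpow_natCast, ← rpow_mul (abs_nonneg _)]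
        congr 1; push_cast; ring
      rw [this]
      rcases le_total 0 (uy 0 y t) with h | h
      · rw [abs_of_nonneg h, max_eq_left h]
        have : 0 ≤ K^p := by positivity
        linarith
      · rw [abs_of_nonpos h, max_eq_right h, zero_rpow (by linarith), zero_add]
        exact rpow_le_rpow (by linarith) (by linarith) (by linarith)
    linarith

lemma F3u {t A : ℝ} (hA : 0 < A) (h1 : T1 ≤ t) (h2 : t < T) (h0 : W p A ≤ uy 0 0 t) :
    ∀ y ∈ Icc 0 R, U p (y+A) - U p A - (K+K^p)*y^2 ≤ u 0 y t := by
  have hR := H.hR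
  have hK := E.hK
  have hp := H.hp
  have hg : gl R T1 T 0 t := gl_lt (by simp; linarith) h1 h2
  refine incr_le (g := fun y => u 0 y t) (g' := fun y => uy 0 y t)
    (f := fun y => U p (y+A) - U p A - (K+K^p)*y^2)
    (f' := fun y => W p (y+A) - 2*(K+K^p)*y) ?_ (u_cont H E hg) ?_
    (fun y hy => (E.der (hg.ed hy.1.le hy.2.le)).2.1) ?_ ?_
  · have := U_cont H.hp
    exact Continuous.continuousOn (by fun_prop)
  · intro y hy
    have := HasDerivAt.comp_add_const y A (U_der H.hp (show 0 < y + A by linarith [hy.1]))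
    exact (this.sub_const _).fun_sub (Ksq_der (K+K^p) y)
  · simp [E.bc (hg.ed le_rfl hR.le)]
  · intro y hy
    have := F3 H E hA h1 h2 h0 y (Ioo_subset_Icc_self hy)
    have hh : 0 ≤ (K+K^p)*y := by have := hy.1; positivity
    linarith
end


section
variable {p R T1 T K : ℝ} {u ux uy ut uxx uyy : ℝ → ℝ → ℝ → ℝ}
variable (H : Dat p R T1 T u ux uy ut uxx uyy) (E : Ex p R T1 T K u ux uy ut uxx uyy)
include H E

lemma mono_pos {x1 x2 y t : ℝ} (h : ∀ x ∈ Icc x1 x2, ed R T1 T x y t) (h0 : 0 ≤ x1)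
    (h12 : x1 ≤ x2) : u x2 y t ≤ u x1 y t := by
  have : AntitoneOn (fun x => u x y t) (Icc x1 x2) := by
    apply antitoneOn_of_hasDerivWithinAt_nonpos (convex_Icc _ _) (f' := fun x => ux x y t)
    · intro x hx
      exact (E.der (h x hx)).1.continuousAt.continuousWithinAt
    · intro x hx
      exact (E.der (h x (interior_subset hx))).1.hasDerivWithinAt
    · intro x hx
      rw [interior_Icc] at hx
      exact nonpos_of_mul_nonpos_right (E.hmon (h x (Ioo_subset_Icc_self hx))) (by linarith [hx.1])
  exact this (left_mem_Icc.mpr h12) (right_mem_Icc.mpr h12) h12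

lemma mono_neg {x1 x2 y t : ℝ} (h : ∀ x ∈ Icc x1 x2, ed R T1 T x y t) (h0 : x2 ≤ 0)
    (h12 : x1 ≤ x2) : u x1 y t ≤ u x2 y t := by
  have : MonotoneOn (fun x => u x y t) (Icc x1 x2) := by
    apply monotoneOn_of_hasDerivWithinAt_nonneg (convex_Icc _ _) (f' := fun x => ux x y t)
    · intro x hx
      exact (E.der (h x hx)).1.continuousAt.continuousWithinAt
    · intro x hx
      exact (E.der (h x (interior_subset hx))).1.hasDerivWithinAt
    · intro x hx
      rw [interior_Icc] at hx
      have := (E.hmon (h x (Ioo_subset_Icc_self hx)))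
      have h2 := hx.2
      by_contra hc
      push Not at hc
      nlinarith
  exact this (left_mem_Icc.mpr h12) (right_mem_Icc.mpr h12) h12

lemma u_le_zero {x y t : ℝ} (hx : |x| ≤ R) (h0 : 0 ≤ y) (hy : y ≤ R) (h1 : T1 ≤ t) (ht : t < T) :
    u x y t ≤ u 0 y t := by
  have hx' := abs_le.mp hx
  rcases le_total 0 x with h | h
  · exact mono_pos H E (fun s hs => ed_lt (by rw [abs_le]; constructor <;> linarith [hs.1, hs.2])
      h0 hy h1 ht) le_rfl h
  · exact mono_neg H E (fun s hs => ed_lt (by rw [abs_le]; constructor <;> linarith [hs.1, hs.2])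
      h0 hy h1 ht) le_rfl h

/-- comparison of normal derivatives -/
lemma uy_cmp {x1 x2 t : ℝ} (h1 : gl R T1 T x1 t) (h2 : gl R T1 T x2 t)
    (h : ∀ y, 0 < y → y < R → u x1 y t ≤ u x2 y t) : uy x1 0 t ≤ uy x2 0 t := by
  have hR := H.hR
  have d1 := (E.der (h1.ed le_rfl hR.le)).2.1
  have d2 := (E.der (h2.ed le_rfl hR.le)).2.1
  have := right_deriv_ge (h0 := R) (c := 0) (d2.fun_sub d1) hR ?_
  · linarith
  · intro s hs hs'
    rw [zero_add, E.bc (h1.ed le_rfl hR.le), E.bc (h2.ed le_rfl hR.le)]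
    linarith [h s hs hs']

lemma F6 (M : ℝ) {δ : ℝ} (hδ : 0 < δ) : ∃ t, T1 ≤ t ∧ T - δ < t ∧ t < T ∧ M ≤ uy 0 0 t := by
  have hR := H.hR
  have hK := E.hK
  set N := |M| + 2*K*R + K with hN
  have hN0 : 0 < N := by positivity
  obtain ⟨x, y, t, hd, hx, hy, htδ, ht, hM⟩ := H.blow ((K*R)^2 + N^2) (min δ R) (lt_min hδ hR)
  have hx' : |x| ≤ R := hx.le.trans (min_le_right _ _)
  have hy' : y ≤ R := hy.le.trans (min_le_right _ _)
  have hy0 : 0 ≤ y := hd.2.1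
  have h1 : T1 ≤ t := hd.2.2.2.1
  have hg : gl R T1 T x t := gl_lt hx' h1 ht
  have he := hg.ed hy0 hy'
  have a1 : (ux x y t)^2 ≤ (K*R)^2 := by
    apply sq_le_sq'
    · have := (abs_le.mp (E.hux he)).1
      nlinarith
    · have := (abs_le.mp (E.hux he)).2
      nlinarith
  have a2 : N < uy x y t := by
    have h3 : N^2 < (uy x y t)^2 := by linarith
    have h4 := lt_abs.mp ((sq_lt_sq.mp h3))
    rw [abs_of_pos hN0] at h4
    rcases h4 with h4 | h4
    · exact h4
    · have := E.huy he
      have : 0 ≤ |M| + 2*K*R := by positivity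
      linarith
  have a3 : uy x y t ≤ uy x 0 t + 2*K*y := by
    refine incr_le (f := fun y => uy x y t) (f' := fun y => uyy x y t)
      (g := fun y => uy x 0 t + 2*K*y) (g' := fun _ => 2*K) (v_cont H E hg) (by fun_prop)
      (fun y hy => (E.der (hg.ed hy.1.le hy.2.le)).2.2.2.2) ?_ (by simp) ?_ y ⟨hy0, hy'⟩
    · intro z hz
      exact (((hasDerivAt_id z).const_mul (2*K)).congr_deriv (mul_one _)).const_add _
    · intro z hz
      have := uyy_le H E hg hz
      have h0 : 0 ≤ (max (uy x z t) 0)^p := rpow_nonneg (le_max_right _ _) _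
      linarith
  have a4 : uy x 0 t ≤ uy 0 0 t := uy_cmp H E hg (gl_lt (by simp; linarith) h1 ht)
    (fun y hy0 hy' => u_le_zero H E hx' hy0.le hy'.le h1 ht)
  refine ⟨t, h1, ?_, ht, ?_⟩
  · have := min_le_left δ R
    linarith
  · have : 2*K*y ≤ 2*K*R := by nlinarith
    have := le_abs_self M
    linarith

lemma F7 {y t : ℝ} (hy0 : 0 ≤ y) (hy : y ≤ R) (h1 : T1 ≤ t) (ht : t < T) :
    U p y - (K+K^p)*y^2 - K*(T-t) ≤ u 0 y t := by
  have hR := H.hR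
  have hK := E.hK
  have hU := U_cont H.hp
  have key : ∀ A, 0 < A → U p (y+A) - U p A - (K+K^p)*y^2 - K*(T-t) ≤ u 0 y t := by
    intro A hA
    obtain ⟨s, hs1, hs2, hs3, hs4⟩ := F6 H E (W p A) (show 0 < T - t by linarith)
    have a := F3u H E hA hs1 hs3 hs4 y ⟨hy0, hy⟩
    have hts : t < s := by linarith
    have := (convex_Icc t s).norm_image_sub_le_of_norm_hasDerivWithin_le
      (f := fun s => u 0 y s) (f' := fun s => ut 0 y s) (C := K)
      (fun r hr => (E.der (ed_lt (by simp; linarith) hy0 hy (by linarith [hr.1])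
        (by linarith [hr.2]))).2.2.1.hasDerivWithinAt)
      (fun r hr => E.hut (ed_lt (by simp; linarith) hy0 hy (by linarith [hr.1])
        (by linarith [hr.2]))) (left_mem_Icc.mpr hts.le) (right_mem_Icc.mpr hts.le)
    simp only [Real.norm_eq_abs, abs_of_pos (show 0 < s - t by linarith)] at this
    have := (abs_le.mp this).2
    nlinarith
  have hl : Tendsto (fun A => U p (y+A) - U p A - (K+K^p)*y^2 - K*(T-t)) (nhdsWithin 0 (Ioi 0))
      (nhds (U p (y+0) - U p 0 - (K+K^p)*y^2 - K*(T-t))) := by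
    apply Tendsto.mono_left _ nhdsWithin_le_nhds
    exact Continuous.tendsto (by fun_prop) 0
  rw [add_zero, U_zero H.hp, sub_zero] at hl
  refine le_of_tendsto hl ?_
  filter_upwards [self_mem_nhdsWithin] with A hA using key A hA

lemma F7' {x y t : ℝ} (hx : |x| ≤ R) (hy0 : 0 ≤ y) (hy : y ≤ R) (h1 : T1 ≤ t) (ht : t < T) :
    U p y - (K+K^p)*y^2 - (K+K^p)*(x^2+(T-t)) ≤ u x y t := by
  have hR := H.hR
  have hK := E.hK
  have a := F7 H E hy0 hy h1 ht
  have := (convex_Icc (-|x|) |x|).norm_image_sub_le_of_norm_hasDerivWithin_le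
      (f := fun s => u s y t) (f' := fun s => ux s y t) (C := K*|x|)
      (fun r hr => (E.der (ed_lt ((abs_le.mpr hr).trans hx) hy0 hy h1 ht)).1.hasDerivWithinAt)
      (fun r hr => (E.hux (ed_lt ((abs_le.mpr hr).trans hx) hy0 hy h1 ht)).trans
        (mul_le_mul_of_nonneg_left (abs_le.mpr hr) (by linarith)))
      (show (0:ℝ) ∈ Icc (-|x|) |x| by constructor <;> linarith [abs_nonneg x])
      (show x ∈ Icc (-|x|) |x| from ⟨neg_abs_le x, le_abs_self x⟩)
  simp only [Real.norm_eq_abs, sub_zero] at this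
  have h3 := (abs_le.mp this).1
  have h4 : K*|x| * |x| = K*x^2 := by rw [mul_assoc, ← sq, sq_abs]
  have h5 : 0 ≤ K^p*(x^2+(T-t)) := by
    have : 0 < T - t := by linarith
    positivity
  nlinarith

/-- exponent n = (p-1)/(p-2) -/
lemma n_facts (hp : 2 < p) (hp3 : p ≤ 3) : 2 ≤ (p-1)/(p-2) ∧ (p-1)/(p-2) * (1 - bt p) = 1 := by
  constructor
  · rw [le_div_iff₀] <;> linarith
  · have h1 : p - 1 ≠ 0 := by linarith
    have h2 : p - 2 ≠ 0 := by linarith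
    unfold bt
    field_simp
    ring

lemma F8 : ∃ C > 0, ∃ τ0 > 0, τ0 ≤ 1 ∧ ∀ x t, |x| ≤ R → T1 ≤ t → t < T → x^2+(T-t) ≤ τ0 →
    W p (C * (x^2+(T-t))^((p-1)/(p-2))) ≤ uy x 0 t := by
  have hR := H.hR
  have hK := E.hK
  have hp := H.hp
  obtain ⟨hn2, hn⟩ := n_facts H E H.hp H.hp3
  set n := (p-1)/(p-2) with hndef
  have hb := bt_pos hp
  have hb1 := bt_lt hp
  set K' := K + K^p with hK'
  have hKp : 0 < K^p := by positivity
  have hK1 : 0 < K' := by positivity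
  have hd := dp_pos hp
  set κ := (2 - 2^(1-bt p)) * (bt p ^ bt p / (1 - bt p)) with hκ
  have h2 : (2:ℝ)^(1-bt p) < 2 := by
    conv_rhs => rw [← rpow_one 2]
    exact rpow_lt_rpow_of_exponent_lt (by norm_num) (by linarith)
  have hκ0 : 0 < κ := mul_pos (by linarith) (div_pos hd (by linarith))
  set C := (3*K'/κ)^n with hC
  have hC0 : 0 < C := rpow_pos_of_pos (by positivity) _
  have hC1 : C^(1-bt p) = 3*K'/κ := by
    rw [hC, ← rpow_mul (by positivity), hn, rpow_one]
  set τ0 := min 1 (min (1/(2*C^2)) (R/C)) with hτ0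
  have t1 : τ0 ≤ 1 := min_le_left _ _
  have t2 : τ0 ≤ 1/(2*C^2) := (min_le_right _ _).trans (min_le_left _ _)
  have t3 : τ0 ≤ R/C := (min_le_right _ _).trans (min_le_right _ _)
  refine ⟨C, hC0, τ0, by positivity, t1, ?_⟩
  intro x t hx ht ht' hτ
  set τ := x^2+(T-t) with hτd
  have hτp : 0 < τ := by have := sq_nonneg x; linarith
  set A := C*τ^n with hA
  have hAp : 0 < A := mul_pos hC0 (rpow_pos_of_pos hτp _)
  have hτn : τ^n ≤ τ^(2:ℝ) := rpow_le_rpow_of_exponent_ge hτp (by linarith) hn2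
  rw [rpow_two] at hτn
  have hτn1 : τ^n ≤ τ := by nlinarith
  have hAR : A ≤ R := by
    have : C*τ ≤ R := by
      have := (le_div_iff₀ hC0).mp (hτ.trans t3)
      linarith
    nlinarith
  by_contra hcon
  push Not at hcon
  have b1 := F4u H E (gl_lt hx ht ht') hAp hcon.le A ⟨hAp.le, hAR⟩
  have b2 := F7' H E hx hAp.le hAR ht ht'
  have e1 : U p A = (bt p ^ bt p / (1 - bt p)) * (3*K'/κ) * τ := by
    unfold U
    rw [hA, mul_rpow hC0.le (rpow_nonneg hτp.le _), hC1, ← rpow_mul hτp.le, hn, rpow_one]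
    ring
  have e2 : U p (A + A) = 2^(1-bt p) * U p A := by
    unfold U
    rw [← two_mul, mul_rpow (by norm_num) hAp.le]
    ring
  have e3 : (2 - 2^(1-bt p)) * U p A = 3*K'*τ := by
    rw [e1]
    have : (2 - 2^(1-bt p)) * (bt p ^ bt p / (1 - bt p) * (3*K'/κ) * τ) = κ * (3*K'/κ) * τ := by
      rw [hκ]; ring
    rw [this]; field_simp
  have e4 : A^2 ≤ τ/2 := by
    have h1 : 2*C^2*τ ≤ 1 := by
      have := (le_div_iff₀ (by positivity)).mp (hτ.trans t2)
      linarith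
    have h2 : A^2 ≤ C^2*τ^2 := by
      rw [hA, mul_pow]
      exact mul_le_mul_of_nonneg_left (pow_le_pow_left₀ (rpow_nonneg hτp.le _) hτn1 2) (sq_nonneg C)
    have h3 : C^2*τ^2 = (2*C^2*τ)*(τ/2) := by ring
    have h4 : (2*C^2*τ)*(τ/2) ≤ 1*(τ/2) := mul_le_mul_of_nonneg_right h1 (by linarith)
    linarith
  rw [e2] at b1
  rw [sub_mul] at e3
  have h5 : K*A^2 ≤ K'*A^2 := mul_le_mul_of_nonneg_right (by linarith) (sq_nonneg A)
  have h6 : K'*A^2 ≤ K'*(τ/2) := mul_le_mul_of_nonneg_left e4 hK1.le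
  have h7 : 0 < K'*τ := mul_pos hK1 hτp
  linarith
end


def CO (f : ℝ → ℝ → ℝ → ℝ) (a b c d t1 t2 : ℝ) : Prop :=
  ContinuousOn (fun q : ℝ × ℝ × ℝ => f q.1 q.2.1 q.2.2) (Icc a b ×ˢ Icc c d ×ˢ Icc t1 t2)

section
variable {p R T1 T K : ℝ} {u ux uy ut uxx uyy : ℝ → ℝ → ℝ → ℝ}

lemma VLpt (H : Dat p R T1 T u ux uy ut uxx uyy) {e1 e2 a b c d t1 t2 h x y t : ℝ}
    (ha : -R ≤ a) (hb : b ≤ R) (hc : 0 ≤ c) (hd : d ≤ R)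
    (ht1 : T1 ≤ t1) (ht2 : t2 < T) (hh : 0 < h) (hhR : h ≤ R) (he1 : -1 ≤ e1 ∧ e1 ≤ 1)
    (he2 : 0 ≤ e2) (he2' : e2 ≤ 1)
    {φ φx φy φt φxx φyy : ℝ → ℝ → ℝ → ℝ}
    (hder : ∀ x ∈ Ioo a b, ∀ y ∈ Ioo c d, ∀ t ∈ Ioc t1 t2, DerPk φ φx φy φt φxx φyy x y t)
    (hx : x ∈ Ioo a b) (hy : y ∈ Ioo c d) (ht : t ∈ Ioc t1 t2)
    (hm : ∀ x' ∈ Icc a b, ∀ y' ∈ Icc c d, ∀ t' ∈ Icc t1 t2,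
      (u (x+h*e1) (y+h*e2) t - u x y t) / h - φ x y t ≤
      (u (x'+h*e1) (y'+h*e2) t' - u x' y' t') / h - φ x' y' t') :
    p * ((ux x y t)^2 + (uy x y t)^2)^(p/2-1) * (ux x y t * φx x y t + uy x y t * φy x y t) ≤
      φt x y t - φxx x y t - φyy x y t := by
  have hdom : ∀ x ∈ Icc a b, ∀ y ∈ Icc c d, ∀ t ∈ Icc t1 t2, ∀ h, 0 ≤ h → h ≤ R →
      dom R T1 T (x+h*e1) (y+h*e2) t := by
    intro x hx y hy t ht h h0 h1
    refine dom_lt ?_ (by nlinarith [hy.1]) (by nlinarith [hy.2]) (by linarith [ht.1])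
      (by linarith [ht.2])
    rw [abs_le]; constructor <;> nlinarith [hx.1, hx.2]
  have hdom0 : ∀ x ∈ Icc a b, ∀ y ∈ Icc c d, ∀ t ∈ Icc t1 t2, dom R T1 T x y t := by
    intro x hx y hy t ht
    simpa using hdom x hx y hy t ht 0 le_rfl H.hR.le
  obtain ⟨r1, r2, r3, r4, r5⟩ := box_min
    (D := fun x y t => (u (x+h*e1) (y+h*e2) t - u x y t) / h - φ x y t)
    (Dx := fun x y t => (ux (x+h*e1) (y+h*e2) t - ux x y t) / h - φx x y t)
    (Dy := fun x y t => (uy (x+h*e1) (y+h*e2) t - uy x y t) / h - φy x y t)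
    (Dt := fun x y t => (ut (x+h*e1) (y+h*e2) t - ut x y t) / h - φt x y t)
    (Dxx := fun x y t => (uxx (x+h*e1) (y+h*e2) t - uxx x y t) / h - φxx x y t)
    (Dyy := fun x y t => (uyy (x+h*e1) (y+h*e2) t - uyy x y t) / h - φyy x y t) (by
      intro x hx y hy t ht
      obtain ⟨f1, f2, f3, f4, f5⟩ := hder x hx y hy t ht
      have hx := Ioo_subset_Icc_self hx
      have hy := Ioo_subset_Icc_self hy
      have ht := Ioc_subset_Icc_self ht
      obtain ⟨a1, a2, a3, a4, a5⟩ := H.der (hdom0 x hx y hy t ht)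
      obtain ⟨b1, b2, b3, b4, b5⟩ := H.der (hdom x hx y hy t ht h hh.le hhR)
      exact ⟨(((HasDerivAt.comp_add_const x (h*e1) b1).fun_sub a1).div_const h).fun_sub f1,
        (((HasDerivAt.comp_add_const y (h*e2) b2).fun_sub a2).div_const h).fun_sub f2,
        ((b3.fun_sub a3).div_const h).fun_sub f3,
        (((HasDerivAt.comp_add_const x (h*e1) b4).fun_sub a4).div_const h).fun_sub f4,
        (((HasDerivAt.comp_add_const y (h*e2) b5).fun_sub a5).div_const h).fun_sub f5⟩) hx hy ht hm
  have hx' := Ioo_subset_Icc_self hx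
  have hy' := Ioo_subset_Icc_self hy
  have ht' := Ioc_subset_Icc_self ht
  have hy0 : 0 < y := by linarith [hy.1]
  have p1 := H.pde (hdom0 x hx' y hy' t ht') hy0 (by linarith [ht.2])
  have p2 := H.pde (hdom x hx' y hy' t ht' h hh.le hhR) (by nlinarith) (by linarith [ht.2])
  have s1 : ux (x+h*e1) (y+h*e2) t - ux x y t = h * φx x y t := by
    have : (ux (x+h*e1) (y+h*e2) t - ux x y t) / h = φx x y t := by linarith
    rw [← this]; field_simp
  have s2 : uy (x+h*e1) (y+h*e2) t - uy x y t = h * φy x y t := by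
    have : (uy (x+h*e1) (y+h*e2) t - uy x y t) / h = φy x y t := by linarith
    rw [← this]; field_simp
  have cv := F_convex H.hp (ux x y t) (uy x y t) (ux (x+h*e1) (y+h*e2) t) (uy (x+h*e1) (y+h*e2) t)
  rw [s1, s2, ← p1, ← p2] at cv
  have s3 : h * φxx x y t ≤ uxx (x+h*e1) (y+h*e2) t - uxx x y t := by
    have := (le_div_iff₀ hh).mp (sub_nonneg.mp r3); linarith
  have s4 : h * φyy x y t ≤ uyy (x+h*e1) (y+h*e2) t - uyy x y t := by
    have := (le_div_iff₀ hh).mp (sub_nonneg.mp r4); linarith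
  have s5 : ut (x+h*e1) (y+h*e2) t - ut x y t ≤ h * φt x y t := by
    have := (div_le_iff₀ hh).mp (sub_nonpos.mp r5); linarith
  have : h * (p * ((ux x y t)^2 + (uy x y t)^2)^(p/2-1) * (ux x y t * φx x y t + uy x y t * φy x y t))
      ≤ h * (φt x y t - φxx x y t - φyy x y t) := by
    have : h * (p * ((ux x y t)^2 + (uy x y t)^2)^(p/2-1) *
      (ux x y t * φx x y t + uy x y t * φy x y t)) = p * ((ux x y t)^2 + (uy x y t)^2)^(p/2-1) *
      (ux x y t * (h*φx x y t) + uy x y t * (h*φy x y t)) := by ring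
    rw [this]
    linarith
  exact le_of_mul_le_mul_left this hh

/-- comparison principle for a directional derivative of `u` -/
lemma VL (H : Dat p R T1 T u ux uy ut uxx uyy) {e1 e2 a b c d t1 t2 : ℝ} (he1 : |e1| ≤ 1)
    (he2 : 0 ≤ e2) (he2' : e2 ≤ 1) (ha : -R ≤ a) (hb : b ≤ R) (hc : 0 ≤ c) (hd : d ≤ R)
    (ht1 : T1 ≤ t1) (ht2 : t2 < T) {z φ φx φy φt φxx φyy : ℝ → ℝ → ℝ → ℝ}
    (hzc : ∀ ⦃x y t⦄, dom R T1 T x y t →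
      ContinuousAt (fun q : ℝ × ℝ × ℝ => z q.1 q.2.1 q.2.2) (x, y, t))
    (hz : ∀ x ∈ Icc a b, ∀ y ∈ Icc c d, ∀ t ∈ Icc t1 t2, ∀ h, 0 < h → h ≤ R →
      ∃ θ, 0 ≤ θ ∧ θ ≤ h ∧ u (x+h*e1) (y+h*e2) t - u x y t = h * z (x+θ*e1) (y+θ*e2) t)
    (hder : ∀ x ∈ Ioo a b, ∀ y ∈ Ioo c d, ∀ t ∈ Ioc t1 t2, DerPk φ φx φy φt φxx φyy x y t)
    (cφ : CO φ a b c d t1 t2) (cφx : CO φx a b c d t1 t2) (cφy : CO φy a b c d t1 t2)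
    (cL : CO (fun x y t => φt x y t - φxx x y t - φyy x y t) a b c d t1 t2)
    (hbd : ∀ x ∈ Icc a b, ∀ y ∈ Icc c d, ∀ t ∈ Icc t1 t2,
      (x = a ∨ x = b ∨ y = c ∨ y = d ∨ t = t1) → φ x y t ≤ z x y t)
    (hin : ∀ x ∈ Ioo a b, ∀ y ∈ Ioo c d, ∀ t ∈ Ioc t1 t2, z x y t < φ x y t →
      φt x y t - φxx x y t - φyy x y t <
      p * ((ux x y t)^2 + (uy x y t)^2)^(p/2-1) * (ux x y t * φx x y t + uy x y t * φy x y t)) :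
    ∀ x ∈ Icc a b, ∀ y ∈ Icc c d, ∀ t ∈ Icc t1 t2, φ x y t ≤ z x y t := by
  intro xs hxs ys hys ts hts
  have hR := H.hR
  have hp := H.hp
  have he1' := abs_le.mp he1
  set B := Icc a b ×ˢ Icc c d ×ˢ Icc t1 t2 with hB
  have hBc : IsCompact B := isCompact_Icc.prod (isCompact_Icc.prod isCompact_Icc)
  have hdom : ∀ x ∈ Icc a b, ∀ y ∈ Icc c d, ∀ t ∈ Icc t1 t2, ∀ h, 0 ≤ h → h ≤ R →
      dom R T1 T (x+h*e1) (y+h*e2) t := by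
    intro x hx y hy t ht h h0 h1
    refine dom_lt ?_ (by nlinarith [hy.1]) (by nlinarith [hy.2]) (by linarith [ht.1])
      (by linarith [ht.2])
    rw [abs_le]; constructor <;> nlinarith [hx.1, hx.2]
  have hdom0 : ∀ x ∈ Icc a b, ∀ y ∈ Icc c d, ∀ t ∈ Icc t1 t2, dom R T1 T x y t := by
    intro x hx y hy t ht
    simpa using hdom x hx y hy t ht 0 le_rfl hR.le
  set h : ℕ → ℝ := fun k => R/((k:ℝ)+1) with hh
  have hpos : ∀ k, 0 < h k := fun k => by positivity
  have hle : ∀ k, h k ≤ R := fun k => by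
    rw [hh]; apply div_le_self hR.le; linarith [Nat.cast_nonneg (α := ℝ) k]
  have hlim : Tendsto h atTop (nhds 0) := by
    have := (tendsto_one_div_add_atTop_nhds_zero_nat (𝕜 := ℝ)).const_mul R
    simpa [hh, div_eq_mul_inv] using this
  -- difference quotients
  set D : ℕ → ℝ → ℝ → ℝ → ℝ := fun k x y t =>
    (u (x+h k*e1) (y+h k*e2) t - u x y t) / h k - φ x y t with hD
  have hDc : ∀ k, ContinuousOn (fun q : ℝ × ℝ × ℝ => D k q.1 q.2.1 q.2.2) B := by
    intro k
    refine ContinuousOn.sub ?_ cφ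
    rintro ⟨x, y, t⟩ ⟨hx, hy, ht⟩
    simp only at hx hy ht
    apply ContinuousAt.continuousWithinAt
    have c1 := H.cu (hdom0 x hx y hy t ht)
    have c2 := H.cu (hdom x hx y hy t ht (h k) (hpos k).le (hle k))
    have c3 : ContinuousAt (fun q : ℝ × ℝ × ℝ => u (q.1+h k*e1) (q.2.1+h k*e2) q.2.2) (x, y, t) :=
      ContinuousAt.comp (g := fun q : ℝ × ℝ × ℝ => u q.1 q.2.1 q.2.2)
        (f := fun q : ℝ × ℝ × ℝ => (q.1+h k*e1, q.2.1+h k*e2, q.2.2)) (x := (x, y, t)) c2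
        (by fun_prop)
    exact (c3.sub c1).div_const _
  have hex : ∀ k, ∃ q ∈ B, ∀ x ∈ Icc a b, ∀ y ∈ Icc c d, ∀ t ∈ Icc t1 t2,
      D k q.1 q.2.1 q.2.2 ≤ D k x y t := by
    intro k
    obtain ⟨x0, hx0, y0, hy0, t0, ht0, hm⟩ := box_exists_min (D := D k) (hxs.1.trans hxs.2)
      (hys.1.trans hys.2) (hts.1.trans hts.2) (hDc k)
    exact ⟨(x0, y0, t0), ⟨hx0, hy0, ht0⟩, hm⟩
  choose q hqB hqm using hex
  obtain ⟨Q, hQB, ψ, hψ, hQ⟩ := hBc.tendsto_subseq hqB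
  obtain ⟨hQx, hQy, hQt⟩ := hQB
  have hψ' := hψ.tendsto_atTop
  -- convergence along the shifted points
  have conv : ∀ (P : ℕ → ℝ × ℝ × ℝ) (P0 : ℝ × ℝ × ℝ), (∀ k, P k ∈ B) → P0 ∈ B →
      Tendsto P atTop (nhds P0) → Tendsto (fun k => D (ψ k) (P k).1 (P k).2.1 (P k).2.2) atTop
        (nhds (z P0.1 P0.2.1 P0.2.2 - φ P0.1 P0.2.1 P0.2.2)) := by
    intro P P0 hP hP0 hPP
    have hφl : Tendsto (fun k => φ (P k).1 (P k).2.1 (P k).2.2) atTop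
        (nhds (φ P0.1 P0.2.1 P0.2.2)) :=
      (cφ P0 hP0).tendsto.comp (tendsto_nhdsWithin_iff.mpr ⟨hPP, Eventually.of_forall hP⟩)
    have hth : ∀ k, ∃ θ, 0 ≤ θ ∧ θ ≤ h (ψ k) ∧
        u ((P k).1+h (ψ k)*e1) ((P k).2.1+h (ψ k)*e2) (P k).2.2 - u (P k).1 (P k).2.1 (P k).2.2 =
        h (ψ k) * z ((P k).1+θ*e1) ((P k).2.1+θ*e2) (P k).2.2 :=
      fun k => hz _ (hP k).1 _ (hP k).2.1 _ (hP k).2.2 _ (hpos _) (hle _)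
    choose θ hθ0 hθ1 hθ using hth
    have hθl : Tendsto θ atTop (nhds 0) :=
      tendsto_of_tendsto_of_tendsto_of_le_of_le tendsto_const_nhds (hlim.comp hψ') hθ0 hθ1
    have hsh : Tendsto (fun k => ((P k).1+θ k*e1, (P k).2.1+θ k*e2, (P k).2.2)) atTop
        (nhds (P0.1+0*e1, P0.2.1+0*e2, P0.2.2)) := by
      refine Tendsto.prodMk_nhds ?_ (Tendsto.prodMk_nhds ?_ ?_)
      · exact ((continuous_fst.tendsto _).comp hPP).add (hθl.mul_const e1)
      · exact (((continuous_fst.comp continuous_snd).tendsto _).comp hPP).add (hθl.mul_const e2)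
      · exact (((continuous_snd.comp continuous_snd).tendsto _).comp hPP)
    rw [zero_mul, zero_mul, add_zero, add_zero] at hsh
    have hzl := (hzc (hdom0 _ hP0.1 _ hP0.2.1 _ hP0.2.2)).tendsto.comp hsh
    have : (fun k => D (ψ k) (P k).1 (P k).2.1 (P k).2.2) = fun k =>
        z ((P k).1+θ k*e1) ((P k).2.1+θ k*e2) (P k).2.2 - φ (P k).1 (P k).2.1 (P k).2.2 := by
      funext k
      simp only [hD]
      rw [hθ k, mul_div_cancel_left₀ _ (hpos _).ne']
    rw [this]
    exact hzl.sub hφl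
  have L1 := conv (q ∘ ψ) Q (fun k => hqB _) ⟨hQx, hQy, hQt⟩ hQ
  have L2 := conv (fun _ => (xs, ys, ts)) (xs, ys, ts) (fun k => ⟨hxs, hys, hts⟩)
    ⟨hxs, hys, hts⟩ tendsto_const_nhds
  have hmin : z Q.1 Q.2.1 Q.2.2 - φ Q.1 Q.2.1 Q.2.2 ≤ z xs ys ts - φ xs ys ts :=
    le_of_tendsto_of_tendsto' L1 L2 (fun k => hqm (ψ k) xs hxs ys hys ts hts)
  by_contra hcon
  push Not at hcon
  have hneg : z Q.1 Q.2.1 Q.2.2 < φ Q.1 Q.2.1 Q.2.2 := by linarith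
  have hint : ¬ (Q.1 = a ∨ Q.1 = b ∨ Q.2.1 = c ∨ Q.2.1 = d ∨ Q.2.2 = t1) := fun hb =>
    absurd (hbd _ hQx _ hQy _ hQt hb) (not_le.mpr hneg)
  push Not at hint
  obtain ⟨n1, n2, n3, n4, n5⟩ := hint
  have hQx' : Q.1 ∈ Ioo a b := ⟨lt_of_le_of_ne hQx.1 (Ne.symm n1), lt_of_le_of_ne hQx.2 n2⟩
  have hQy' : Q.2.1 ∈ Ioo c d := ⟨lt_of_le_of_ne hQy.1 (Ne.symm n3), lt_of_le_of_ne hQy.2 n4⟩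
  have hQt' : Q.2.2 ∈ Ioc t1 t2 := ⟨lt_of_le_of_ne hQt.1 (Ne.symm n5), hQt.2⟩
  have hQ1 : Tendsto (fun k => (q (ψ k)).1) atTop (nhds Q.1) := (continuous_fst.tendsto _).comp hQ
  have hQ2 : Tendsto (fun k => (q (ψ k)).2.1) atTop (nhds Q.2.1) :=
    ((continuous_fst.comp continuous_snd).tendsto _).comp hQ
  have hQ3 : Tendsto (fun k => (q (ψ k)).2.2) atTop (nhds Q.2.2) :=
    ((continuous_snd.comp continuous_snd).tendsto _).comp hQ
  have key : ∀ᶠ k in atTop, p * ((ux (q (ψ k)).1 (q (ψ k)).2.1 (q (ψ k)).2.2)^2 +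
      (uy (q (ψ k)).1 (q (ψ k)).2.1 (q (ψ k)).2.2)^2)^(p/2-1) *
      (ux (q (ψ k)).1 (q (ψ k)).2.1 (q (ψ k)).2.2 * φx (q (ψ k)).1 (q (ψ k)).2.1 (q (ψ k)).2.2
      + uy (q (ψ k)).1 (q (ψ k)).2.1 (q (ψ k)).2.2 * φy (q (ψ k)).1 (q (ψ k)).2.1 (q (ψ k)).2.2) ≤
      φt (q (ψ k)).1 (q (ψ k)).2.1 (q (ψ k)).2.2 - φxx (q (ψ k)).1 (q (ψ k)).2.1 (q (ψ k)).2.2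
      - φyy (q (ψ k)).1 (q (ψ k)).2.1 (q (ψ k)).2.2 := by
    filter_upwards [hQ1.eventually (Ioo_mem_nhds hQx'.1 hQx'.2),
      hQ2.eventually (Ioo_mem_nhds hQy'.1 hQy'.2), hQ3.eventually (Ioi_mem_nhds hQt'.1)] with k k1 k2 k3
    exact VLpt H ha hb hc hd ht1 ht2 (hpos (ψ k)) (hle (ψ k)) he1' he2 he2' hder k1 k2
      ⟨k3, (hqB (ψ k)).2.2.2⟩ (hqm (ψ k))
  have gx := (H.cux (hdom0 _ hQx _ hQy _ hQt)).tendsto.comp hQ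
  have gy := (H.cuy (hdom0 _ hQx _ hQy _ hQt)).tendsto.comp hQ
  have hQw : Tendsto (q ∘ ψ) atTop (nhdsWithin Q B) :=
    tendsto_nhdsWithin_iff.mpr ⟨hQ, Eventually.of_forall (fun k => hqB _)⟩
  have g1 := (cφx Q ⟨hQx, hQy, hQt⟩).tendsto.comp hQw
  have g2 := (cφy Q ⟨hQx, hQy, hQt⟩).tendsto.comp hQw
  have g3 := (cL Q ⟨hQx, hQy, hQt⟩).tendsto.comp hQw
  have gl := (((gx.pow 2).add (gy.pow 2)).rpow_const (p := p/2-1) (Or.inr (by linarith))).const_mul p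
  have := le_of_tendsto_of_tendsto (gl.mul ((gx.mul g1).add (gy.mul g2))) g3 key
  have h2 := hin _ hQx' _ hQy' _ hQt' hneg
  exact absurd this (not_le.mpr h2)

lemma VLy (H : Dat p R T1 T u ux uy ut uxx uyy) {a b c d t1 t2 : ℝ}
    (ha : -R ≤ a) (hb : b ≤ R) (hc : 0 ≤ c) (hd : d ≤ R)
    (ht1 : T1 ≤ t1) (ht2 : t2 < T) {φ φx φy φt φxx φyy : ℝ → ℝ → ℝ → ℝ}
    (hder : ∀ x ∈ Ioo a b, ∀ y ∈ Ioo c d, ∀ t ∈ Ioc t1 t2, DerPk φ φx φy φt φxx φyy x y t)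
    (cφ : CO φ a b c d t1 t2) (cφx : CO φx a b c d t1 t2) (cφy : CO φy a b c d t1 t2)
    (cL : CO (fun x y t => φt x y t - φxx x y t - φyy x y t) a b c d t1 t2)
    (hbd : ∀ x ∈ Icc a b, ∀ y ∈ Icc c d, ∀ t ∈ Icc t1 t2,
      (x = a ∨ x = b ∨ y = c ∨ y = d ∨ t = t1) → φ x y t ≤ uy x y t)
    (hin : ∀ x ∈ Ioo a b, ∀ y ∈ Ioo c d, ∀ t ∈ Ioc t1 t2, uy x y t < φ x y t →
      φt x y t - φxx x y t - φyy x y t <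
      p * ((ux x y t)^2 + (uy x y t)^2)^(p/2-1) * (ux x y t * φx x y t + uy x y t * φy x y t)) :
    ∀ x ∈ Icc a b, ∀ y ∈ Icc c d, ∀ t ∈ Icc t1 t2, φ x y t ≤ uy x y t := by
  refine VL H (e1 := 0) (e2 := 1) (by simp) (by simp) le_rfl ha hb hc hd ht1 ht2 H.cuy ?_ hder cφ
    cφx cφy cL hbd hin
  intro x hx y hy t ht h h0 h1
  have hdm : ∀ s ∈ Icc y (y+h), dom R T1 T x s t := fun s hs => dom_lt
    (by rw [abs_le]; constructor <;> linarith [hx.1, hx.2, H.hR]) (by linarith [hy.1, hs.1])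
    (by linarith [hy.2, hs.2]) (by linarith [ht.1]) (by linarith [ht.2])
  obtain ⟨ξ, hξ, e⟩ := exists_hasDerivAt_eq_slope (fun s => u x s t) (fun s => uy x s t)
    (show y < y + h by linarith)
    (fun s hs => (H.der (hdm s hs)).2.1.continuousAt.continuousWithinAt)
    (fun s hs => (H.der (hdm s (Ioo_subset_Icc_self hs))).2.1)
  refine ⟨ξ - y, by linarith [hξ.1], by linarith [hξ.2], ?_⟩
  simp only [mul_zero, add_zero, mul_one]
  rw [show y + (ξ - y) = ξ by ring, e, show y + h - y = h by ring]
  field_simp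

lemma VLx (H : Dat p R T1 T u ux uy ut uxx uyy) {a b c d t1 t2 : ℝ}
    (ha : -R ≤ a) (hb : b ≤ R) (hc : 0 ≤ c) (hd : d ≤ R)
    (ht1 : T1 ≤ t1) (ht2 : t2 < T) {φ φx φy φt φxx φyy : ℝ → ℝ → ℝ → ℝ}
    (hder : ∀ x ∈ Ioo a b, ∀ y ∈ Ioo c d, ∀ t ∈ Ioc t1 t2, DerPk φ φx φy φt φxx φyy x y t)
    (cφ : CO φ a b c d t1 t2) (cφx : CO φx a b c d t1 t2) (cφy : CO φy a b c d t1 t2)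
    (cL : CO (fun x y t => φt x y t - φxx x y t - φyy x y t) a b c d t1 t2)
    (hbd : ∀ x ∈ Icc a b, ∀ y ∈ Icc c d, ∀ t ∈ Icc t1 t2,
      (x = a ∨ x = b ∨ y = c ∨ y = d ∨ t = t1) → φ x y t ≤ -ux x y t)
    (hin : ∀ x ∈ Ioo a b, ∀ y ∈ Ioo c d, ∀ t ∈ Ioc t1 t2, -ux x y t < φ x y t →
      φt x y t - φxx x y t - φyy x y t <
      p * ((ux x y t)^2 + (uy x y t)^2)^(p/2-1) * (ux x y t * φx x y t + uy x y t * φy x y t)) :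
    ∀ x ∈ Icc a b, ∀ y ∈ Icc c d, ∀ t ∈ Icc t1 t2, φ x y t ≤ -ux x y t := by
  refine VL H (e1 := -1) (e2 := 0) (z := fun x y t => -ux x y t) (by simp) le_rfl (by simp) ha hb hc
    hd ht1 ht2 (fun x y t h => (H.cux h).neg) ?_ hder cφ cφx cφy cL hbd hin
  intro x hx y hy t ht h h0 h1
  have hdm : ∀ s ∈ Icc (x-h) x, dom R T1 T s y t := fun s hs => dom_lt
    (by rw [abs_le]; constructor <;> linarith [hx.1, hx.2, H.hR, hs.1, hs.2]) (by linarith [hy.1])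
    (by linarith [hy.2, H.hR]) (by linarith [ht.1]) (by linarith [ht.2])
  obtain ⟨ξ, hξ, e⟩ := exists_hasDerivAt_eq_slope (fun s => u s y t) (fun s => ux s y t)
    (show x - h < x by linarith)
    (fun s hs => (H.der (hdm s hs)).1.continuousAt.continuousWithinAt)
    (fun s hs => (H.der (hdm s (Ioo_subset_Icc_self hs))).1)
  refine ⟨x - ξ, by linarith [hξ.2], by linarith [hξ.1], ?_⟩
  simp only [mul_zero, add_zero]
  rw [show x + (x - ξ)*(-1) = ξ by ring, e, show x - (x - h) = h by ring,
    show x + h * -1 = x - h by ring]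
  field_simp
  ring_nf
end


lemma CO_of {f : ℝ → ℝ → ℝ → ℝ} {a b c d t1 t2 : ℝ}
    (h : ∀ x ∈ Icc a b, ∀ y ∈ Icc c d, ∀ t ∈ Icc t1 t2,
      ContinuousAt (fun q : ℝ × ℝ × ℝ => f q.1 q.2.1 q.2.2) (x, y, t)) : CO f a b c d t1 t2 := by
  rintro ⟨x, y, t⟩ ⟨hx, hy, ht⟩
  exact (h x hx y hy t ht).continuousWithinAt

/-- algebraic core of the lower barrier -/
lemma core10 {p K C1 C3 v b w : ℝ} (hp : 2 < p) (hp3 : p ≤ 3) (hK : 1 ≤ K) (hC1 : 0 ≤ C1)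
    (hC3 : C1 + K^2 + K + 2 ≤ C3) (hv : -K ≤ v) (hvw : v < w - C3) (hb : b^2 ≤ K^2) :
    p * (b^2+v^2)^(p/2-1) * v + C1 < p * w^(p-1) := by
  have hw1 : 1 < w := by nlinarith
  have hw2 : C1 + K^2 + 2 < w := by linarith
  have hww : w ≤ w^(p-1) := by
    conv_lhs => rw [← rpow_one w]
    exact rpow_le_rpow_of_exponent_le hw1.le (by linarith)
  have hG0 : 0 ≤ (b^2+v^2)^(p/2-1) := by positivity
  rcases le_or_gt v 1 with h1 | h1
  · have h2 : (b^2+v^2)^(p/2-1) * v ≤ K^2+1 := by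
      rcases le_or_gt v 0 with h0 | h0
      · nlinarith
      · have : (b^2+v^2)^(p/2-1) ≤ (K^2+1)^(p/2-1) :=
          rpow_le_rpow (by positivity) (by nlinarith) (by linarith)
        have h3 : (K^2+1)^(p/2-1) ≤ (K^2+1)^(1:ℝ) :=
          rpow_le_rpow_of_exponent_le (by nlinarith) (by linarith)
        rw [rpow_one] at h3
        nlinarith
    nlinarith
  · have hv0 : 0 < v := by linarith
    have e1 : (b^2+v^2)^(p/2-1) = v^(p-2) * (1 + b^2/v^2)^(p/2-1) := by
      have : b^2+v^2 = v^2*(1+b^2/v^2) := by field_simp; ring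
      rw [this, mul_rpow (by positivity) (by positivity), ← rpow_natCast v 2, ← rpow_mul hv0.le]
      congr 2; push_cast; ring
    have e2 : (1 + b^2/v^2)^(p/2-1) ≤ 1 + b^2/v^2 := by
      conv_rhs => rw [← rpow_one (1 + b^2/v^2)]
      apply rpow_le_rpow_of_exponent_le _ (by linarith)
      have : 0 ≤ b^2/v^2 := by positivity
      linarith
    have e3 : v^(p-2) ≤ v := by
      conv_rhs => rw [← rpow_one v]
      exact rpow_le_rpow_of_exponent_le h1.le (by linarith)
    have e4 : v^(p-2) * v = v^(p-1) := by
      rw [← rpow_add_one hv0.ne']; congr 1; ring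
    have hvp : 0 < v^(p-2) := rpow_pos_of_pos hv0 _
    have e5 : (b^2+v^2)^(p/2-1) * v ≤ v^(p-1) + K^2 := by
      rw [e1]
      have a1 : v^(p-2) * (1 + b^2/v^2)^(p/2-1) * v ≤ v^(p-2) * (1 + b^2/v^2) * v := by
        gcongr
      have a2 : v^(p-2) * (1 + b^2/v^2) * v = v^(p-1) + (v^(p-2)/v)*b^2 := by
        rw [← e4]; field_simp
      have a3 : v^(p-2)/v ≤ 1 := by rw [div_le_one hv0]; exact e3
      have a4 : (v^(p-2)/v)*b^2 ≤ 1 * b^2 := mul_le_mul_of_nonneg_right a3 (sq_nonneg b)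
      linarith
    have e6 : v^(p-1) + C3 ≤ w^(p-1) := by
      have a0 : w^(p-1) = w^(p-2)*w := by
        rw [← rpow_add_one (by linarith)]; congr 1; ring
      have a1 : v^(p-2) ≤ w^(p-2) := rpow_le_rpow hv0.le (by nlinarith) (by linarith)
      have a2 : 1 ≤ w^(p-2) := one_le_rpow hw1.le (by linarith)
      rw [a0, ← e4]
      have a3 : v^(p-2)*v ≤ w^(p-2)*v := mul_le_mul_of_nonneg_right a1 hv0.le
      have a4 : w^(p-2)*(v+C3) ≤ w^(p-2)*w := mul_le_mul_of_nonneg_left (by linarith) (by linarith)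
      have a5 : 0 ≤ C3 := by nlinarith
      nlinarith
    have : p * ((b^2+v^2)^(p/2-1) * v) ≤ p*(w^(p-1) - C3 + K^2) :=
      mul_le_mul_of_nonneg_left (by linarith) (by linarith)
    nlinarith

section
variable {p R T1 T K : ℝ} {u ux uy ut uxx uyy : ℝ → ℝ → ℝ → ℝ}

section barrier
variable (p T C C3 : ℝ)
def b10n : ℝ := (p-1)/(p-2)
def b10s (x t : ℝ) : ℝ := x^2+(T-t)
def b10ξ (x y t : ℝ) : ℝ := y + C*(b10s T x t)^(b10n p)
def b10 (x y t : ℝ) : ℝ := W p (b10ξ p T C x y t) - C3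
def b10ξx (x t : ℝ) : ℝ := C*(2*x*b10n p*(b10s T x t)^(b10n p - 1))
def b10x (x y t : ℝ) : ℝ := -(W p (b10ξ p T C x y t))^p * b10ξx p T C x t
def b10y (x y t : ℝ) : ℝ := -(W p (b10ξ p T C x y t))^p
def b10t (x y t : ℝ) : ℝ := (W p (b10ξ p T C x y t))^p * (C*(b10n p*(b10s T x t)^(b10n p - 1)))
def b10yy (x y t : ℝ) : ℝ := (p*(W p (b10ξ p T C x y t))^(p-1))*(W p (b10ξ p T C x y t))^p
def b10ξxx (x t : ℝ) : ℝ := C*(2*b10n p*(b10s T x t)^(b10n p - 1)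
  + 2*x*b10n p*(2*x*(b10n p-1)*(b10s T x t)^(b10n p - 2)))
def b10xx (x y t : ℝ) : ℝ := (p*(W p (b10ξ p T C x y t))^(p-1))*(W p (b10ξ p T C x y t))^p *
  (b10ξx p T C x t)^2 - (W p (b10ξ p T C x y t))^p * b10ξxx p T C x t
end barrier

lemma Wp_der (hp : 2 < p) {s : ℝ} (hs : 0 < s) :
    HasDerivAt (fun s => -(W p s)^p) ((p*(W p s)^(p-1))*(W p s)^p) s := by
  have := ((W_der hp hs).rpow_const (p := p) (Or.inl (W_pos hp hs).ne')).neg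
  exact this.congr_deriv (by ring)

lemma pow_s_x {T x t a : ℝ} (h : 0 < b10s T x t) :
    HasDerivAt (fun x => (b10s T x t)^a) (2*x*a*(b10s T x t)^(a-1)) x := by
  have h1 : HasDerivAt (fun x => b10s T x t) (2*x) x := by
    unfold b10s
    exact ((hasDerivAt_pow 2 x).add_const _).congr_deriv (by push_cast; ring)
  exact h1.rpow_const (Or.inl h.ne')

lemma pow_s_t {T x t a : ℝ} (h : 0 < b10s T x t) :
    HasDerivAt (fun t => (b10s T x t)^a) (-(a*(b10s T x t)^(a-1))) t := by
  have h1 : HasDerivAt (fun t => b10s T x t) (-1) t := by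
    unfold b10s
    exact (((hasDerivAt_id t).const_sub T).const_add _)
  exact (h1.rpow_const (p := a) (Or.inl h.ne')).congr_deriv (by ring)

lemma b10_der (hp : 2 < p) {C C3 x y t : ℝ} (hC : 0 < C) (hy : 0 ≤ y) (h : 0 < b10s T x t) :
    DerPk (b10 p T C C3) (b10x p T C) (b10y p T C) (b10t p T C) (b10xx p T C) (b10yy p T C) x y t := by
  have hξ : 0 < b10ξ p T C x y t := by unfold b10ξ; positivity
  have dx : HasDerivAt (fun x => b10ξ p T C x y t) (b10ξx p T C x t) x :=
    ((pow_s_x h).const_mul C).const_add y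
  have dy : HasDerivAt (fun y => b10ξ p T C x y t) 1 y := (hasDerivAt_id y).add_const _
  have dt : HasDerivAt (fun t => b10ξ p T C x y t) (C*(-(b10n p*(b10s T x t)^(b10n p - 1)))) t :=
    ((pow_s_t h).const_mul C).const_add y
  have dxx : HasDerivAt (fun x => b10ξx p T C x t) (b10ξxx p T C x t) x := by
    have a1 := (((hasDerivAt_id x).const_mul 2).mul_const (b10n p)).fun_mul
      (pow_s_x (a := b10n p - 1) h)
    refine (a1.const_mul C).congr_deriv ?_
    unfold b10ξxx
    rw [show b10n p - 1 - 1 = b10n p - 2 by ring]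
    simp only [id]
    ring
  refine ⟨?_, ?_, ?_, ?_, ?_⟩
  · exact (HasDerivAt.comp x (W_der hp hξ) dx).sub_const _
  · exact ((HasDerivAt.comp y (W_der hp hξ) dy).sub_const _).congr_deriv (by unfold b10y; ring)
  · exact ((HasDerivAt.comp t (W_der hp hξ) dt).sub_const _).congr_deriv (by unfold b10t; ring)
  · have := (HasDerivAt.comp x (Wp_der hp hξ) dx).fun_mul dxx
    refine this.congr_deriv ?_
    unfold b10xx
    simp only [Function.comp]
    ring
  · exact (HasDerivAt.comp y (Wp_der hp hξ) dy).congr_deriv (by unfold b10yy; ring)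

lemma b10_cont (hp : 2 < p) {C C3 a b c d t1 t2 : ℝ} (hC : 0 < C) (hc : 0 ≤ c) (h2 : t2 < T) :
    CO (b10 p T C C3) a b c d t1 t2 ∧ CO (b10x p T C) a b c d t1 t2 ∧
    CO (b10y p T C) a b c d t1 t2 ∧
    CO (fun x y t => b10t p T C x y t - b10xx p T C x y t - b10yy p T C x y t) a b c d t1 t2 := by
  have main : ∀ x ∈ Icc a b, ∀ y ∈ Icc c d, ∀ t ∈ Icc t1 t2,
      (∀ e : ℝ, ContinuousAt (fun q : ℝ × ℝ × ℝ => (b10s T q.1 q.2.2)^e) (x, y, t)) ∧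
      ContinuousAt (fun q : ℝ × ℝ × ℝ => W p (b10ξ p T C q.1 q.2.1 q.2.2)) (x, y, t) ∧
      (∀ e : ℝ, ContinuousAt (fun q : ℝ × ℝ × ℝ => (W p (b10ξ p T C q.1 q.2.1 q.2.2))^e) (x, y, t)) := by
    intro x hx y hy t ht
    have hs : 0 < b10s T x t := by unfold b10s; nlinarith [sq_nonneg x, ht.2]
    have hy0 : 0 ≤ y := by linarith [hy.1]
    have hξ : 0 < b10ξ p T C x y t := by unfold b10ξ; positivity
    have c0 : ContinuousAt (fun q : ℝ × ℝ × ℝ => b10s T q.1 q.2.2) (x, y, t) := by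
      unfold b10s; fun_prop
    have c1 : ∀ e : ℝ, ContinuousAt (fun q : ℝ × ℝ × ℝ => (b10s T q.1 q.2.2)^e) (x, y, t) :=
      fun e => c0.rpow_const (Or.inl hs.ne')
    have c2 : ContinuousAt (fun q : ℝ × ℝ × ℝ => b10ξ p T C q.1 q.2.1 q.2.2) (x, y, t) := by
      unfold b10ξ
      have : ContinuousAt (fun q : ℝ × ℝ × ℝ => q.2.1) (x, y, t) := by fun_prop
      exact this.add (continuousAt_const.mul (c1 _))
    have c3 : ContinuousAt (fun q : ℝ × ℝ × ℝ => W p (b10ξ p T C q.1 q.2.1 q.2.2)) (x, y, t) :=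
      ContinuousAt.comp (g := W p) (f := fun q : ℝ × ℝ × ℝ => b10ξ p T C q.1 q.2.1 q.2.2)
        (x := (x, y, t)) (W_contAt hp hξ) c2
    exact ⟨c1, c3, fun e => c3.rpow_const (Or.inl (W_pos hp hξ).ne')⟩
  have cx : ∀ x y t : ℝ, ContinuousAt (fun q : ℝ × ℝ × ℝ => q.1) (x, y, t) := by
    intros; fun_prop
  have cξx : ∀ x ∈ Icc a b, ∀ y ∈ Icc c d, ∀ t ∈ Icc t1 t2,
      ContinuousAt (fun q : ℝ × ℝ × ℝ => b10ξx p T C q.1 q.2.2) (x, y, t) := by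
    intro x hx y hy t ht
    obtain ⟨m1, m2, m3⟩ := main x hx y hy t ht
    exact continuousAt_const.mul (((continuousAt_const.mul (cx x y t)).mul continuousAt_const).mul (m1 _))
  refine ⟨CO_of ?_, CO_of ?_, CO_of ?_, CO_of ?_⟩
  all_goals
    intro x hx y hy t ht
    obtain ⟨m1, m2, m3⟩ := main x hx y hy t ht
    have m4 := cξx x hx y hy t ht
  · exact m2.sub continuousAt_const
  · exact (m3 _).neg.mul m4
  · exact (m3 _).neg
  · have k1 : ContinuousAt (fun q : ℝ × ℝ × ℝ => b10t p T C q.1 q.2.1 q.2.2) (x, y, t) :=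
      (m3 _).mul (continuousAt_const.mul (continuousAt_const.mul (m1 _)))
    have k2 : ContinuousAt (fun q : ℝ × ℝ × ℝ => b10yy p T C q.1 q.2.1 q.2.2) (x, y, t) :=
      (continuousAt_const.mul (m3 _)).mul (m3 _)
    have k4 : ContinuousAt (fun q : ℝ × ℝ × ℝ => b10ξxx p T C q.1 q.2.2) (x, y, t) := by
      have c1 : ContinuousAt (fun q : ℝ × ℝ × ℝ => 2*q.1*b10n p) (x, y, t) := by fun_prop
      have c2 : ContinuousAt (fun q : ℝ × ℝ × ℝ => 2*q.1*(b10n p-1)) (x, y, t) := by fun_prop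
      exact continuousAt_const.mul ((continuousAt_const.mul (m1 _)).add (c1.mul (c2.mul (m1 _))))
    have k3 : ContinuousAt (fun q : ℝ × ℝ × ℝ => b10xx p T C q.1 q.2.1 q.2.2) (x, y, t) :=
      (((continuousAt_const.mul (m3 _)).mul (m3 _)).mul (m4.pow 2)).sub ((m3 _).mul k4)
    exact (k1.sub k3).sub k2
end


section
variable {p R T1 T K : ℝ} {u ux uy ut uxx uyy : ℝ → ℝ → ℝ → ℝ}
variable (H : Dat p R T1 T u ux uy ut uxx uyy) (E : Ex p R T1 T K u ux uy ut uxx uyy)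
include H E

lemma F10_in {C C3 x y t : ℝ} (hC : 0 < C)
    (hC3 : C*b10n p*(3+4*(b10n p-1)) + K^2 + K + 2 ≤ C3)
    (he : ed R T1 T x y t) (ht : t < T) (hx : |x| ≤ 1) (hs : b10s T x t ≤ 1)
    (hlt : uy x y t < b10 p T C C3 x y t) :
      b10t p T C x y t - b10xx p T C x y t - b10yy p T C x y t <
      p * ((ux x y t)^2 + (uy x y t)^2)^(p/2-1) *
        (ux x y t * b10x p T C x y t + uy x y t * b10y p T C x y t) := by
  have hp := H.hp
  have hK := E.hK
  have hn : 2 ≤ b10n p := (n_facts H E H.hp H.hp3).1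
  have hs0 : 0 < b10s T x t := by unfold b10s; nlinarith [sq_nonneg x]
  have hξ : 0 < b10ξ p T C x y t := by
    have := he.2.1
    unfold b10ξ; positivity
  have hw := W_pos hp hξ
  have hux := E.hux he
  have hb : (ux x y t)^2 ≤ K^2 := by
    rw [sq_le_sq, abs_of_pos (show 0 < K by linarith)]
    nlinarith [abs_nonneg x]
  have hx2 : x^2 ≤ 1 := by rw [← sq_abs]; nlinarith [abs_nonneg x]
  have p1 : (b10s T x t)^(b10n p - 1) ≤ 1 := rpow_le_one hs0.le hs (by linarith)
  have p2 : (b10s T x t)^(b10n p - 2) ≤ 1 := rpow_le_one hs0.le hs (by linarith)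
  have p1' : 0 < (b10s T x t)^(b10n p - 1) := by positivity
  have p2' : 0 < (b10s T x t)^(b10n p - 2) := by positivity
  have q1 : C*(b10n p*(b10s T x t)^(b10n p - 1)) ≤ C*(b10n p * 1) := by gcongr
  have q2 : b10ξxx p T C x t ≤ C*(2*b10n p*1 + 4*b10n p*(b10n p-1)*1) := by
    unfold b10ξxx
    have : 2*x*b10n p*(2*x*(b10n p-1)*(b10s T x t)^(b10n p - 2)) =
      4*b10n p*(b10n p-1)*(x^2*(b10s T x t)^(b10n p - 2)) := by ring
    rw [this]
    have : x^2*(b10s T x t)^(b10n p - 2) ≤ 1 := mul_le_one₀ hx2 p2'.le p2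
    have h4 : 0 ≤ 4*b10n p*(b10n p-1) := by nlinarith
    gcongr
  have q3 : ux x y t * b10ξx p T C x t ≤ 0 := by
    have := E.hmon he
    have e : ux x y t * b10ξx p T C x t = (C*2*b10n p*(b10s T x t)^(b10n p - 1)) * (x * ux x y t) := by
      unfold b10ξx; ring
    rw [e]
    exact mul_nonpos_of_nonneg_of_nonpos (by positivity) this
  have hlt' : uy x y t < W p (b10ξ p T C x y t) - C3 := hlt
  have core := core10 hp H.hp3 hK (show 0 ≤ C*b10n p*(3+4*(b10n p-1)) by
    apply mul_nonneg <;> nlinarith) hC3 (E.huy he) hlt' hb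
  set w := W p (b10ξ p T C x y t) with hwd
  have hwp : 0 < w^p := by positivity
  have hwp1 : 0 < w^(p-1) := by positivity
  set G := ((ux x y t)^2 + (uy x y t)^2)^(p/2-1) with hG
  have hG0 : 0 ≤ p*G := by positivity
  have q4 : p*G*(ux x y t * b10ξx p T C x t) ≤ 0 := mul_nonpos_of_nonneg_of_nonpos hG0 q3
  have q5 : 0 ≤ p*w^(p-1)*(b10ξx p T C x t)^2 := by positivity
  have key : 0 < -(p*G*(uy x y t)) - p*G*(ux x y t * b10ξx p T C x t)
      - C*(b10n p*(b10s T x t)^(b10n p - 1)) - b10ξxx p T C x t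
      + p*w^(p-1) + p*w^(p-1)*(b10ξx p T C x t)^2 := by linarith
  have := mul_pos hwp key
  unfold b10t b10xx b10yy b10x b10y
  rw [← hwd]
  nlinarith

lemma F10 : ∃ C > 0, ∃ C3 > 0, ∃ r > 0, ∃ s > 0, r ≤ R ∧ s ≤ T - T1 ∧ ∀ x y t, |x| ≤ r → 0 ≤ y → y ≤ r →
    T - s ≤ t → t < T → W p (y + C*(x^2+(T-t))^((p-1)/(p-2))) - C3 ≤ uy x y t := by
  obtain ⟨C, hC, τ0, hτ0, hτ1, h8⟩ := F8 H E
  have hR := H.hR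
  have hp := H.hp
  have hT := H.hT
  have hK := E.hK
  have hn : 2 ≤ b10n p := (n_facts H E H.hp H.hp3).1
  set r := min R (τ0/2) with hr
  set s := min (T-T1) (τ0/2) with hs
  have hr0 : 0 < r := lt_min hR (by linarith)
  have hs0 : 0 < s := lt_min (by linarith) (by linarith)
  have hrR : r ≤ R := min_le_left _ _
  have hrτ : r ≤ τ0/2 := min_le_right _ _
  have hsT : s ≤ T - T1 := min_le_left _ _
  have hsτ : s ≤ τ0/2 := min_le_right _ _
  set C1 := C*b10n p*(3+4*(b10n p-1)) with hC1
  have hC10 : 0 ≤ C1 := by apply mul_nonneg <;> nlinarith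
  have w1 := W_pos hp (show 0 < C*(r^2)^(b10n p) by positivity)
  have w2 := W_pos hp hr0
  have w3 := W_pos hp (show 0 < C*s^(b10n p) by positivity)
  set C3 := C1 + K^2 + K + 2 + W p (C*(r^2)^(b10n p)) + W p r + W p (C*s^(b10n p)) with hC3
  have hKK : 0 < K^2 := by positivity
  refine ⟨C, hC, C3, by linarith, r, hr0, s, hs0, hrR, hsT, ?_⟩
  intro x y t hx hy hyr hts htT
  have hτ : ∀ x t, |x| ≤ r → T - s ≤ t → b10s T x t ≤ τ0 := by
    intro x t hx ht
    have : x^2 ≤ r := by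
      rw [← sq_abs]; nlinarith [abs_nonneg x]
    unfold b10s; linarith
  obtain ⟨c1, c2, c3, c4⟩ := b10_cont (T := T) (C3 := C3) (a := -r) (b := r) (c := 0) (d := r) (t1 := T-s) (t2 := t) hp hC le_rfl htT
  have := VLy H (a := -r) (b := r) (c := 0) (d := r) (t1 := T-s) (t2 := t) (by linarith) (by linarith)
    le_rfl hrR (by linarith) htT (φ := b10 p T C C3) (φx := b10x p T C) (φy := b10y p T C)
    (φt := b10t p T C) (φxx := b10xx p T C) (φyy := b10yy p T C) ?_ c1 c2 c3 c4 ?_ ?_ x (abs_le.mp hx)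
    y ⟨hy, hyr⟩ t ⟨hts, le_rfl⟩
  · exact this
  · intro x hx y hy t' ht
    refine b10_der hp hC hy.1.le ?_
    unfold b10s; nlinarith [sq_nonneg x, ht.2]
  · intro x hx y hy t' ht hb
    have ht2 : t' < T := by linarith [ht.2]
    have hxr : |x| ≤ r := abs_le.mpr hx
    have hs' : 0 < b10s T x t' := by unfold b10s; nlinarith [sq_nonneg x]
    have hpow : 0 < C*(b10s T x t')^(b10n p) := by positivity
    have he : ed R T1 T x y t' := ed_lt (by linarith) hy.1 (by linarith [hy.2]) (by linarith [ht.1]) ht2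
    have hv := E.huy he
    show W p (y + C*(b10s T x t')^(b10n p)) - C3 ≤ uy x y t'
    have hxcase : |x| = r → W p (y + C*(b10s T x t')^(b10n p)) - C3 ≤ uy x y t' := by
      intro hxe
      have : C*(r^2)^(b10n p) ≤ y + C*(b10s T x t')^(b10n p) := by
        have : (r^2)^(b10n p) ≤ (b10s T x t')^(b10n p) := by
          apply rpow_le_rpow (by positivity) _ (by linarith)
          unfold b10s; rw [← hxe, sq_abs]; linarith
        nlinarith [hy.1]
      have := W_anti hp (by positivity) this
      linarith
    rcases hb with hb | hb | hb | hb | hb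
    · exact hxcase (by rw [hb, abs_neg, abs_of_pos hr0])
    · exact hxcase (by rw [hb, abs_of_pos hr0])
    · have := h8 x t' (by linarith) (by linarith [ht.1]) ht2 (hτ x t' hxr ht.1)
      rw [hb, zero_add]
      have h3 : W p (C*(b10s T x t')^(b10n p)) ≤ uy x 0 t' := this
      linarith
    · have := W_anti hp hr0 (show r ≤ y + C*(b10s T x t')^(b10n p) by linarith)
      linarith
    · have : C*s^(b10n p) ≤ y + C*(b10s T x t')^(b10n p) := by
        have : s^(b10n p) ≤ (b10s T x t')^(b10n p) := by
          apply rpow_le_rpow (by positivity) _ (by linarith)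
          unfold b10s; rw [hb]; nlinarith [sq_nonneg x]
        nlinarith [hy.1]
      have := W_anti hp (by positivity) this
      linarith
  · intro x hx y hy t' ht hlt
    have ht2 : t' < T := by linarith [ht.2]
    have hxr : |x| ≤ r := abs_le.mpr (Ioo_subset_Icc_self hx)
    have he : ed R T1 T x y t' := ed_lt (by linarith) hy.1.le (by linarith [hy.2]) (by linarith [ht.1]) ht2
    exact F10_in H E hC (by linarith) he ht2 (by linarith) ((hτ x t' hxr ht.1.le).trans hτ1) hlt
end

set_option linter.all false

section
variable {p R T1 T K : ℝ} {u ux uy ut uxx uyy : ℝ → ℝ → ℝ → ℝ}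
section barrier
variable (A x0 y0 t0 a b ρ κ : ℝ)
def h11S (x y t : ℝ) : ℝ := ρ^2 - (x-(x0+a*(t-t0)))^2 - (y-(y0+b*(t-t0)))^2
def h11St (x y t : ℝ) : ℝ := 2*a*(x-(x0+a*(t-t0))) + 2*b*(y-(y0+b*(t-t0)))
def h11Sx (x t : ℝ) : ℝ := -2*(x-(x0+a*(t-t0)))
def h11Sy (y t : ℝ) : ℝ := -2*(y-(y0+b*(t-t0)))
def h11e (t : ℝ) : ℝ := κ*exp (-A*(t-t0))
def h11 (x y t : ℝ) : ℝ := h11e A t0 κ t * (x * (h11S x0 y0 t0 a b ρ x y t)^3)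
def h11t (x y t : ℝ) : ℝ := h11e A t0 κ t * (-A*x*(h11S x0 y0 t0 a b ρ x y t)^3
  + 3*x*(h11S x0 y0 t0 a b ρ x y t)^2*h11St x0 y0 t0 a b x y t)
def h11x (x y t : ℝ) : ℝ := h11e A t0 κ t * ((h11S x0 y0 t0 a b ρ x y t)^3
  + 3*x*(h11S x0 y0 t0 a b ρ x y t)^2*h11Sx x0 t0 a x t)
def h11y (x y t : ℝ) : ℝ := h11e A t0 κ t * (3*x*(h11S x0 y0 t0 a b ρ x y t)^2*h11Sy y0 t0 b y t)
def h11xx (x y t : ℝ) : ℝ := h11e A t0 κ t * (6*(h11S x0 y0 t0 a b ρ x y t)^2*h11Sx x0 t0 a x t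
  + 6*x*(h11S x0 y0 t0 a b ρ x y t)*(h11Sx x0 t0 a x t)^2 - 6*x*(h11S x0 y0 t0 a b ρ x y t)^2)
def h11yy (x y t : ℝ) : ℝ := h11e A t0 κ t * (
  6*x*(h11S x0 y0 t0 a b ρ x y t)*(h11Sy y0 t0 b y t)^2 - 6*x*(h11S x0 y0 t0 a b ρ x y t)^2)

lemma h11_der (x y t : ℝ) : DerPk (h11 A x0 y0 t0 a b ρ κ) (h11x A x0 y0 t0 a b ρ κ)
    (h11y A x0 y0 t0 a b ρ κ) (h11t A x0 y0 t0 a b ρ κ) (h11xx A x0 y0 t0 a b ρ κ)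
    (h11yy A x0 y0 t0 a b ρ κ) x y t := by
  have dSxx : HasDerivAt (fun x => h11Sx x0 t0 a x t) (-2) x :=
    (((hasDerivAt_id x).sub_const _).const_mul (-2)).congr_deriv (by ring)
  have dSyy : HasDerivAt (fun y => h11Sy y0 t0 b y t) (-2) y :=
    (((hasDerivAt_id y).sub_const _).const_mul (-2)).congr_deriv (by ring)
  have dSx : HasDerivAt (fun x => h11S x0 y0 t0 a b ρ x y t) (h11Sx x0 t0 a x t) x := by
    have := ((((hasDerivAt_id x).sub_const (x0+a*(t-t0))).fun_pow 2).const_sub (ρ^2)).sub_const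
      ((y-(y0+b*(t-t0)))^2)
    exact this.congr_deriv (by unfold h11Sx; simp)
  have dSy : HasDerivAt (fun y => h11S x0 y0 t0 a b ρ x y t) (h11Sy y0 t0 b y t) y := by
    have := (((hasDerivAt_id y).sub_const (y0+b*(t-t0))).fun_pow 2).const_sub (ρ^2-(x-(x0+a*(t-t0)))^2)
    exact this.congr_deriv (by unfold h11Sy; simp)
  have dSt : HasDerivAt (fun t => h11S x0 y0 t0 a b ρ x y t) (h11St x0 y0 t0 a b x y t) t := by
    have k : ∀ c d e : ℝ, HasDerivAt (fun t => (c - (d+e*(t-t0)))^2) (-2*e*(c-(d+e*(t-t0)))) t := by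
      intro c d e
      have := ((((((hasDerivAt_id t).sub_const t0).const_mul e).const_add d).const_sub c).fun_pow 2)
      exact this.congr_deriv (by simp; ring)
    exact (((k x x0 a).const_sub (ρ^2)).fun_sub (k y y0 b)).congr_deriv (by unfold h11St; ring)
  have de : HasDerivAt (fun t => h11e A t0 κ t) (-A*h11e A t0 κ t) t := by
    have := (((((hasDerivAt_id t).sub_const t0).const_mul (-A)).exp).const_mul κ)
    exact this.congr_deriv (by unfold h11e; simp; ring)
  refine ⟨?_, ?_, ?_, ?_, ?_⟩
  · exact (((hasDerivAt_id x).fun_mul (dSx.fun_pow 3)).const_mul _).congr_deriv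
      (by unfold h11x; simp only [id, Nat.cast_ofNat]; ring)
  · exact (((dSy.fun_pow 3).const_mul x).const_mul _).congr_deriv (by unfold h11y; simp only [id, Nat.cast_ofNat]; ring)
  · exact (de.fun_mul ((dSt.fun_pow 3).const_mul x)).congr_deriv (by unfold h11t; simp only [id, Nat.cast_ofNat]; ring)
  · have := ((dSx.fun_pow 3).fun_add (((((hasDerivAt_id x).const_mul 3).fun_mul (dSx.fun_pow 2)).fun_mul dSxx))).const_mul (h11e A t0 κ t)
    exact this.congr_deriv (by unfold h11xx; simp only [id, Nat.cast_ofNat]; ring)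
  · have := ((((dSy.fun_pow 2).const_mul (3*x))).fun_mul dSyy).const_mul (h11e A t0 κ t)
    exact this.congr_deriv (by unfold h11yy; simp only [id, Nat.cast_ofNat]; ring)
end barrier

lemma cvx_le {θ a b c : ℝ} (h0 : 0 ≤ θ) (h1 : 0 ≤ 1-θ) (ha : a ≤ c) (hb : b ≤ c) :
    (1-θ)*a+θ*b ≤ c := by
  nlinarith

lemma cvx_ge {θ a b c : ℝ} (h0 : 0 ≤ θ) (h1 : 0 ≤ 1-θ) (ha : c ≤ a) (hb : c ≤ b) :
    c ≤ (1-θ)*a+θ*b := by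
  nlinarith

lemma core11 {A x S Sx Sy St F1 F2 M V ρ c : ℝ} (hx : 0 < x) (hS : 0 < S) (hρ : 0 < ρ) (hρ1 : ρ ≤ 1)
    (hSr : S = ρ^2 - (Sx/2)^2 - (Sy/2)^2) (hSx : Sx = -2*(x-c)) (hc : 0 ≤ c)
    (hM : 0 ≤ M) (hV : 0 ≤ V)
    (hSt : |St| ≤ 4*V) (hF1 : |F1| ≤ M*x) (hx1 : |F1| ≤ M) (hF2 : |F2| ≤ M)
    (hA : (12*V+48+13*M)^2 < 96*A*ρ^2) :
    (-A*x*S^3 + 3*x*S^2*St) - (6*S^2*Sx + 6*x*S*Sx^2 - 6*x*S^2) - (6*x*S*Sy^2 - 6*x*S^2) <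
      F1*(S^3+3*x*S^2*Sx) + F2*(3*x*S^2*Sy) := by
  have hS1 : S ≤ 1 := by nlinarith [sq_nonneg Sx, sq_nonneg Sy]
  have hSx2 : |Sx| ≤ 2 := abs_le_of_sq_le_sq (by nlinarith [sq_nonneg Sx, sq_nonneg Sy]) (by norm_num)
  have hSy2 : |Sy| ≤ 2 := abs_le_of_sq_le_sq (by nlinarith [sq_nonneg Sx, sq_nonneg Sy]) (by norm_num)
  have e1 : Sx^2+Sy^2 = 4*(ρ^2-S) := by rw [hSr]; ring
  have f1 : -(F1*S) ≤ M*x := by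
    have : |F1*S| ≤ M*x*1 := by
      rw [abs_mul, abs_of_pos hS]; exact mul_le_mul hF1 hS1 hS.le (by positivity)
    linarith [(abs_le.mp this).1]
  have f2 : -(F1*Sx) ≤ 2*M := by
    have : |F1*Sx| ≤ M*2 := by
      rw [abs_mul]; exact mul_le_mul hx1 hSx2 (abs_nonneg _) hM
    linarith [(abs_le.mp this).1]
  have f3 : -(F2*Sy) ≤ 2*M := by
    have : |F2*Sy| ≤ M*2 := by
      rw [abs_mul]; exact mul_le_mul hF2 hSy2 (abs_nonneg _) hM
    linarith [(abs_le.mp this).1]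
  have f4 : -6*Sx ≤ 12*x := by rw [hSx]; linarith
  have f5 : St ≤ 4*V := (abs_le.mp hSt).2
  have q : -A*S^2 + (12*V+48+13*M)*S - 24*ρ^2 < 0 := by
    by_contra h
    push Not at h
    set B := 12*V+48+13*M
    have hρ2 : 0 < ρ^2 := by positivity
    have : 0 ≤ 96*ρ^2*(-A*S^2 + B*S - 24*ρ^2) := by positivity
    nlinarith [sq_nonneg (B*S - 48*ρ^2), mul_pos (sub_pos.mpr hA) (pow_pos hS 2)]
  -- bracket
  have m1 : 3*x*S*St ≤ 3*x*S*(4*V) := mul_le_mul_of_nonneg_left f5 (by positivity)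
  have m2 : S*(-6*Sx) ≤ S*(12*x) := mul_le_mul_of_nonneg_left f4 hS.le
  have m3 : S*(-(F1*S)) ≤ S*(M*x) := mul_le_mul_of_nonneg_left f1 hS.le
  have m4 : 3*x*S*(-(F1*Sx)) ≤ 3*x*S*(2*M) := mul_le_mul_of_nonneg_left f2 (by positivity)
  have m5 : 3*x*S*(-(F2*Sy)) ≤ 3*x*S*(2*M) := mul_le_mul_of_nonneg_left f3 (by positivity)
  have m6 : x*(-A*S^2 + (12*V+48+13*M)*S - 24*ρ^2) < 0 := mul_neg_of_pos_of_neg hx q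
  have tot : -A*x*S^2 + 3*x*S*St - 6*S*Sx - 6*x*(Sx^2+Sy^2) + 12*x*S - F1*S^2 - 3*x*S*F1*Sx
      - 3*x*S*F2*Sy < 0 := by
    rw [e1]; nlinarith
  have := mul_neg_of_pos_of_neg hS tot
  nlinarith

variable (H : Dat p R T1 T u ux uy ut uxx uyy) (E : Ex p R T1 T K u ux uy ut uxx uyy)
include H E

lemma F11a : ∃ x0 y0 t0, 0 < x0 ∧ x0 < R/2 ∧ 0 < y0 ∧ y0 < R ∧ T1 ≤ t0 ∧ t0 < T ∧ ux x0 y0 t0 < 0 := by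
  by_contra hcon
  push Not at hcon
  have hR := H.hR
  have hT := H.hT
  obtain ⟨M, hM, hb⟩ := bdd_away (r := R/2) (T' := T1) (R := R) (T1 := T1) (T := T) (by linarith) hT H.cuy
  obtain ⟨t, h1, -, h2, h3⟩ := F6 H E (M+1) one_pos
  have a1 := hb (R/2) 0 t (by rw [abs_of_pos (by linarith)]; linarith) le_rfl (by linarith) h1 h2.le
    (Or.inl (le_abs_self _))
  have a2 := uy_cmp H E (x1 := 0) (x2 := R/2) (t := t) (gl_lt (by simp; linarith) h1 h2)
    (gl_lt (by rw [abs_of_pos (by linarith)]; linarith) h1 h2) ?_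
  · linarith [(abs_le.mp a1).2]
  intro y hy hyR
  have hed : ∀ x ∈ Icc 0 (R/2), ed R T1 T x y t := fun x hx =>
    ed_lt (by rw [abs_of_nonneg hx.1]; linarith [hx.2]) hy.le hyR.le h1 h2
  have : MonotoneOn (fun x => u x y t) (Icc 0 (R/2)) := by
    apply monotoneOn_of_hasDerivWithinAt_nonneg (convex_Icc _ _) (f' := fun x => ux x y t)
    · intro x hx
      exact (E.der (hed x hx)).1.continuousAt.continuousWithinAt
    · intro x hx
      exact (E.der (hed x (interior_subset hx))).1.hasDerivWithinAt
    · intro x hx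
      rw [interior_Icc] at hx
      exact hcon x y t hx.1 hx.2 hy hyR h1 h2
  exact this (left_mem_Icc.mpr (by linarith)) (right_mem_Icc.mpr (by linarith)) (by linarith)

lemma ux_nonpos {x y t : ℝ} (h : ed R T1 T x y t) (hx : 0 ≤ x) : 0 ≤ -ux x y t := by
  rcases hx.eq_or_lt with e | e
  · subst e; rw [E.hux0 h]; simp
  · linarith [nonpos_of_mul_nonpos_right (E.hmon h) e]

set_option maxHeartbeats 1000000 in
lemma F11b {x0 y0 t0 r y1 t1 : ℝ} (hx0 : 0 < x0) (hx0' : x0 < R/2) (hy0 : 0 < y0) (hy0' : y0 < R)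
    (ht0 : T1 ≤ t0) (hneg : ux x0 y0 t0 < 0) (hr : r ≤ R/2) (hy1 : 0 < y1)
    (ht1 : t0 < t1) (ht1' : t1 < T) :
    ∃ k > 0, ∀ x y t, 0 ≤ x → x ≤ r → y1 ≤ y → y ≤ r → t1 ≤ t → t < T → k*x ≤ -ux x y t := by
  have hR := H.hR
  have hp := H.hp
  have hK := E.hK
  rcases lt_or_ge r y1 with hry | hry
  · exact ⟨1, one_pos, fun x y t _ _ a b => by linarith⟩
  -- neighbourhood
  obtain ⟨δ, hδ, hnb⟩ : ∃ δ > 0, ∀ x y, |x-x0| < δ → |y-y0| < δ → ux x y t0 < ux x0 y0 t0/2 := by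
    have hd0 : dom R T1 T x0 y0 t0 := (ed_lt (by rw [abs_of_pos hx0]; linarith) hy0.le hy0'.le ht0
      (by linarith)).dom hR
    have := (H.cux hd0).eventually_lt_const (show ux x0 y0 t0 < ux x0 y0 t0/2 by linarith)
    obtain ⟨δ, hδ, h⟩ := Metric.eventually_nhds_iff.mp this
    refine ⟨δ, hδ, fun x y hx hy => ?_⟩
    have := @h (x, y, t0) (by
      simp only [Prod.dist_eq, Real.dist_eq, sub_self, abs_zero]
      exact max_lt hx (max_lt hy hδ))
    exact this
  set η := min y0 y1/2 with hη
  have hη0 : 0 < η := by have := lt_min hy0 hy1; linarith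
  have hηy0 : 2*η ≤ y0 := by have := min_le_left y0 y1; linarith
  have hηy1 : 2*η ≤ y1 := by have := min_le_right y0 y1; linarith
  obtain ⟨ρ, hρ, hρ1, hρR, hρη, hρy, hρδ⟩ : ∃ ρ > 0, ρ ≤ 1 ∧ ρ ≤ R/2 ∧ ρ ≤ η ∧ ρ ≤ R-y0 ∧ ρ ≤ δ := by
    refine ⟨min 1 (min (R/2) (min η (min (R-y0) δ))), ?_, ?_, ?_, ?_, ?_, ?_⟩
    · refine lt_min one_pos (lt_min (by linarith) (lt_min hη0 (lt_min (by linarith) hδ)))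
    all_goals simp
  obtain ⟨M1, hM1, hb1⟩ := bdd_away (r := η) (T' := T1) (R := R) (T1 := T1) (T := T) hη0 H.hT
    (f := fun x y t => p*((ux x y t)^2+(uy x y t)^2)^(p/2-1)) (fun x y t h => by
      have c1 := H.cux h
      have c2 := H.cuy h
      exact continuousAt_const.mul (((c1.pow 2).add (c2.pow 2)).rpow_const (Or.inr (by linarith))))
  obtain ⟨M2, hM2, hb2⟩ := bdd_away (r := η) (T' := T1) (R := R) (T1 := T1) (T := T) hη0 H.hT
    (f := fun x y t => p*((ux x y t)^2+(uy x y t)^2)^(p/2-1)*uy x y t) (fun x y t h => by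
      have c1 := H.cux h
      have c2 := H.cuy h
      exact (continuousAt_const.mul (((c1.pow 2).add (c2.pow 2)).rpow_const (Or.inr (by linarith)))).mul c2)
  set M := M1*K*(1+R) + M2 with hM
  have hM0 : 0 ≤ M := by positivity
  set V := R/(t1-t0) with hV
  have hV0 : 0 ≤ V := div_nonneg hR.le (by linarith)
  obtain ⟨A, hA, hA0⟩ : ∃ A, (12*V+48+13*M)^2 < 96*A*ρ^2 ∧ 0 < A := by
    refine ⟨((12*V+48+13*M)^2+1)/(96*ρ^2), ?_, by positivity⟩
    have : 96*(((12*V+48+13*M)^2+1)/(96*ρ^2))*ρ^2 = (12*V+48+13*M)^2+1 := by field_simp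
    rw [this]; linarith
  set κ := (-ux x0 y0 t0/2)/R with hκ
  have hκ0 : 0 < κ := div_pos (by linarith) hR
  refine ⟨κ*exp (-A*(T-t0))*(ρ^2)^3, by positivity, ?_⟩
  intro xs ys ts hxs hxr hys hyr hts htT
  have hdt : 0 < ts - t0 := by linarith
  set a := (xs-x0)/(ts-t0) with ha
  set b := (ys-y0)/(ts-t0) with hb
  have hVb : ∀ c : ℝ, |c| ≤ R → |c/(ts-t0)| ≤ V := by
    intro c hc
    rw [abs_div, abs_of_pos hdt, hV]
    exact div_le_div₀ hR.le hc (by linarith) (by linarith)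
  have haV : |a| ≤ V := hVb _ (by rw [abs_le]; constructor <;> linarith)
  have hbV : |b| ≤ V := hVb _ (by rw [abs_le]; constructor <;> linarith)
  -- the centre
  have hcen : ∀ t ∈ Icc t0 ts, 0 ≤ x0+a*(t-t0) ∧ x0+a*(t-t0) ≤ R/2 ∧ 2*η ≤ y0+b*(t-t0) ∧
      y0+b*(t-t0) ≤ R - ρ := by
    intro t ht
    set θ := (t-t0)/(ts-t0) with hθ
    have h0 : 0 ≤ θ := div_nonneg (by linarith [ht.1]) hdt.le
    have h1 : θ ≤ 1 := by rw [hθ, div_le_one hdt]; linarith [ht.2]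
    have ea : x0+a*(t-t0) = (1-θ)*x0+θ*xs := by rw [ha, hθ]; field_simp; ring
    have eb : y0+b*(t-t0) = (1-θ)*y0+θ*ys := by rw [hb, hθ]; field_simp; ring
    rw [ea, eb]
    have h2 : 0 ≤ 1-θ := by linarith
    refine ⟨by positivity, ?_, ?_, ?_⟩
    · exact cvx_le h0 h2 (by linarith) (by linarith)
    · exact cvx_ge h0 h2 (by linarith) (by linarith)
    · exact cvx_le h0 h2 (by linarith) (by linarith)
  have hce : x0 + a*(ts-t0) = xs ∧ y0 + b*(ts-t0) = ys := by
    rw [ha, hb]; constructor <;> field_simp <;> ring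
  have hSneg : ∀ x y t, ρ ≤ |x-(x0+a*(t-t0))| ∨ ρ ≤ |y-(y0+b*(t-t0))| → h11S x0 y0 t0 a b ρ x y t ≤ 0 := by
    intro x y t h
    unfold h11S
    rcases h with h | h
    · have : ρ^2 ≤ (x-(x0+a*(t-t0)))^2 := by rw [← sq_abs (x-_)]; gcongr
      linarith [sq_nonneg (y-(y0+b*(t-t0)))]
    · have : ρ^2 ≤ (y-(y0+b*(t-t0)))^2 := by rw [← sq_abs (y-_)]; gcongr
      linarith [sq_nonneg (x-(x0+a*(t-t0)))]
  have he0 : ∀ t, 0 < h11e A t0 κ t := fun t => by unfold h11e; positivity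
  have hφneg : ∀ x y t, 0 ≤ x → h11S x0 y0 t0 a b ρ x y t ≤ 0 → h11 A x0 y0 t0 a b ρ κ x y t ≤ 0 := by
    intro x y t hx hS
    unfold h11
    refine mul_nonpos_of_nonneg_of_nonpos (he0 t).le (mul_nonpos_of_nonneg_of_nonpos hx ?_)
    exact (Odd.pow_nonpos (by decide) hS)
  have res := VLx H (a := 0) (b := R) (c := η) (d := R) (t1 := t0) (t2 := ts) (by linarith) le_rfl
    hη0.le le_rfl ht0 htT (fun x _ y _ t _ => h11_der A x0 y0 t0 a b ρ κ x y t)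
    (Continuous.continuousOn (by unfold h11 h11e h11S; fun_prop))
    (Continuous.continuousOn (by unfold h11x h11e h11S h11Sx; fun_prop))
    (Continuous.continuousOn (by unfold h11y h11e h11S h11Sy; fun_prop))
    (Continuous.continuousOn (by unfold h11t h11xx h11yy h11e h11S h11Sx h11Sy h11St; fun_prop))
    ?_ ?_ xs ⟨hxs, by linarith⟩ ys ⟨by linarith, by linarith⟩ ts ⟨by linarith, le_rfl⟩
  · refine le_trans ?_ res
    unfold h11 h11e
    have : h11S x0 y0 t0 a b ρ xs ys ts = ρ^2 := by
      unfold h11S; rw [hce.1, hce.2]; ring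
    rw [this]
    have : exp (-A*(T-t0)) ≤ exp (-A*(ts-t0)) := exp_le_exp.mpr (by
      have : A*(ts-t0) ≤ A*(T-t0) := mul_le_mul_of_nonneg_left (by linarith) hA0.le
      linarith)
    have h3 : κ*exp (-A*(T-t0))*(xs*(ρ^2)^3) ≤ κ*exp (-A*(ts-t0))*(xs*(ρ^2)^3) := by gcongr
    linarith
  · intro x hx y hy t ht hbd
    have he : ed R T1 T x y t := ed_lt (by rw [abs_of_nonneg hx.1]; exact hx.2) (by linarith [hy.1]) hy.2
      (by linarith [ht.1]) (by linarith [ht.2])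
    have hnn := ux_nonpos H E he hx.1
    obtain ⟨c1, c2, c3, c4⟩ := hcen t ht
    rcases hbd with h | h | h | h | h
    · refine le_trans (le_of_eq ?_) hnn
      unfold h11; rw [h]; ring
    · refine (hφneg x y t hx.1 (hSneg x y t (Or.inl ?_))).trans hnn
      rw [h, abs_of_nonneg] <;> linarith
    · refine (hφneg x y t hx.1 (hSneg x y t (Or.inr ?_))).trans hnn
      rw [h, abs_of_nonpos] <;> linarith
    · refine (hφneg x y t hx.1 (hSneg x y t (Or.inr ?_))).trans hnn
      rw [h, abs_of_nonneg] <;> linarith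
    · by_cases hS : h11S x0 y0 t0 a b ρ x y t ≤ 0
      · exact (hφneg x y t hx.1 hS).trans hnn
      · have h1 : ¬ (ρ ≤ |x-(x0+a*(t-t0))| ∨ ρ ≤ |y-(y0+b*(t-t0))|) := fun h' => hS (hSneg x y t h')
        push Not at h1
        rw [h] at h1
        simp only [sub_self, mul_zero, add_zero] at h1
        have := hnb x y (by linarith) (by linarith)
        have this : ux x y t < ux x0 y0 t0/2 := by rw [h]; exact this
        have hS1 : h11S x0 y0 t0 a b ρ x y t ≤ 1 := by
          unfold h11S
          have : ρ^2 ≤ 1 := pow_le_one₀ hρ.le hρ1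
          linarith [sq_nonneg (x-(x0+a*(t-t0))), sq_nonneg (y-(y0+b*(t-t0)))]
        push Not at hS
        have h3 : (h11S x0 y0 t0 a b ρ x y t)^3 ≤ 1 := pow_le_one₀ hS.le hS1
        have h4 : h11 A x0 y0 t0 a b ρ κ x y t ≤ κ*R := by
          unfold h11 h11e
          rw [h]
          simp only [sub_self, mul_zero, exp_zero, mul_one]
          rw [h] at h3
          have : x * (h11S x0 y0 t0 a b ρ x y t0)^3 ≤ R*1 := by
            rw [h] at hS
            exact mul_le_mul hx.2 h3 (by positivity) hR.le
          exact mul_le_mul_of_nonneg_left (by linarith) hκ0.le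
        have h5 : κ*R = -ux x0 y0 t0/2 := by rw [hκ]; field_simp
        linarith
  · intro x hx y hy t ht hlt
    have ht2 : t < T := by linarith [ht.2]
    have he : ed R T1 T x y t := ed_lt (by rw [abs_of_pos hx.1]; exact hx.2.le) (by linarith [hy.1]) hy.2.le
      (by linarith [ht.1]) ht2
    have hnn := ux_nonpos H E he hx.1.le
    have hS : 0 < h11S x0 y0 t0 a b ρ x y t := by
      by_contra hc
      push Not at hc
      linarith [hφneg x y t hx.1.le hc]
    obtain ⟨c1, c2, c3, c4⟩ := hcen t (Ioc_subset_Icc_self ht)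
    have h1 : ¬ (ρ ≤ |x-(x0+a*(t-t0))| ∨ ρ ≤ |y-(y0+b*(t-t0))|) := fun h' => by
      linarith [hSneg x y t h']
    push Not at h1
    have hq1 := hb1 x y t (by rw [abs_of_pos hx.1]; linarith [hx.2]) (by linarith [hy.1]) (by linarith [hy.2])
      (by linarith [ht.1]) ht2.le (Or.inr (Or.inl hy.1.le))
    have hq2 := hb2 x y t (by rw [abs_of_pos hx.1]; linarith [hx.2]) (by linarith [hy.1]) (by linarith [hy.2])
      (by linarith [ht.1]) ht2.le (Or.inr (Or.inl hy.1.le))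
    have hux := E.hux he
    rw [abs_of_pos hx.1] at hux
    set G := p*((ux x y t)^2+(uy x y t)^2)^(p/2-1) with hG
    have hF1 : |G*ux x y t| ≤ M1*K*x := by
      rw [abs_mul, mul_assoc]
      exact mul_le_mul hq1 hux (abs_nonneg _) hM1.le
    have core := core11 (A := A) (x := x) (S := h11S x0 y0 t0 a b ρ x y t) (Sx := h11Sx x0 t0 a x t)
      (Sy := h11Sy y0 t0 b y t) (St := h11St x0 y0 t0 a b x y t) (F1 := G*ux x y t) (F2 := G*uy x y t)
      (M := M) (V := V) (ρ := ρ) (c := x0+a*(t-t0)) hx.1 hS hρ hρ1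
      (by unfold h11S h11Sx h11Sy; ring) rfl c1 hM0 hV0 ?_ ?_ ?_ ?_ hA
    · have := mul_lt_mul_of_pos_left core (he0 t)
      unfold h11t h11xx h11yy h11x h11y
      refine lt_of_eq_of_lt ?_ (lt_of_lt_of_eq this ?_) <;> ring
    · unfold h11St
      have k : ∀ c d : ℝ, |c| ≤ V → |d| ≤ 1 → |2*c*d| ≤ 2*V := by
        intro c d hc hd
        rw [abs_mul, abs_mul, abs_two]
        have : |c| * |d| ≤ V*1 := mul_le_mul hc hd (abs_nonneg _) hV0
        linarith
      have k1 := k a _ haV (h1.1.le.trans hρ1)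
      have k2 := k b _ hbV (h1.2.le.trans hρ1)
      exact (abs_add_le _ _).trans (by linarith)
    · refine hF1.trans (mul_le_mul_of_nonneg_right ?_ hx.1.le)
      rw [hM]
      have : 0 ≤ M1*K*R := by positivity
      linarith
    · refine hF1.trans ?_
      rw [hM]
      have h0 : 0 ≤ M1*K := by positivity
      have : M1*K*x ≤ M1*K*R := mul_le_mul_of_nonneg_left hx.2.le h0
      linarith
    · refine hq2.trans ?_
      rw [hM]
      have : 0 ≤ M1*K*(1+R) := by positivity
      linarith
end

set_option linter.all false

section
variable {p R T1 T K : ℝ} {u ux uy ut uxx uyy : ℝ → ℝ → ℝ → ℝ}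
section barrier
variable (T g e k : ℝ)
def q12a (x y t : ℝ) : ℝ := (x^2+(T-t))/y^2
def q12 (x y t : ℝ) : ℝ := (x^2+(T-t))/y + y
def s12 (x y t : ℝ) : ℝ := 1 + y^e - (q12 T x y t)^g
def s12t (x y t : ℝ) : ℝ := g*(q12 T x y t)^(g-1)/y
def s12x (x y t : ℝ) : ℝ := -(g*(q12 T x y t)^(g-1)*(2*x/y))
def s12y (x y t : ℝ) : ℝ := e*y^(e-1) - g*(q12 T x y t)^(g-1)*(1-q12a T x y t)
def s12xx (x y t : ℝ) : ℝ := -(g*((g-1)*(q12 T x y t)^(g-2)*(2*x/y)^2 + (q12 T x y t)^(g-1)*(2/y)))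
def s12yy (x y t : ℝ) : ℝ := e*(e-1)*y^(e-2) -
  g*((g-1)*(q12 T x y t)^(g-2)*(1-q12a T x y t)^2 + (q12 T x y t)^(g-1)*(2*q12a T x y t/y))
def h12 (x y t : ℝ) : ℝ := k*(x*s12 T g e x y t)
def h12x (x y t : ℝ) : ℝ := k*(s12 T g e x y t + x*s12x T g x y t)
def h12y (x y t : ℝ) : ℝ := k*(x*s12y T g e x y t)
def h12t (x y t : ℝ) : ℝ := k*(x*s12t T g x y t)
def h12xx (x y t : ℝ) : ℝ := k*(2*s12x T g x y t + x*s12xx T g x y t)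
def h12yy (x y t : ℝ) : ℝ := k*(x*s12yy T g e x y t)

variable {T}
lemma q12_pos {x y t : ℝ} (hy : 0 < y) (ht : t < T) : 0 < q12 T x y t := by
  unfold q12
  have : 0 ≤ x^2+(T-t) := by nlinarith [sq_nonneg x]
  positivity

lemma h12_der {x y t : ℝ} (hy : 0 < y) (ht : t < T) : DerPk (h12 T g e k) (h12x T g e k)
    (h12y T g e k) (h12t T g k) (h12xx T g k) (h12yy T g e k) x y t := by
  have hq := q12_pos (x := x) hy ht
  have dqx : HasDerivAt (fun x => q12 T x y t) (2*x/y) x := by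
    have := ((((hasDerivAt_pow 2 x).add_const (T-t)).div_const y).add_const y)
    exact this.congr_deriv (by push_cast; ring)
  have dqt : HasDerivAt (fun t => q12 T x y t) (-1/y) t :=
    (((((hasDerivAt_id t).const_sub T).const_add (x^2)).div_const y).add_const y)
  have dqy : HasDerivAt (fun y => q12 T x y t) (1-q12a T x y t) y := by
    have := (((hasDerivAt_id y).fun_inv hy.ne').const_mul (x^2+(T-t))).fun_add (hasDerivAt_id y)
    refine (this.congr_deriv ?_)
    simp only [id]
    unfold q12a; ring
  have day : HasDerivAt (fun y => q12a T x y t) (-(2*q12a T x y t/y)) y := by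
    have := (((hasDerivAt_pow 2 y).fun_inv (by positivity)).const_mul (x^2+(T-t)))
    refine (this.congr_deriv ?_)
    unfold q12a; push_cast; field_simp
  have dpx : ∀ c : ℝ, HasDerivAt (fun x => (q12 T x y t)^c) ((2*x/y)*c*(q12 T x y t)^(c-1)) x :=
    fun c => dqx.rpow_const (Or.inl hq.ne')
  have dpt : ∀ c : ℝ, HasDerivAt (fun t => (q12 T x y t)^c) ((-1/y)*c*(q12 T x y t)^(c-1)) t :=
    fun c => dqt.rpow_const (Or.inl hq.ne')
  have dpy : ∀ c : ℝ, HasDerivAt (fun y => (q12 T x y t)^c) ((1-q12a T x y t)*c*(q12 T x y t)^(c-1)) y :=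
    fun c => dqy.rpow_const (Or.inl hq.ne')
  have dey : ∀ c : ℝ, HasDerivAt (fun y : ℝ => y^c) (c*y^(c-1)) y :=
    fun c => hasDerivAt_rpow_const (Or.inl hy.ne')
  have dsx : HasDerivAt (fun x => s12 T g e x y t) (s12x T g x y t) x :=
    ((dpx g).const_sub _).congr_deriv (by unfold s12x; ring)
  have eg : g - 1 - 1 = g - 2 := by ring
  refine ⟨?_, ?_, ?_, ?_, ?_⟩
  · exact (((hasDerivAt_id x).fun_mul dsx).const_mul k).congr_deriv (by unfold h12x; simp only [id]; ring)
  · exact (((((dey e).const_add 1).fun_sub (dpy g)).const_mul x).const_mul k).congr_deriv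
      (by unfold h12y s12y; ring)
  · exact ((((dpt g).const_sub (1+y^e)).const_mul x).const_mul k).congr_deriv
      (by unfold h12t s12t; ring)
  · have h1 : HasDerivAt (fun x => s12x T g x y t) (s12xx T g x y t) x := by
      have := (((dpx (g-1)).const_mul g).fun_mul (((hasDerivAt_id x).const_mul 2).div_const y)).fun_neg
      refine this.congr_deriv ?_
      unfold s12xx; rw [eg]; simp only [id]; ring
    exact ((dsx.fun_add ((hasDerivAt_id x).fun_mul h1)).const_mul k).congr_deriv
      (by unfold h12xx; simp only [id]; ring)
  · have h1 : HasDerivAt (fun y => s12y T g e x y t) (s12yy T g e x y t) y := by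
      have := ((dey (e-1)).const_mul e).fun_sub (((dpy (g-1)).const_mul g).fun_mul (day.const_sub 1))
      refine this.congr_deriv ?_
      unfold s12yy; rw [eg, show e - 1 - 1 = e - 2 by ring]; ring
    exact ((h1.const_mul x).const_mul k)

lemma h12_cont {a b c d t1 t2 : ℝ} (hc : 0 < c) (h2 : t2 < T) :
    CO (h12 T g e k) a b c d t1 t2 ∧ CO (h12x T g e k) a b c d t1 t2 ∧
    CO (h12y T g e k) a b c d t1 t2 ∧
    CO (fun x y t => h12t T g k x y t - h12xx T g k x y t - h12yy T g e k x y t) a b c d t1 t2 := by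
  have hx : CO (fun x y t => x) a b c d t1 t2 := by unfold CO; fun_prop
  have hy : CO (fun x y t => y) a b c d t1 t2 := by unfold CO; fun_prop
  have ht : CO (fun x y t => x^2+(T-t)) a b c d t1 t2 := by unfold CO; fun_prop
  have y0 : ∀ q ∈ Icc a b ×ˢ Icc c d ×ˢ Icc t1 t2, q.2.1 ≠ 0 := fun q hq => by
    have := hq.2.1.1; linarith
  have hye : ∀ c' : ℝ, CO (fun x y t => y^c') a b c d t1 t2 := fun c' =>
    ContinuousOn.rpow_const hy (fun q hq => Or.inl (y0 q hq))
  have hyi : CO (fun x y t => y⁻¹) a b c d t1 t2 := ContinuousOn.inv₀ hy y0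
  have hq : CO (q12 T) a b c d t1 t2 := (ContinuousOn.div ht hy y0).add hy
  have hqa : CO (q12a T) a b c d t1 t2 :=
    (ContinuousOn.div ht (hy.pow 2) (fun q hq => pow_ne_zero 2 (y0 q hq)))
  have hqe : ∀ c' : ℝ, CO (fun x y t => (q12 T x y t)^c') a b c d t1 t2 := fun c' =>
    ContinuousOn.rpow_const hq (fun q hq => Or.inl (q12_pos (by have := hq.2.1.1; linarith)
      (by have := hq.2.2.2; linarith)).ne')
  have hk : ∀ c' : ℝ, CO (fun x y t => c') a b c d t1 t2 := fun c' => continuousOn_const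
  have hs : CO (s12 T g e) a b c d t1 t2 := ((hk 1).add (hye e)).sub (hqe g)
  have h2xy : CO (fun x y t => 2*x/y) a b c d t1 t2 := ContinuousOn.div ((hk 2).mul hx) hy y0
  have hsx : CO (s12x T g) a b c d t1 t2 := (((hk g).mul (hqe _)).mul h2xy).neg
  have h1a : CO (fun x y t => 1 - q12a T x y t) a b c d t1 t2 := (hk 1).sub hqa
  have hsy : CO (s12y T g e) a b c d t1 t2 := ((hk e).mul (hye _)).sub (((hk g).mul (hqe _)).mul h1a)
  have hst : CO (s12t T g) a b c d t1 t2 := ContinuousOn.div ((hk g).mul (hqe _)) hy y0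
  have hsxx : CO (s12xx T g) a b c d t1 t2 :=
    (((hk g).mul ((((hk (g-1)).mul (hqe _)).mul (h2xy.pow 2)).add ((hqe _).mul (ContinuousOn.div (hk 2) hy y0)))).neg)
  have hsyy : CO (s12yy T g e) a b c d t1 t2 :=
    ((hk (e*(e-1))).mul (hye _)).sub ((hk g).mul ((((hk (g-1)).mul (hqe _)).mul (h1a.pow 2)).add
      ((hqe _).mul (ContinuousOn.div ((hk 2).mul hqa) hy y0))))
  refine ⟨(hk k).mul (hx.mul hs), (hk k).mul (hs.add (hx.mul hsx)), (hk k).mul (hx.mul hsy), ?_⟩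
  exact (((hk k).mul (hx.mul hst)).sub ((hk k).mul (((hk 2).mul hsx).add (hx.mul hsxx)))).sub
    ((hk k).mul (hx.mul hsyy))
end barrier

lemma core12 {g e x y a P1 P2 Y1 Y2 Yg ψ F1 F2 C : ℝ} (hg : 0 < g) (hg1 : g < 1) (he : 0 < e)
    (he1 : e < 1) (hx : 0 < x) (hy : 0 < y) (ha : 0 ≤ a) (hP2 : 0 < P2) (hP1 : P1 = y*(a+1)*P2)
    (hY2 : 0 < Y2) (hY1 : Y1 = y*Y2) (hYg : P1/y ≤ Yg) (hψ0 : 0 ≤ ψ) (hψ : ψ ≤ 2) (hC : 0 ≤ C)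
    (hF1 : F1 ≤ 0) (hF1' : -F1 ≤ C*x/y) (hF2 : (1+g)/y ≤ F2) (hF2' : F2 ≤ C/y)
    (hfin : g*(10+C)*Yg + 2*C/y < e*(e+g)*Y2) :
    x*(g*P1/y) - (2*(-(g*P1*(2*x/y))) + x*(-(g*((g-1)*P2*(2*x/y)^2 + P1*(2/y))))) -
      x*(e*(e-1)*Y2 - g*((g-1)*P2*(1-a)^2 + P1*(2*a/y))) <
    F1*(ψ + x*(-(g*P1*(2*x/y)))) + F2*(x*(e*Y1 - g*P1*(1-a))) := by
  have hP1p : 0 < P1 := by rw [hP1]; positivity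
  have s0 : 0 ≤ g*((1-g)*P2*(2*x/y)^2) := by
    have : 0 < 1-g := by linarith
    positivity
  have s1 : (1+g)/y*(e*Y1) ≤ F2*(e*Y1) := mul_le_mul_of_nonneg_right hF2 (by rw [hY1]; positivity)
  have s1' : (1+g)/y*(e*Y1) = (1+g)*e*Y2 := by rw [hY1]; field_simp
  have s2 : F2*(g*P1) ≤ C/y*(g*P1) := mul_le_mul_of_nonneg_right hF2' (by positivity)
  have s2' : C/y*(g*P1) = g*C*(P1/y) := by ring
  have s3 : (1+g)/y*(g*P1*a) ≤ F2*(g*P1*a) := mul_le_mul_of_nonneg_right hF2 (by positivity)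
  have s3' : (1+g)/y*(g*P1*a) = (1+g)*g*((a+1)*P2*a) := by rw [hP1]; field_simp
  have ey : P1/y = (a+1)*P2 := by rw [hP1]; field_simp
  have s4 : -F1*ψ ≤ (C*x/y)*2 := mul_le_mul hF1' hψ hψ0 (by positivity)
  have s4' : (C*x/y)*2 = x*(2*C/y) := by ring
  have s5 : 0 ≤ F1*(x*(-(g*P1*(2*x/y)))) := by
    have h5 : 0 ≤ x*(g*P1*(2*x/y)) := by positivity
    have : F1*(x*(-(g*P1*(2*x/y)))) = (-F1)*(x*(g*P1*(2*x/y))) := by ring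
    rw [this]; exact mul_nonneg (by linarith) h5
  have s6 : g*(10+C)*(P1/y) ≤ g*(10+C)*Yg := mul_le_mul_of_nonneg_left hYg (by positivity)
  have s7 : g*(1-g)*P2*(3*a-1) ≤ 3*g*((a+1)*P2) := by
    have h1 : 0 ≤ g*P2 := by positivity
    have h2 : (1-g)*(3*a-1) ≤ 3*(a+1) := by nlinarith
    have := mul_le_mul_of_nonneg_left h2 h1
    linarith
  -- bracket
  have br : g*(P1/y) + 4*g*(P1/y) + 2*g*(P1/y) - g*(1-g)*P2*(2*x/y)^2 - e*(e-1)*Y2 - g*(1-g)*P2*(1-a)^2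
     + 2*g*(P1/y)*a + 2*C/y - F2*(e*Y1) + F2*(g*P1) - F2*(g*P1*a) < 0 := by
    rw [s1'] at s1
    rw [s2', ey] at s2
    rw [s3'] at s3
    rw [ey] at s6 ⊢
    linarith
  have := mul_neg_of_pos_of_neg hx br
  have e1 : F1*(ψ + x*(-(g*P1*(2*x/y)))) = -(-F1*ψ) + F1*(x*(-(g*P1*(2*x/y)))) := by ring
  rw [e1]
  have e2 : x*(g*P1/y) - (2*(-(g*P1*(2*x/y))) + x*(-(g*((g-1)*P2*(2*x/y)^2 + P1*(2/y))))) -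
      x*(e*(e-1)*Y2 - g*((g-1)*P2*(1-a)^2 + P1*(2*a/y))) - F2*(x*(e*Y1 - g*P1*(1-a))) + x*(2*C/y) =
      x*(g*(P1/y) + 4*g*(P1/y) + 2*g*(P1/y) - g*(1-g)*P2*(2*x/y)^2 - e*(e-1)*Y2 - g*(1-g)*P2*(1-a)^2
     + 2*g*(P1/y)*a + 2*C/y - F2*(e*Y1) + F2*(g*P1) - F2*(g*P1*a)) := by ring
  linarith
end

set_option linter.all false

lemma small_pow {e c : ℝ} (he : 0 < e) (hc : 0 < c) : ∃ r > 0, ∀ y, 0 ≤ y → y ≤ r → y^e ≤ c := by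
  refine ⟨c^(1/e), by positivity, fun y h0 h1 => ?_⟩
  calc y^e ≤ (c^(1/e))^e := rpow_le_rpow h0 h1 he.le
    _ = c := by rw [← rpow_mul hc.le, one_div_mul_cancel he.ne', rpow_one]

lemma fin12 {g C : ℝ} (hg : 0 < g) (hg1 : g < 1) (hC : 0 ≤ C) : ∃ r > 0, ∀ y, 0 < y → y ≤ r →
    g*(10+C)*y^(g-2) + 2*C/y < (g/2)*(g/2+g)*y^(g/2-2) := by
  obtain ⟨r, hr, h⟩ := small_pow (e := g/2) (c := (g/2)*(g/2+g)/(2*(g*(10+C)+2*C))) (by linarith)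
    (by positivity)
  refine ⟨min r 1, lt_min hr one_pos, fun y hy hyr => ?_⟩
  have hy1 : y ≤ 1 := hyr.trans (min_le_right _ _)
  have h1 := h y hy.le (hyr.trans (min_le_left _ _))
  rw [le_div_iff₀ (by positivity)] at h1
  have hY : 0 < y^(g/2-2) := by positivity
  have e1 : y^(g-2) = y^(g/2)*y^(g/2-2) := by rw [← rpow_add hy]; congr 1; ring
  have e2 : 1/y = y^(1-g/2)*y^(g/2-2) := by
    rw [← rpow_add hy, one_div, ← rpow_neg_one]; congr 1; ring
  have e3 : y^(1-g/2) ≤ y^(g/2) := rpow_le_rpow_of_exponent_ge hy hy1 (by linarith)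
  have e4 : 2*C/y = 2*C*(1/y) := by ring
  rw [e4, e1, e2]
  have e5 : 2*C*(y^(1-g/2)*y^(g/2-2)) ≤ 2*C*(y^(g/2)*y^(g/2-2)) := by gcongr
  have e6 : (g*(10+C)+2*C)*y^(g/2) < (g/2)*(g/2+g) := by
    have : 0 < (g/2)*(g/2+g) := by positivity
    nlinarith
  have := mul_lt_mul_of_pos_right e6 hY
  linarith

section
variable {p R T1 T K : ℝ} {u ux uy ut uxx uyy : ℝ → ℝ → ℝ → ℝ}
variable (H : Dat p R T1 T u ux uy ut uxx uyy) (E : Ex p R T1 T K u ux uy ut uxx uyy)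
include H E

set_option maxHeartbeats 2000000 in
lemma F12b {M : ℝ} (hM : 0 < M) : ∃ r0 > 0, ∃ s0 > 0, ∃ C > 0, r0 ≤ R/2 ∧ r0 ≤ 1 ∧ s0 ≤ T - T1 ∧
    ∀ x y t, |x| ≤ r0 → 0 < y → y ≤ r0 → T - s0 ≤ t → t < T → x^2+(T-t) ≤ M*y →
      (1+bt p/2)/y ≤ p*((ux x y t)^2+(uy x y t)^2)^(p/2-1)*uy x y t ∧
      p*((ux x y t)^2+(uy x y t)^2)^(p/2-1)*uy x y t ≤ C/y ∧
      |p*((ux x y t)^2+(uy x y t)^2)^(p/2-1)*ux x y t| ≤ C*|x|/y := by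
  obtain ⟨C0, hC0, C3, hC3, r, hr, s, hs, hrR, hsT, h10⟩ := F10 H E
  have hp := H.hp
  have hp3 := H.hp3
  have hR := H.hR
  have hK := E.hK
  have hn := (n_facts H E hp hp3).1
  set n := (p-1)/(p-2) with hnd
  have hb0 := bt_pos hp
  have hb1 := bt_lt hp
  have hb2 : 1/2 ≤ bt p := by unfold bt; rw [div_le_div_iff₀] <;> linarith
  have hbm := bt_mul hp
  obtain ⟨A, hA, -, hWA⟩ := W_large hp (20*(C3+1)) one_pos
  set D := C0*M^n with hD
  have hD0 : 0 < D := by positivity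
  obtain ⟨r0, hr0, b1, b2, b3, b4, b5⟩ : ∃ r0 > 0, r0 ≤ R/2 ∧ r0 ≤ 1 ∧ r0 ≤ r ∧ r0 ≤ A/2 ∧ D*r0 ≤ 8/100 := by
    refine ⟨min (R/2) (min 1 (min r (min (A/2) (8/100/D)))), ?_, ?_, ?_, ?_, ?_, ?_⟩
    · exact lt_min (by linarith) (lt_min one_pos (lt_min hr (lt_min (by linarith) (by positivity))))
    · simp
    · simp
    · simp
    · simp
    · have : min (R/2) (min 1 (min r (min (A/2) (8/100/D)))) ≤ 8/100/D := by simp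
      calc D * _ ≤ D*(8/100/D) := mul_le_mul_of_nonneg_left this hD0.le
        _ = 8/100 := by field_simp
  set Cw := 1+3*K with hCw
  have hCw1 : 1 ≤ Cw := by linarith
  refine ⟨r0, hr0, s, hs, p*Cw^(p-1)*bt p*K, by positivity, b1, b2, hsT, ?_⟩
  intro x y t hx hy hyr hts htT hτ
  have he : ed R T1 T x y t := ed_lt (by linarith) hy.le (by linarith) (by linarith) htT
  have hg : gl R T1 T x t := gl_lt (by linarith) (by linarith) htT
  have h1 := h10 x y t (by linarith) hy.le (by linarith) hts htT
  have hτ0 : 0 < x^2+(T-t) := by nlinarith [sq_nonneg x]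
  set ξ := y*(1+D*y) with hξ
  have hDy : D*y ≤ 8/100 := (mul_le_mul_of_nonneg_left hyr hD0.le).trans b5
  have hDy0 : 0 < D*y := by positivity
  have hξ0 : 0 < ξ := by positivity
  have hξle : y + C0*(x^2+(T-t))^n ≤ ξ := by
    have a1 : (x^2+(T-t))^n ≤ (M*y)^n := rpow_le_rpow hτ0.le hτ (by linarith)
    have a2 : (M*y)^n = M^n*y^n := mul_rpow hM.le hy.le
    have a3 : y^n ≤ y^(2:ℝ) := rpow_le_rpow_of_exponent_ge hy (by linarith) hn
    rw [rpow_two] at a3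
    have a4 : M^n*y^n ≤ M^n*y^2 := mul_le_mul_of_nonneg_left a3 (by positivity)
    have a5 : C0*(x^2+(T-t))^n ≤ C0*(M^n*y^2) := mul_le_mul_of_nonneg_left (by linarith) hC0.le
    have a6 : ξ = y + C0*(M^n*y^2) := by rw [hξ, hD]; ring
    linarith
  have hξA : ξ ≤ A := by
    have : y*(1+D*y) ≤ y*2 := mul_le_mul_of_nonneg_left (by linarith) hy.le
    linarith
  have hyξ : y ≤ ξ := by
    have : y*1 ≤ y*(1+D*y) := mul_le_mul_of_nonneg_left (by linarith) hy.le
    linarith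
  have w1 := W_anti hp (show 0 < y + C0*(x^2+(T-t))^n by positivity) hξle
  have w2 := W_anti hp hξ0 hξA
  have w3 := W_anti hp hy hyξ
  have w0 := W_pos hp hξ0
  have hv : 95/100*W p ξ ≤ uy x y t := by linarith
  have hv0 : 0 < uy x y t := by linarith
  have hup := F4' H E hg hy (by linarith)
  have hux := E.hux he
  set G := ((ux x y t)^2+(uy x y t)^2)^(p/2-1) with hG
  have hG0 : 0 ≤ G := by positivity
  -- lower
  have l1 : (uy x y t)^(p-2) ≤ G := by
    have : (uy x y t)^(p-2) = ((uy x y t)^2)^(p/2-1) := by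
      rw [← rpow_natCast (uy x y t) 2, ← rpow_mul hv0.le]; congr 1; push_cast; ring
    rw [this]
    exact rpow_le_rpow (by positivity) (by nlinarith [sq_nonneg (ux x y t)]) (by linarith)
  have l2 : (uy x y t)^(p-1) ≤ G*uy x y t := by
    have : (uy x y t)^(p-1) = (uy x y t)^(p-2)*uy x y t := by
      rw [← rpow_add_one hv0.ne']; congr 1; ring
    rw [this]; exact mul_le_mul_of_nonneg_right l1 hv0.le
  have l3 : (95/100*W p ξ)^(p-1) ≤ (uy x y t)^(p-1) := rpow_le_rpow (by positivity) hv (by linarith)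
  have l4 : (95/100*W p ξ)^(p-1) = (95/100:ℝ)^(p-1)*(bt p/ξ) := by
    rw [mul_rpow (by norm_num) w0.le, W_pow1 hp hξ0]
  have l5 : (95/100:ℝ)^(2:ℝ) ≤ (95/100:ℝ)^(p-1) :=
    rpow_le_rpow_of_exponent_ge (by norm_num) (by norm_num) (by linarith)
  rw [rpow_two] at l5
  have l6 : (95/100:ℝ)^2*(bt p/ξ) ≤ G*uy x y t := by
    have : (95/100:ℝ)^2*(bt p/ξ) ≤ (95/100:ℝ)^(p-1)*(bt p/ξ) :=
      mul_le_mul_of_nonneg_right l5 (by positivity)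
    linarith
  -- upper
  have hWy : 1 ≤ W p y := by linarith
  have hW0 : 0 < W p y := by linarith
  have u1 : uy x y t ≤ (1+2*K)*W p y := by
    have : 2*K*y ≤ 2*K*W p y := mul_le_mul_of_nonneg_left (by linarith) (by linarith)
    linarith
  have u2 : |ux x y t| ≤ K*W p y := by
    refine hux.trans (mul_le_mul_of_nonneg_left (by linarith) (by linarith))
  have u3 : (ux x y t)^2+(uy x y t)^2 ≤ (Cw*W p y)^2 := by
    have a1 : (ux x y t)^2 ≤ (K*W p y)^2 := by rw [← sq_abs (ux x y t)]; gcongr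
    have a2 : (uy x y t)^2 ≤ ((1+2*K)*W p y)^2 := by gcongr
    have a3 : (K*W p y)^2 + ((1+2*K)*W p y)^2 ≤ (Cw*W p y)^2 := by
      have : (Cw*W p y)^2 - ((K*W p y)^2 + ((1+2*K)*W p y)^2) = (4*K^2+2*K)*(W p y)^2 := by
        rw [hCw]; ring
      have h2 : 0 ≤ (4*K^2+2*K)*(W p y)^2 := by positivity
      linarith
    linarith
  have hZ0 : 0 < Cw*W p y := by positivity
  have hZ1 : 1 ≤ Cw*W p y := one_le_mul_of_one_le_of_one_le hCw1 hWy
  have u4 : G ≤ (Cw*W p y)^(p-2) := by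
    have : (Cw*W p y)^(p-2) = ((Cw*W p y)^2)^(p/2-1) := by
      rw [← rpow_natCast (Cw*W p y) 2, ← rpow_mul hZ0.le]; congr 1; push_cast; ring
    rw [this]
    exact rpow_le_rpow (by positivity) u3 (by linarith)
  have u5 : (Cw*W p y)^(p-1) = (Cw*W p y)^(p-2)*(Cw*W p y) := by
    rw [← rpow_add_one hZ0.ne']; congr 1; ring
  have u6 : (Cw*W p y)^(p-1) = Cw^(p-1)*(bt p/y) := by
    rw [mul_rpow (by linarith) hW0.le, W_pow1 hp hy]
  have hZp : 0 < (Cw*W p y)^(p-2) := by positivity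
  have hCy : 0 ≤ p*(Cw^(p-1)*(bt p/y)) := by positivity
  have epq : p*bt p = 1+bt p := by linarith
  refine ⟨?_, ?_, ?_⟩
  · have : p*((95/100:ℝ)^2*(bt p/ξ)) ≤ p*(G*uy x y t) := mul_le_mul_of_nonneg_left l6 (by linarith)
    have e1 : p*((95/100:ℝ)^2*(bt p/ξ)) = (95/100:ℝ)^2*(p*bt p)/ξ := by ring
    rw [e1, epq] at this
    have e2 : (1+bt p/2)/y ≤ (95/100:ℝ)^2*(1+bt p)/ξ := by
      rw [div_le_div_iff₀ hy hξ0, hξ]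
      have e3 : (1+bt p/2)*(1+D*y) ≤ (95/100:ℝ)^2*(1+bt p) := by
        have : (1+bt p/2)*(1+D*y) ≤ (1+bt p/2)*(108/100) :=
          mul_le_mul_of_nonneg_left (by linarith) (by linarith)
        linarith
      have := mul_le_mul_of_nonneg_right e3 hy.le
      linarith
    linarith
  · have a1 : G*uy x y t ≤ (Cw*W p y)^(p-2)*(Cw*W p y) := by
      refine mul_le_mul u4 (u1.trans ?_) hv0.le hZp.le
      exact mul_le_mul_of_nonneg_right (by linarith) hW0.le
    rw [← u5, u6] at a1
    have a2 : p*(G*uy x y t) ≤ p*(Cw^(p-1)*(bt p/y)) := mul_le_mul_of_nonneg_left a1 (by linarith)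
    have a3 : p*(Cw^(p-1)*(bt p/y)) * 1 ≤ p*(Cw^(p-1)*(bt p/y)) * K := mul_le_mul_of_nonneg_left hK hCy
    have a4 : p*Cw^(p-1)*bt p*K/y = p*(Cw^(p-1)*(bt p/y)) * K := by ring
    rw [a4]; linarith
  · have a1 : G*|ux x y t| ≤ (Cw*W p y)^(p-1)*(K*|x|) := by
      refine mul_le_mul ?_ hux (abs_nonneg _) (by positivity)
      rw [u5]
      refine u4.trans ?_
      exact le_mul_of_one_le_right hZp.le hZ1
    rw [u6] at a1
    have a2 := mul_le_mul_of_nonneg_left a1 (show 0 ≤ p by linarith)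
    rw [abs_mul, abs_of_nonneg (show 0 ≤ p*G by positivity)]
    refine le_trans (le_of_eq (by ring)) (a2.trans (le_of_eq (by ring)))
end

set_option linter.all false

section
variable {p R T1 T K : ℝ} {u ux uy ut uxx uyy : ℝ → ℝ → ℝ → ℝ}
variable (H : Dat p R T1 T u ux uy ut uxx uyy) (E : Ex p R T1 T K u ux uy ut uxx uyy)
include H E

set_option maxHeartbeats 2000000 in
lemma F12t : ∃ k > 0, ∃ r > 0, ∃ s > 0, r ≤ R/2 ∧ r ≤ 1 ∧ s ≤ T - T1 ∧ ∀ x y t, 0 ≤ x → x ≤ r → 0 < y → y ≤ r →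
    T - s ≤ t → t < T → h12 T (bt p/2) (bt p/2/2) k x y t ≤ -ux x y t := by
  have hp := H.hp
  have hR := H.hR
  have hb0 := bt_pos hp
  have hb1 := bt_lt hp
  obtain ⟨g, hg⟩ : ∃ g, g = bt p/2 := ⟨_, rfl⟩
  obtain ⟨e, he⟩ : ∃ e, e = g/2 := ⟨_, rfl⟩
  rw [← hg, ← he]
  have hg0 : 0 < g := by linarith
  have hg1 : g < 1 := by linarith
  have he0 : 0 < e := by linarith
  obtain ⟨M, hMd⟩ : ∃ M : ℝ, M = 2^(1/g) := ⟨_, rfl⟩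
  have hM1 : 1 ≤ M := by rw [hMd]; exact one_le_rpow (by norm_num) (by positivity)
  have hM0 : 0 < M := by linarith
  have hMg : M^g = 2 := by rw [hMd, ← rpow_mul (by norm_num), one_div_mul_cancel hg0.ne', rpow_one]
  obtain ⟨r0, hr0, s0, hs0, C, hC, c1, c2, c3, hF⟩ := F12b H E hM0
  obtain ⟨r1, hr1, hfin⟩ := fin12 hg0 hg1 hC.le
  obtain ⟨x0, y0, t0, a1, a2, a3, a4, a5, a6, a7⟩ := F11a H E
  obtain ⟨r, hr, d1, d2⟩ : ∃ r > 0, r ≤ r0 ∧ r ≤ r1 := ⟨min r0 r1, lt_min hr0 hr1, min_le_left _ _, min_le_right _ _⟩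
  obtain ⟨s, hs, d3, d4⟩ : ∃ s > 0, s ≤ s0 ∧ s ≤ (T-t0)/2 :=
    ⟨min s0 ((T-t0)/2), lt_min hs0 (by linarith), min_le_left _ _, min_le_right _ _⟩
  obtain ⟨y1, hy1, d5, d6⟩ : ∃ y1 > 0, y1 ≤ r^2/M ∧ y1 ≤ s/M :=
    ⟨min (r^2/M) (s/M), lt_min (by positivity) (by positivity), min_le_left _ _, min_le_right _ _⟩
  have d7 : y1 ≤ r := by
    refine d5.trans ?_
    rw [div_le_iff₀ hM0]
    have : r*r ≤ r*M := mul_le_mul_of_nonneg_left (by linarith) hr.le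
    linarith [sq r]
  obtain ⟨k', hk', hk⟩ := F11b H E a1 a2 a3 a4 a5 a7 (r := r) (t1 := T - s) (by linarith) hy1 (by linarith) (by linarith)
  have hpsi : ∀ x y t, 0 < y → y ≤ r → s12 T g e x y t ≤ 2 - (q12 T x y t)^g := by
    intro x y t hy hyr
    have : y^e ≤ 1 := rpow_le_one hy.le (by linarith) he0.le
    unfold s12; linarith
  have hpsi2 : ∀ x y t, 0 < y → y ≤ r → t < T → s12 T g e x y t ≤ 2 := by
    intro x y t hy hyr ht
    have : 0 < (q12 T x y t)^g := rpow_pos_of_pos (q12_pos hy ht) _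
    linarith [hpsi x y t hy hyr]
  have hneg : ∀ x y t, 0 ≤ x → 0 < y → y ≤ r → t < T → M*y ≤ x^2+(T-t) → h12 T g e (k'/2) x y t ≤ 0 := by
    intro x y t hx hy hyr ht h
    have h1 : M ≤ q12 T x y t := by
      have : M ≤ (x^2+(T-t))/y := by rw [le_div_iff₀ hy]; exact h
      unfold q12; linarith
    have h2 : M^g ≤ (q12 T x y t)^g := rpow_le_rpow hM0.le h1 hg0.le
    have h3 : s12 T g e x y t ≤ 0 := by linarith [hpsi x y t hy hyr]
    unfold h12
    exact mul_nonpos_of_nonneg_of_nonpos (by linarith) (mul_nonpos_of_nonneg_of_nonpos hx h3)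
  have hle : ∀ x y t, 0 ≤ x → 0 < y → y ≤ r → t < T → h12 T g e (k'/2) x y t ≤ k'*x := by
    intro x y t hx hy hyr ht
    have := mul_le_mul_of_nonneg_left (hpsi2 x y t hy hyr ht) hx
    unfold h12
    have := mul_le_mul_of_nonneg_left this hk'.le
    linarith
  refine ⟨k'/2, by linarith, r, hr, s, hs, by linarith, by linarith, by linarith, ?_⟩
  intro X Y t hX hXr hY hYr ht htT
  have hTt : 0 < T - t := by linarith
  obtain ⟨c, hc, e1, e2⟩ : ∃ c > 0, c ≤ Y ∧ c ≤ (T-t)/M :=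
    ⟨min Y ((T-t)/M), lt_min hY (by positivity), min_le_left _ _, min_le_right _ _⟩
  rw [le_div_iff₀ hM0] at e2
  rw [div_eq_mul_inv] at d5 d6
  obtain ⟨k1, k2, k3, k4⟩ := h12_cont (T := T) g e (k'/2) (a := 0) (b := r) (d := r) (t1 := T - s) hc htT
  have hed : ∀ x y t', 0 ≤ x → x ≤ r → 0 < y → y ≤ r → T - s ≤ t' → t' < T → ed R T1 T x y t' := by
    intro x y t' h1 h2 h3 h4 h5 h6
    exact ed_lt (by rw [abs_of_nonneg h1]; linarith) h3.le (by linarith) (by linarith) h6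
  refine VLx H (a := 0) (b := r) (c := c) (d := r) (t1 := T - s) (t2 := t) (by linarith) (by linarith) hc.le (by linarith)
    (by linarith) htT (φ := h12 T g e (k'/2)) (φx := h12x T g e (k'/2)) (φy := h12y T g e (k'/2))
    (φt := h12t T g (k'/2)) (φxx := h12xx T g (k'/2)) (φyy := h12yy T g e (k'/2))
    (fun x hx y hy t' ht' => h12_der g e _ (by linarith [hy.1]) (by linarith [ht'.2])) k1 k2 k3 k4 ?_ ?_
    X ⟨hX, hXr⟩ Y ⟨e1, hYr⟩ t ⟨ht, le_rfl⟩
  · intro x hx y hy t' ht' hbd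
    have hy0 : 0 < y := by linarith [hy.1]
    have ht0 : t' < T := by linarith [ht'.2]
    have hd := hed x y t' hx.1 hx.2 hy0 hy.2 ht'.1 ht0
    have hnn := ux_nonpos H E hd hx.1
    by_cases hQ : M*y ≤ x^2+(T-t')
    · linarith [hneg x y t' hx.1 hy0 hy.2 ht0 hQ]
    push Not at hQ
    have hfar : y1 ≤ y → h12 T g e (k'/2) x y t' ≤ -ux x y t' := fun h =>
      (hle x y t' hx.1 hy0 hy.2 ht0).trans (hk x y t' hx.1 hx.2 h hy.2 ht'.1 ht0)
    rcases hbd with h | h | h | h | h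
    · have : h12 T g e (k'/2) x y t' ≤ k'*x := hle x y t' hx.1 hy0 hy.2 ht0
      rw [h] at this hnn ⊢
      linarith
    · refine hfar (d5.trans ?_)
      rw [← div_eq_mul_inv, div_le_iff₀ hM0]
      rw [h] at hQ
      linarith
    · exfalso
      rw [h] at hQ
      linarith [sq_nonneg x, ht'.2]
    · exact hfar (by linarith)
    · refine hfar (d6.trans ?_)
      rw [← div_eq_mul_inv, div_le_iff₀ hM0]
      rw [h] at hQ
      linarith [sq_nonneg x]
  · intro x hx y hy t' ht' hlt
    have hy0 : 0 < y := by linarith [hy.1]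
    have ht0 : t' < T := by linarith [ht'.2]
    have hd := hed x y t' hx.1.le hx.2.le hy0 hy.2.le ht'.1.le ht0
    have hnn := ux_nonpos H E hd hx.1.le
    have hQ : ¬ M*y ≤ x^2+(T-t') := fun h => by linarith [hneg x y t' hx.1.le hy0 hy.2.le ht0 h]
    push Not at hQ
    obtain ⟨f1, f2, f3⟩ := hF x y t' (by rw [abs_of_pos hx.1]; linarith [hx.2]) hy0 (by linarith [hy.2])
      (by linarith [ht'.1]) ht0 hQ.le
    rw [abs_of_pos hx.1] at f3
    have hψ0 : 0 ≤ s12 T g e x y t' := by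
      by_contra hc'
      push Not at hc'
      have : h12 T g e (k'/2) x y t' ≤ 0 := by
        unfold h12
        exact mul_nonpos_of_nonneg_of_nonpos (by linarith) (mul_nonpos_of_nonneg_of_nonpos hx.1.le hc'.le)
      linarith
    have hG0 : 0 ≤ p*((ux x y t')^2+(uy x y t')^2)^(p/2-1) := by positivity
    have hq := q12_pos (x := x) hy0 ht0
    have hqy : y ≤ q12 T x y t' := by
      unfold q12
      have : 0 ≤ (x^2+(T-t'))/y := div_nonneg (by linarith [sq_nonneg x]) hy0.le
      linarith
    have core := core12 (g := g) (e := e) (x := x) (y := y) (a := q12a T x y t') (P1 := (q12 T x y t')^(g-1))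
      (P2 := (q12 T x y t')^(g-2)) (Y1 := y^(e-1)) (Y2 := y^(e-2)) (Yg := y^(g-2)) (ψ := s12 T g e x y t')
      (F1 := p*((ux x y t')^2+(uy x y t')^2)^(p/2-1)*ux x y t')
      (F2 := p*((ux x y t')^2+(uy x y t')^2)^(p/2-1)*uy x y t') (C := C) hg0 hg1 he0 (by linarith) hx.1 hy0
      (div_nonneg (by linarith [sq_nonneg x]) (by positivity)) (rpow_pos_of_pos hq _) ?_ (rpow_pos_of_pos hy0 _) ?_ ?_
      hψ0 (hpsi2 x y t' hy0 hy.2.le ht0) hC.le (mul_nonpos_of_nonneg_of_nonpos hG0 (by linarith))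
      ((neg_le_abs _).trans f3) (by rw [hg]; exact f1) f2
      (by rw [he]; exact hfin y hy0 (by linarith [hy.2]))
    · have := mul_lt_mul_of_pos_left core (show 0 < k'/2 by linarith)
      unfold h12t h12xx h12yy h12x h12y s12t s12x s12y s12xx s12yy
      refine lt_of_eq_of_lt ?_ (lt_of_lt_of_eq this ?_) <;> ring
    · have e3 : y*(q12a T x y t'+1) = q12 T x y t' := by unfold q12a q12; field_simp
      rw [e3, show g - 1 = 1 + (g-2) by ring, rpow_add hq, rpow_one]
    · rw [show e - 1 = 1 + (e-2) by ring, rpow_add hy0, rpow_one]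
    · rw [div_le_iff₀ hy0]
      have : y^(g-2)*y = y^(g-1) := by
        rw [show g - 1 = (g-2)+1 by ring, rpow_add hy0, rpow_one]
      rw [this]
      exact rpow_le_rpow_of_nonpos hy0 hqy (by linarith)
end

set_option linter.all false

section
variable {p R T1 T K : ℝ} {u ux uy ut uxx uyy : ℝ → ℝ → ℝ → ℝ}
variable (H : Dat p R T1 T u ux uy ut uxx uyy) (E : Ex p R T1 T K u ux uy ut uxx uyy)
include H E

lemma F12T : ∃ k > 0, ∃ r > 0, r ≤ R/2 ∧ r ≤ 1 ∧ ∀ x y, 0 ≤ x → x ≤ r → 0 < y → y ≤ r →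
    k*(x*(1-(x^2/y+y)^(bt p/2))) ≤ -ux x y T := by
  obtain ⟨k, hk, r, hr, s, hs, h1, h2, h3, h⟩ := F12t H E
  have hR := H.hR
  refine ⟨k, hk, r, hr, h1, h2, fun x y hx hxr hy hyr => ?_⟩
  have he : ed R T1 T x y T := ⟨by rw [abs_of_nonneg hx]; linarith, hy.le, by linarith, H.hT.le, le_rfl,
    fun h => hy.ne' h.2.1⟩
  have hcx := H.cux (he.dom hR)
  have hq : 0 < q12 T x y T := by unfold q12; rw [sub_self, add_zero]; positivity
  have key : h12 T (bt p/2) (bt p/2/2) k x y T ≤ -ux x y T := by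
    refine le_T (f := fun t => h12 T (bt p/2) (bt p/2/2) k x y t) (g := fun t => -ux x y t) (a := 0) (b := 0)
      (T1 := T - s) (by linarith) (by linarith) le_rfl
      (fun t h4 h5 => h x y t hx hxr hy hyr h4 h5) (fun _ => ?_) (fun _ => (tend_T hcx).neg)
    have : ContinuousAt (fun t => h12 T (bt p/2) (bt p/2/2) k x y t) T := by
      have hqc : ContinuousAt (fun t => q12 T x y t) T := by unfold q12; fun_prop
      have := hqc.rpow_const (p := bt p/2) (Or.inl hq.ne')
      unfold h12 s12
      fun_prop
    exact this.tendsto.mono_left nhdsWithin_le_nhds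
  refine le_trans ?_ key
  unfold h12 s12 q12
  rw [sub_self, add_zero]
  have : 0 ≤ y^(bt p/2/2) := by positivity
  gcongr
  linarith

lemma F12X : ∃ k > 0, ∃ r > 0, r ≤ 1 ∧ r ≤ R ∧ ∀ q x, 0 < q → q ≤ r → 0 ≤ x → x ≤ q^2 →
    u x (q^3) T + k*x^2 ≤ u 0 (q^3) T := by
  obtain ⟨k, hk, r, hr, h1, h2, h⟩ := F12T H E
  have hR := H.hR
  have hb0 := bt_pos H.hp
  obtain ⟨r1, hr1, hs⟩ := small_pow (e := bt p/2) (c := 1/2) (by linarith) (by norm_num)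
  refine ⟨k/4, by linarith, min r (r1/2), lt_min hr (by linarith), (min_le_left _ _).trans h2,
    by linarith [min_le_left r (r1/2)], ?_⟩
  intro q x hq hqr hx hxq
  have hqr1 : q ≤ r := hqr.trans (min_le_left _ _)
  have hqr2 : q ≤ r1/2 := hqr.trans (min_le_right _ _)
  have q2 : q^2 ≤ q := by nlinarith
  have q3 : q^3 ≤ q := by nlinarith [sq_nonneg q]
  have q30 : 0 < q^3 := by positivity
  have hed : ∀ z ∈ Icc 0 x, ed R T1 T z (q^3) T := fun z hz =>
    ⟨by rw [abs_of_nonneg hz.1]; linarith [hz.2], q30.le, by linarith, H.hT.le, le_rfl,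
      fun h => q30.ne' h.2.1⟩
  have hd : ∀ z ∈ Icc 0 x, HasDerivAt (fun z => u z (q^3) T + k/4*z^2) (ux z (q^3) T + 2*(k/4)*z) z :=
    fun z hz => (E.der (hed z hz)).1.fun_add (Ksq_der (k/4) z)
  have : AntitoneOn (fun z => u z (q^3) T + k/4*z^2) (Icc 0 x) := by
    apply antitoneOn_of_hasDerivWithinAt_nonpos (convex_Icc _ _) (f' := fun z => ux z (q^3) T + 2*(k/4)*z)
    · intro z hz
      exact (hd z hz).continuousAt.continuousWithinAt
    · intro z hz
      exact (hd z (interior_subset hz)).hasDerivWithinAt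
    · intro z hz
      rw [interior_Icc] at hz
      have a1 := h z (q^3) hz.1.le (by linarith [hz.2]) q30 (by linarith)
      have a2 : z^2/q^3 + q^3 ≤ r1 := by
        have : z^2/q^3 ≤ q := by
          rw [div_le_iff₀ q30]
          calc z^2 ≤ (q^2)^2 := pow_le_pow_left₀ hz.1.le (by linarith [hz.2]) 2
            _ = q*q^3 := by ring
        linarith
      have a3 := hs (z^2/q^3+q^3) (by positivity) a2
      have a4 : z*(1/2) ≤ z*(1-(z^2/q^3+q^3)^(bt p/2)) := mul_le_mul_of_nonneg_left (by linarith) hz.1.le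
      have a5 := mul_le_mul_of_nonneg_left a4 hk.le
      linarith
  have := this (left_mem_Icc.mpr hx) (right_mem_Icc.mpr hx) hx
  simp only [ne_eq, OfNat.ofNat_ne_zero, not_false_eq_true, zero_pow, mul_zero, add_zero] at this
  exact this

lemma uT0 {y : ℝ} (hy : 0 < y) (hyR : y ≤ R) : u 0 y T ≤ U p y + K*y^2 := by
  have hR := H.hR
  have he : ed R T1 T 0 y T := ⟨by simp; linarith, hy.le, by linarith, H.hT.le, le_rfl,
    fun h => hy.ne' h.2.1⟩
  exact le_T (f := fun t => u 0 y t) (g := fun t => U p y + K*y^2) (a := 0) (b := 0)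
      H.hT H.hT.le le_rfl
      (fun t h4 h5 => F4u' H E (gl_lt (by simp; linarith) h4 h5) y ⟨hy.le, hyR⟩)
      (fun _ => tend_T (H.cu (he.dom hR))) (fun _ => tendsto_const_nhds)

lemma vT0 {y : ℝ} (hy : 0 < y) (hyR : y ≤ R) : uy 0 y T ≤ W p y + 2*K*y := by
  have hR := H.hR
  have he : ed R T1 T 0 y T := ⟨by simp; linarith, hy.le, by linarith, H.hT.le, le_rfl,
    fun h => hy.ne' h.2.1⟩
  exact le_T (f := fun t => uy 0 y t) (g := fun t => W p y + 2*K*y) (a := 0) (b := 0)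
      H.hT H.hT.le le_rfl
      (fun t h4 h5 => F4' H E (gl_lt (by simp; linarith) h4 h5) hy hyR)
      (fun _ => tend_T (H.cuy (he.dom hR))) (fun _ => tendsto_const_nhds)

omit E in
lemma cuxx_T {x y : ℝ} (hx : 0 < x) (hxR : x ≤ R) (hy : 0 ≤ y) (hyR : y ≤ R) :
    ContinuousAt (fun q : ℝ × ℝ => uxx q.1 q.2 T) (x, y) := by
  have hR := H.hR
  exact ContinuousAt.comp (g := fun q : ℝ × ℝ × ℝ => uxx q.1 q.2.1 q.2.2)
    (f := fun q : ℝ × ℝ => (q.1, q.2, T)) (x := (x, y))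
    (H.cuxx ⟨by rw [abs_of_pos hx]; linarith, hy, by linarith, H.hT.le, le_rfl, fun h => hx.ne' h.1⟩)
    (by fun_prop)

lemma F13 {X y : ℝ} (hX : 0 < X) (hXR : X ≤ R) (hy : 0 < y) (hyR : y ≤ R) :
    ∃ z ∈ Icc (X/2) X, ∫ s in (0:ℝ)..y, uxx z s T ≤ 2*K*y := by
  have hR := H.hR
  have hK := E.hK
  by_contra hcon
  push Not at hcon
  have hX2 : X/2 ≤ X := by linarith
  have hC : ContinuousOn (fun q : ℝ × ℝ => uxx q.1 q.2 T) (Icc (X/2) X ×ˢ Icc 0 y) := by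
    rintro ⟨a, b⟩ ⟨ha, hb⟩
    exact (cuxx_T H (by linarith [ha.1]) (ha.2.trans hXR) hb.1 (hb.2.trans hyR)).continuousWithinAt
  have hI : IntegrableOn (fun q : ℝ × ℝ => uxx q.1 q.2 T) (Icc (X/2) X ×ˢ Icc 0 y) (volume.prod volume) :=
    hC.integrableOn_compact (isCompact_Icc.prod isCompact_Icc)
  have hI2 : Integrable (fun q : ℝ × ℝ => uxx q.1 q.2 T)
      ((volume.restrict (uIoc (X/2) X)).prod (volume.restrict (uIoc 0 y))) := by
    rw [Measure.prod_restrict, uIoc_of_le hX2, uIoc_of_le hy.le]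
    exact hI.mono_set (Set.prod_mono Ioc_subset_Icc_self Ioc_subset_Icc_self)
  have hsw := intervalIntegral_intervalIntegral_swap (F := fun a b => uxx a b T) (a := X/2) (b := X) (c := 0) (d := y)
    (by rw [Measure.prod_restrict, ← Measure.volume_eq_prod] at hI2; exact hI2)
  have hii : IntervalIntegrable (fun a => ∫ s in (0:ℝ)..y, uxx a s T) volume (X/2) X := by
    have := hI2.integral_prod_left
    rw [intervalIntegrable_iff]
    refine this.congr (Eventually.of_forall fun a => ?_)
    simp only [uIoc_of_le hy.le]
    rw [intervalIntegral.integral_of_le hy.le]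
  have h1 : ∫ a in (X/2)..X, (2*K*y) ≤ ∫ a in (X/2)..X, ∫ s in (0:ℝ)..y, uxx a s T :=
    intervalIntegral.integral_mono_on hX2 intervalIntegrable_const hii (fun a ha => (hcon a ha).le)
  have hed : ∀ x ∈ Icc (X/2) X, ∀ s ∈ Icc 0 y, ed R T1 T x s T := fun x hx s hs =>
    ⟨by rw [abs_of_pos (by linarith [hx.1])]; linarith [hx.2], hs.1, by linarith [hs.2], H.hT.le, le_rfl,
      fun h => by linarith [h.1, hx.1]⟩
  have h2 : ∀ s ∈ Icc 0 y, ∫ a in (X/2)..X, uxx a s T = ux X s T - ux (X/2) s T := by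
    intro s hs
    refine intervalIntegral.integral_eq_sub_of_hasDerivAt (f := fun x => ux x s T) (fun x hx => ?_) ?_
    · rw [uIcc_of_le hX2] at hx
      exact (E.der (hed x hx s hs)).2.2.2.1
    · apply ContinuousOn.intervalIntegrable
      rw [uIcc_of_le hX2]
      exact hC.comp (f := fun x => (x, s)) (by fun_prop) (fun x hx => ⟨hx, hs⟩)
  have h3 : ∀ s ∈ Icc 0 y, ux X s T - ux (X/2) s T ≤ K*(X/2) := by
    intro s hs
    have a1 := ux_nonpos H E (hed X ⟨hX2, le_rfl⟩ s hs) hX.le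
    have a2 := E.hux (hed (X/2) ⟨le_rfl, hX2⟩ s hs)
    rw [abs_of_pos (by linarith : 0 < X/2)] at a2
    linarith [(abs_le.mp a2).1]
  have hii2 : IntervalIntegrable (fun s => ∫ a in (X/2)..X, uxx a s T) volume 0 y := by
    have := hI2.integral_prod_right
    rw [intervalIntegrable_iff]
    refine this.congr (Eventually.of_forall fun a => ?_)
    simp only [uIoc_of_le hX2]
    rw [intervalIntegral.integral_of_le hX2]
  have h4 : ∫ s in (0:ℝ)..y, ∫ a in (X/2)..X, uxx a s T ≤ ∫ s in (0:ℝ)..y, K*(X/2) :=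
    intervalIntegral.integral_mono_on hy.le hii2 intervalIntegrable_const
      (fun s hs => (h2 s hs).trans_le (h3 s hs))
  rw [intervalIntegral.integral_const, smul_eq_mul] at h1 h4
  have h5 : 0 < K*X*y := by positivity
  have h6 : (X - X/2)*(2*K*y) ≤ (y-0)*(K*(X/2)) := by linarith
  nlinarith
end

set_option linter.all false

lemma prim {f : ℝ → ℝ} {Y : ℝ} (hY : 0 ≤ Y) (hf : ContinuousOn f (Icc 0 Y)) (h0 : ∀ s ∈ Icc 0 Y, 0 ≤ f s) :
    ∃ J : ℝ → ℝ, Continuous J ∧ (∀ s ∈ Icc 0 Y, HasDerivAt J (f s) s) ∧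
      ∀ s ∈ Icc 0 Y, 0 ≤ J s ∧ J s ≤ ∫ s in (0:ℝ)..Y, f s := by
  set g : ℝ → ℝ := fun s => f (projIcc 0 Y hY s) with hg
  have hgc : Continuous g := by
    have : Continuous ((Icc 0 Y).restrict f) := hf.restrict
    exact this.comp continuous_projIcc
  have hgf : ∀ s ∈ Icc 0 Y, g s = f s := fun s hs => by
    simp only [hg]; rw [projIcc_of_mem hY hs]
  have hg0 : ∀ s, 0 ≤ g s := fun s => h0 _ (projIcc 0 Y hY s).2
  refine ⟨fun s => ∫ a in (0:ℝ)..s, g a, ?_, ?_, ?_⟩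
  · exact intervalIntegral.continuous_primitive (fun a b => hgc.intervalIntegrable a b) 0
  · intro s hs
    rw [← hgf s hs]
    exact (hgc.integral_hasStrictDerivAt 0 s).hasDerivAt
  · intro s hs
    refine ⟨intervalIntegral.integral_nonneg hs.1 (fun a _ => hg0 a), ?_⟩
    have e : ∫ a in (0:ℝ)..Y, f a = ∫ a in (0:ℝ)..Y, g a :=
      intervalIntegral.integral_congr (fun a ha => by rw [uIcc_of_le hY] at ha; exact (hgf a ha).symm)
    rw [e, ← intervalIntegral.integral_add_adjacent_intervals (hgc.intervalIntegrable 0 s) (hgc.intervalIntegrable s Y)]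
    linarith [intervalIntegral.integral_nonneg (μ := volume) hs.2 (fun a _ => hg0 a)]

lemma bern {a S q : ℝ} (ha : 0 ≤ a) (hS : 0 < S) (hq : 1 ≤ q) : S^q - a^q ≤ q*(S-a)*S^(q-1) := by
  have := one_add_mul_self_le_rpow_one_add (s := a/S-1) (by have : 0 ≤ a/S := by positivity
                                                            linarith) hq
  rw [show 1 + (a/S-1) = a/S by ring, div_rpow ha hS.le, le_div_iff₀ (by positivity)] at this
  have e : S^q = S*S^(q-1) := by rw [rpow_sub_one hS.ne']; field_simp
  have e2 : (1 + q*(a/S-1))*S^q = S^q + q*(a-S)*S^(q-1) := by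
    rw [e]; field_simp
  linarith

lemma err14 {p K b v w x : ℝ} (hp : 2 < p) (hp3 : p ≤ 3) (hK : 1 ≤ K) (hb : |b| ≤ K*x) (hb1 : |b| ≤ K)
    (hv : -K ≤ v) (hvw : v ≤ 2*w - K) (hw : 0 < w) :
    (b^2+v^2)^(p/2) ≤ (max v 0)^p + 4*K^4 + 3*K^2*x^2*w^(p-2) := by
  have hb2 : b^2 ≤ K^2*x^2 := by rw [← sq_abs b, ← mul_pow]; exact pow_le_pow_left₀ (abs_nonneg _) hb 2
  have hwp : 0 < w^(p-2) := by positivity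
  have hbK : b^2 ≤ K^2 := by rw [← sq_abs b]; exact pow_le_pow_left₀ (abs_nonneg _) hb1 2
  rcases le_total v 0 with h | h
  · rw [max_eq_right h, zero_rpow (by linarith)]
    have h1 : v^2 ≤ K^2 := by nlinarith
    have : (b^2+v^2)^(p/2) ≤ (2*K^2)^(p/2) := rpow_le_rpow (by positivity) (by linarith) (by linarith)
    have h2 : (2*K^2)^(p/2) ≤ (2*K^2)^(2:ℝ) := rpow_le_rpow_of_exponent_le (by nlinarith) (by linarith)
    have h3 : (2*K^2)^(2:ℝ) = 4*K^4 := by rw [rpow_two]; ring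
    rw [h3] at h2
    have : 0 ≤ 3*K^2*x^2*w^(p-2) := by positivity
    linarith
  · rw [max_eq_left h]
    rcases eq_or_lt_of_le (show 0 ≤ b^2+v^2 by positivity) with e | hS
    · rw [← e, zero_rpow (by linarith)]; positivity
    have h1 := bern (a := v^2) (sq_nonneg v) hS (q := p/2) (by linarith)
    have h2 : (v^2)^(p/2) = v^p := by
      rw [← rpow_natCast, ← rpow_mul h]; congr 1; push_cast; ring
    have h3 : (b^2+v^2)^(p/2-1) ≤ 2*w^(p-2) := by
      have h31 : b^2+v^2 ≤ (2*w)^2 := by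
        have : b^2+v^2 ≤ (|b|+v)^2 := by
          have := mul_nonneg (abs_nonneg b) h
          nlinarith [sq_abs b]
        exact this.trans (pow_le_pow_left₀ (by positivity) (by linarith) 2)
      calc (b^2+v^2)^(p/2-1) ≤ ((2*w)^2)^(p/2-1) := rpow_le_rpow hS.le h31 (by linarith)
        _ = (2*w)^(p-2) := by rw [← rpow_natCast, ← rpow_mul (by positivity)]; congr 1; push_cast; ring
        _ = 2^(p-2)*w^(p-2) := mul_rpow (by norm_num) hw.le
        _ ≤ 2^(1:ℝ)*w^(p-2) := by
            gcongr
            · norm_num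
            · linarith
        _ = 2*w^(p-2) := by rw [rpow_one]
    have h4 : p/2*(b^2+v^2-v^2)*(b^2+v^2)^(p/2-1) ≤ (3/2*(K^2*x^2))*(2*w^(p-2)) := by
      apply mul_le_mul _ h3 (by positivity) (by positivity)
      rw [add_sub_cancel_right]
      exact mul_le_mul (by linarith) hb2 (by positivity) (by norm_num)
    have : 0 < 4*K^4 := by positivity
    rw [h2] at h1
    linarith

section
variable {p R T1 T K : ℝ} {u ux uy ut uxx uyy : ℝ → ℝ → ℝ → ℝ}
variable (H : Dat p R T1 T u ux uy ut uxx uyy) (E : Ex p R T1 T K u ux uy ut uxx uyy)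
include H E

/-- lower bound along a good vertical line -/
lemma F14a {X y z A : ℝ} (hz : 0 < z) (hzX : z ≤ X) (hX1 : X ≤ 1) (hXR : X ≤ R) (hy : 0 < y) (hyR : y ≤ R)
    (hy1 : y ≤ 1) (hWy : 3*K ≤ W p y) (hA : 0 < A) (h0 : W p A ≤ uy z 0 T)
    (hI : ∫ s in (0:ℝ)..y, uxx z s T ≤ 2*K*y) :
    U p (y+A) - U p A - (7*K^4*y+6*K^2*X^2)*y ≤ u z y T := by
  have hp := H.hp
  have hp3 := H.hp3
  have hR := H.hR
  have hK := E.hK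
  have hb0 := bt_pos hp
  have hb1 := bt_lt hp
  have hb2 : 1/2 ≤ bt p := by unfold bt; rw [div_le_div_iff₀] <;> linarith
  have hg : gl R T1 T z T := ⟨by rw [abs_of_pos hz]; linarith, H.hT.le, le_rfl, fun h => hz.ne' h.1⟩
  have hcc : ContinuousOn (fun s => uxx z s T) (Icc 0 y) := fun s hs =>
    (ContinuousAt.comp (g := fun q : ℝ × ℝ => uxx q.1 q.2 T) (f := fun s => (z, s)) (x := s)
      (cuxx_T H hz (by linarith) hs.1 (hs.2.trans hyR)) (by fun_prop)).continuousWithinAt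
  have hc : ContinuousOn (fun s => uxx z s T + K) (Icc 0 y) := hcc.add continuousOn_const
  obtain ⟨J, J1, J2, J3⟩ := prim hy.le hc (fun s hs => by linarith [E.huxx (hg.ed hs.1 (hs.2.trans hyR))])
  have hJ : ∫ s in (0:ℝ)..y, (uxx z s T + K) ≤ 3*K*y := by
    rw [intervalIntegral.integral_add
      (ContinuousOn.intervalIntegrable (by rw [uIcc_of_le hy.le]; exact hcc)) intervalIntegrable_const,
      intervalIntegral.integral_const, smul_eq_mul]
    linarith
  have hdΦ : ∀ s ∈ Ioo 0 y, HasDerivAt (fun s => J s + 4*K^4*s + 3*K^2*X^2*(1/bt p)*s^(bt p))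
      (uxx z s T + K + 4*K^4 + 3*K^2*X^2*s^(bt p-1)) s := by
    intro s hs
    refine (((J2 s (Ioo_subset_Icc_self hs)).fun_add ((hasDerivAt_id s).const_mul (4*K^4))).fun_add
      ((hasDerivAt_rpow_const (p := bt p) (Or.inl hs.1.ne')).const_mul (3*K^2*X^2*(1/bt p)))).congr_deriv ?_
    field_simp
  have hlow := ode_low (v := fun s => uy z s T) (v' := fun s => uyy z s T) (Y := y)
    (Φ := fun s => J s + 4*K^4*s + 3*K^2*X^2*(1/bt p)*s^(bt p))
    (φ := fun s => uxx z s T + K + 4*K^4 + 3*K^2*X^2*s^(bt p-1)) hp hA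
    ((v_cont H E hg).mono (Icc_subset_Icc_right hyR)) ?_
    (fun s hs => (E.der (hg.ed hs.1.le (hs.2.le.trans hyR))).2.2.2.2) hdΦ ?_ ?_ h0
  · refine incr_le (g := fun s => u z s T) (g' := fun s => uy z s T) (Y := y)
      (f := fun s => U p (s+A) - U p A - (7*K^4*y+6*K^2*X^2)*s)
      (f' := fun s => W p (s+A) - (7*K^4*y+6*K^2*X^2)) ?_ ((u_cont H E hg).mono (Icc_subset_Icc_right hyR)) ?_
      (fun s hs => (E.der (hg.ed hs.1.le (hs.2.le.trans hyR))).2.1) ?_ ?_ y ⟨hy.le, le_rfl⟩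
    · have := U_cont hp
      exact Continuous.continuousOn (by fun_prop)
    · intro s hs
      have := HasDerivAt.comp_add_const s A (U_der hp (show 0 < s + A by linarith [hs.1]))
      exact ((this.sub_const _).fun_sub ((hasDerivAt_id s).const_mul (7*K^4*y+6*K^2*X^2))).congr_deriv (by ring)
    · simp [E.bc (hg.ed le_rfl hR.le)]
    · intro s hs
      have h1 := hlow s (Ioo_subset_Icc_self hs)
      have h2 := (J3 s (Ioo_subset_Icc_self hs)).2
      have h3 : s^(bt p) ≤ 1 := rpow_le_one hs.1.le (by linarith [hs.2]) hb0.le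
      have h4 : 3*K^2*X^2*(1/bt p)*s^(bt p) ≤ 3*K^2*X^2*2*1 := by
        have : 1/bt p ≤ 2 := by rw [div_le_iff₀ hb0]; linarith
        have : 0 ≤ s^(bt p) := rpow_nonneg hs.1.le _
        gcongr
      have h5 : 4*K^4*s ≤ 4*K^4*y := by have := hs.2.le; gcongr
      have h6 : 3*K*y ≤ 3*K^4*y := by
        have : K^1 ≤ K^4 := pow_le_pow_right₀ hK (by norm_num)
        rw [pow_one] at this
        gcongr
      linarith
  · have : Continuous (fun s : ℝ => s^(bt p)) := continuous_id.rpow_const (fun _ => Or.inr hb0.le)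
    exact Continuous.continuousOn (by fun_prop)
  · intro s hs
    have h1 := (J3 s hs).1
    have h2 := hs.1
    positivity
  · intro s hs
    have he := hg.ed hs.1.le (hs.2.le.trans hyR)
    have e1 := E.pde he hs.1
    have e3 := (abs_le.mp (E.hut he)).1
    have e4 := E.hux he
    rw [abs_of_pos hz] at e4
    have e5 := F4' H E hg hs.1 (hs.2.le.trans hyR)
    have e6 : 3*K ≤ W p s := hWy.trans (W_anti hp hs.1 hs.2.le)
    have e7 : K*z ≤ K*X := mul_le_mul_of_nonneg_left hzX (by linarith)
    have e8 : K*X ≤ K*1 := mul_le_mul_of_nonneg_left hX1 (by linarith)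
    have e9 : 2*K*s ≤ 2*K*1 := mul_le_mul_of_nonneg_left (by linarith [hs.2]) (by linarith)
    have key := err14 (p := p) (K := K) (b := ux z s T) (v := uy z s T) (w := W p s) (x := X) hp hp3 hK
      (by linarith) (by linarith) (E.huy he) (by linarith) (W_pos hp hs.1)
    rw [W_pow2 hp hs.1] at key
    have e10 : (bt p)^(1-bt p) ≤ 1 := rpow_le_one hb0.le hb1.le (by linarith)
    rw [show -(1-bt p) = bt p-1 by ring] at key
    have e11 : 3*K^2*X^2*((bt p)^(1-bt p)*s^(bt p-1)) ≤ 3*K^2*X^2*(1*s^(bt p-1)) := by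
      have : 0 ≤ s^(bt p-1) := rpow_nonneg hs.1.le _
      gcongr
    linarith

lemma F14 : ∃ c > 0, ∃ r > 0, r ≤ R ∧ ∀ X, 0 < X → X ≤ r →
    uy X 0 T ≤ W p (c*(X^2)^((p-1)/(p-2))) := by
  have hp := H.hp
  have hp3 := H.hp3
  have hR := H.hR
  have hK := E.hK
  have hb0 := bt_pos hp
  have hb1 := bt_lt hp
  have hdp := dp_pos hp
  have hn := (n_facts H E hp hp3).2
  obtain ⟨k, hk, r, hr, hr1, hrR, hX⟩ := F12X H E
  obtain ⟨s1, hs1, hs1', hWs⟩ := W_large hp (3*K) one_pos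
  obtain ⟨c, hc, hcU⟩ := small_pow (e := 1-bt p) (c := k/16*(1-bt p)/(bt p^bt p)) (by linarith)
    (by have : 0 < 1 - bt p := by linarith
        positivity)
  have hcU := hcU c hc.le le_rfl
  obtain ⟨r2, hr2, g1, g2, g3⟩ : ∃ r2 > 0, r2 ≤ r ∧ r2 ≤ s1 ∧ r2 ≤ k/(16*14*K^4) := by
    refine ⟨min r (min s1 (k/(16*14*K^4))), lt_min hr (lt_min hs1 (by positivity)), ?_, ?_, ?_⟩
    · simp
    · simp
    · simp
  rw [le_div_iff₀ (by positivity)] at g3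
  refine ⟨c, hc, r2^2, by positivity, by nlinarith, ?_⟩
  intro X hX0 hXr
  obtain ⟨q, hq, rfl⟩ : ∃ q, 0 < q ∧ X = q^2 := ⟨√X, Real.sqrt_pos.mpr hX0, (Real.sq_sqrt hX0.le).symm⟩
  have hqr : q ≤ r2 := (sq_le_sq₀ hq.le hr2.le).mp hXr
  have q1 : q ≤ 1 := by linarith
  have q2 : q^2 ≤ q := by nlinarith
  have q3 : q^3 ≤ q := by nlinarith [sq_nonneg q]
  have q30 : 0 < q^3 := by positivity
  obtain ⟨z, hz, hI⟩ := F13 H E hX0 (by linarith) q30 (by linarith)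
  have hz0 : 0 < z := by linarith [hz.1]
  obtain ⟨A, hAd⟩ : ∃ A, A = c*((q^2)^2)^((p-1)/(p-2)) := ⟨_, rfl⟩
  have hA : 0 < A := by rw [hAd]; positivity
  have hUA : U p A ≤ k/16*q^4 := by
    have : U p A = bt p^bt p/(1-bt p)*(c^(1-bt p)*q^4) := by
      unfold U
      rw [hAd, mul_rpow hc.le (by positivity), ← rpow_mul (by positivity), hn, rpow_one]
      ring
    rw [this, ← mul_assoc]
    apply mul_le_mul_of_nonneg_right _ (by positivity)
    rw [le_div_iff₀ hdp] at hcU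
    rw [div_mul_eq_mul_div, div_le_iff₀ (by linarith)]
    linarith
  rw [← hAd]
  have hv : uy z 0 T ≤ W p A := by
    by_contra hcon
    push Not at hcon
    have a1 := F14a H E (X := q^2) (y := q^3) (z := z) (A := A) hz0 hz.2 (by linarith) (by linarith) q30 (by linarith)
      (by linarith) (hWs.trans (W_anti hp q30 (by linarith))) hA hcon.le hI
    have a2 := hX q z hq (by linarith) hz0.le hz.2
    have a3 := uT0 H E q30 (by linarith)
    have a4 := U_mono hp q30.le (show q^3 ≤ q^3 + A by linarith)
    have a5 : (q^2/2)^2 ≤ z^2 := pow_le_pow_left₀ (by positivity) hz.1 2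
    have a6 : k*(q^2/2)^2 ≤ k*z^2 := mul_le_mul_of_nonneg_left a5 hk.le
    have K4 : K^1 ≤ K^4 := pow_le_pow_right₀ hK (by norm_num)
    have K42 : K^2 ≤ K^4 := pow_le_pow_right₀ hK (by norm_num)
    have a7 : (7*K^4*q^3+6*K^2*(q^2)^2)*q^3 + K*(q^3)^2 ≤ 14*K^4*q^6 := by
      have e1 : K*q^6 ≤ K^4*q^6 := by gcongr; linarith
      have e2 : 6*K^2*q^7 ≤ 6*K^4*q^6 := by
        have : q^7 ≤ q^6 := pow_le_pow_of_le_one hq.le q1 (by norm_num)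
        gcongr
      have : (7*K^4*q^3+6*K^2*(q^2)^2)*q^3 + K*(q^3)^2 = 7*K^4*q^6 + 6*K^2*q^7 + K*q^6 := by ring
      linarith
    have a8 : 14*K^4*q^6 ≤ k/16*q^4 := by
      have e1 : q^2*(14*K^4) ≤ k/16 := by
        have : q^2*(14*K^4) ≤ r2*(14*K^4) := by gcongr; linarith
        linarith
      calc 14*K^4*q^6 = q^2*(14*K^4)*q^4 := by ring
        _ ≤ k/16*q^4 := by gcongr
    have a9 : 0 < k*q^4 := by positivity
    have a10 : k*(q^2/2)^2 = k*q^4/4 := by ring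
    linarith
  have hgz : ∀ z, 0 < z → z ≤ q^2 → gl R T1 T z T := fun z h1 h2 =>
    ⟨by rw [abs_of_pos h1]; linarith, H.hT.le, le_rfl, fun h => h1.ne' h.1⟩
  refine le_trans ?_ hv
  refine uy_cmp H E (hgz _ hX0 le_rfl) (hgz z hz0 hz.2) (fun y hy hyR => ?_)
  exact mono_pos H E (fun x hx => (hgz x (by linarith [hx.1]) hx.2).ed hy.le hyR.le) hz0.le hz.2

lemma F15 : ∃ c > 0, ∃ r > 0, r ≤ R ∧ ∀ x y, 0 ≤ x → x ≤ r → 0 ≤ y → y ≤ r → ¬(x = 0 ∧ y = 0) →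
    uy x y T ≤ W p (y + c*(x^2)^((p-1)/(p-2))) + 2*K*R := by
  obtain ⟨c, hc, r, hr, hrR, h⟩ := F14 H E
  have hp := H.hp
  have hR := H.hR
  have hK := E.hK
  refine ⟨c, hc, r, hr, hrR, fun x y hx hxr hy hyr hxy => ?_⟩
  have hKy : 2*K*y ≤ 2*K*R := by gcongr; linarith
  rcases eq_or_lt_of_le hx with e | hx0
  · subst e
    have hy0 : 0 < y := lt_of_le_of_ne hy (fun h => hxy ⟨rfl, h.symm⟩)
    have := vT0 H E hy0 (by linarith)
    have e0 : (p-1)/(p-2) ≠ 0 := (div_pos (by linarith) (by linarith)).ne'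
    rw [zero_pow two_ne_zero, zero_rpow e0, mul_zero, add_zero]
    linarith
  · have hg : gl R T1 T x T := ⟨by rw [abs_of_pos hx0]; linarith, H.hT.le, le_rfl, fun h => hx0.ne' h.1⟩
    have := F4 H E hg (by positivity) (h x hx0 hxr) y ⟨hy, by linarith⟩
    linarith

lemma F10T : ∃ C > 0, ∃ C3 > 0, ∃ r > 0, r ≤ R ∧ ∀ x y, |x| ≤ r → 0 ≤ y → y ≤ r → ¬(x = 0 ∧ y = 0) →
    W p (y + C*(x^2)^((p-1)/(p-2))) - C3 ≤ uy x y T := by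
  obtain ⟨C, hC, C3, hC3, r, hr, s, hs, hrR, hsT, h⟩ := F10 H E
  have hp := H.hp
  have hR := H.hR
  refine ⟨C, hC, C3, hC3, r, hr, hrR, fun x y hx hy hyr hxy => ?_⟩
  have he : ed R T1 T x y T := ⟨by linarith, hy, by linarith, H.hT.le, le_rfl, fun h => hxy ⟨h.1, h.2.1⟩⟩
  have e0 : 0 < (p-1)/(p-2) := (div_pos (by linarith) (by linarith))
  have key := le_T (f := fun t => W p (y + C*(x^2+(T-t))^((p-1)/(p-2))) - C3) (g := fun t => uy x y t) (a := 0) (b := 0)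
      (T1 := T - s) (by linarith) (by linarith) le_rfl
      (fun t h4 h5 => h x y t hx hy hyr h4 h5) (fun _ => ?_) (fun _ => tend_T (H.cuy (he.dom hR)))
  · simpa using key
  · have hpos : 0 < y + C*(x^2+(T-T))^((p-1)/(p-2)) := by
      rw [sub_self, add_zero]
      by_cases hx0 : x = 0
      · have hy0 : 0 < y := lt_of_le_of_ne hy (fun h => hxy ⟨hx0, h.symm⟩)
        positivity
      · have : 0 < x^2 := by positivity
        positivity
    have : ContinuousAt (fun t => W p (y + C*(x^2+(T-t))^((p-1)/(p-2))) - C3) T := by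
      have h1 : ContinuousAt (fun t => y + C*(x^2+(T-t))^((p-1)/(p-2))) T := by
        have : ContinuousAt (fun t => (x^2+(T-t))^((p-1)/(p-2))) T :=
          ContinuousAt.rpow_const (by fun_prop) (Or.inr e0.le)
        fun_prop
      exact (ContinuousAt.comp (g := W p) (f := fun t => y + C*(x^2+(T-t))^((p-1)/(p-2))) (x := T)
        (W_contAt hp hpos) h1).sub continuousAt_const
    exact this.tendsto.mono_left nhdsWithin_le_nhds
end

set_option linter.all false

lemma cont_refl {f : ℝ → ℝ → ℝ → ℝ} {x y t : ℝ}
    (h : ContinuousAt (fun q : ℝ × ℝ × ℝ => f q.1 q.2.1 q.2.2) (-x, y, t)) :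
    ContinuousAt (fun q : ℝ × ℝ × ℝ => f (-q.1) q.2.1 q.2.2) (x, y, t) :=
  ContinuousAt.comp (g := fun q : ℝ × ℝ × ℝ => f q.1 q.2.1 q.2.2)
    (f := fun q : ℝ × ℝ × ℝ => (-q.1, q.2.1, q.2.2)) (x := (x, y, t)) h (by fun_prop)

lemma der_refl {f : ℝ → ℝ} {f' x : ℝ} (h : HasDerivAt f f' (-x)) : HasDerivAt (fun s => f (-s)) (-f') x :=
  (HasDerivAt.comp x h (hasDerivAt_neg x)).congr_deriv (by ring)

section
variable {p R T1 T K : ℝ} {u ux uy ut uxx uyy : ℝ → ℝ → ℝ → ℝ}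

lemma dom_refl {x y t : ℝ} (h : dom R T1 T x y t) : dom R T1 T (-x) y t :=
  ⟨by rw [abs_neg]; exact h.1, h.2.1, h.2.2.1, h.2.2.2.1, h.2.2.2.2.1,
    fun h' => h.2.2.2.2.2 ⟨by linarith [h'.1], h'.2⟩⟩

lemma Dat.refl (H : Dat p R T1 T u ux uy ut uxx uyy) :
    Dat p R T1 T (fun x => u (-x)) (fun x y t => -ux (-x) y t) (fun x => uy (-x)) (fun x => ut (-x))
      (fun x => uxx (-x)) (fun x => uyy (-x)) where
  hp := H.hp
  hp3 := H.hp3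
  hR := H.hR
  hT := H.hT
  der := fun x y t h => by
    have d := H.der (dom_refl h)
    refine ⟨der_refl (f := fun s => u s y t) d.1, d.2.1, d.2.2.1, ?_, d.2.2.2.2⟩
    exact (der_refl (f := fun s => ux s y t) d.2.2.2.1).fun_neg.congr_deriv (by ring)
  cu := fun x y t h => cont_refl (H.cu (dom_refl h))
  cux := fun x y t h => (cont_refl (H.cux (dom_refl h))).neg
  cuy := fun x y t h => cont_refl (H.cuy (dom_refl h))
  cut := fun x y t h => cont_refl (H.cut (dom_refl h))
  cuxx := fun x y t h => cont_refl (H.cuxx (dom_refl h))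
  cuyy := fun x y t h => cont_refl (H.cuyy (dom_refl h))
  pde := fun x y t h hy ht => by
    have := H.pde (dom_refl h) hy ht
    rw [neg_sq]; exact this
  bc := fun x t hx h1 h2 => H.bc (by rw [abs_neg]; exact hx) h1 h2
  nn := fun x y t h ht => H.nn (dom_refl h) ht
  mon := fun x y t h hy ht => by
    have := H.mon (dom_refl h) hy ht
    linarith
  blow := fun M δ hδ => by
    obtain ⟨x, y, t, h1, h2, h3, h4, h5, h6⟩ := H.blow M δ hδ
    refine ⟨-x, y, t, dom_refl h1, by rw [abs_neg]; exact h2, h3, h4, h5, ?_⟩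
    simp only [neg_neg, neg_sq]
    exact h6

lemma W_cmp (hp : 2 < p) {x y c c' : ℝ} (hc : 0 < c) (hcc : c ≤ c') (hy : 0 ≤ y) (hxy : ¬(x = 0 ∧ y = 0)) :
    W p (y + c'*(x^2)^((p-1)/(p-2))) ≤ W p (y + c*(x^2)^((p-1)/(p-2))) := by
  have h0 : 0 ≤ (x^2)^((p-1)/(p-2)) := by positivity
  apply W_anti hp
  · by_cases hx : x = 0
    · have hy0 : 0 < y := lt_of_le_of_ne hy (fun h => hxy ⟨hx, h.symm⟩)
      positivity
    · have : 0 < x^2 := by positivity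
      positivity
  · gcongr

/-- the profile in terms of the abstract data -/
lemma profile (H : Dat p R T1 T u ux uy ut uxx uyy) : ∃ C1 > 0, ∃ C2 > 0, ∃ C3 > 0, ∃ r > 0, r ≤ R ∧
    ∀ x y, |x| ≤ r → 0 ≤ y → y ≤ r → ¬(x = 0 ∧ y = 0) →
      W p (y + C1*(x^2)^((p-1)/(p-2))) - C3 ≤ uy x y T ∧
      uy x y T ≤ W p (y + C2*(x^2)^((p-1)/(p-2))) + C3 := by
  obtain ⟨K, E⟩ := exists_ex H
  obtain ⟨K', E'⟩ := exists_ex H.refl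
  obtain ⟨C1, hC1, C3, hC3, r1, hr1, hr1R, h1⟩ := F10T H E
  obtain ⟨c, hc, r2, hr2, hr2R, h2⟩ := F15 H E
  obtain ⟨c', hc', r3, hr3, hr3R, h3⟩ := F15 H.refl E'
  have hR := H.hR
  have hp := H.hp
  have hK := E.hK
  have hK' := E'.hK
  have k1 : 0 < 2*K*R := by positivity
  have k2 : 0 < 2*K'*R := by positivity
  refine ⟨C1, hC1, min c c', lt_min hc hc', C3+2*K*R+2*K'*R, by positivity, min r1 (min r2 r3),
    lt_min hr1 (lt_min hr2 hr3), (min_le_left _ _).trans hr1R, ?_⟩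
  intro x y hx hy hyr hxy
  have m1 := min_le_left r1 (min r2 r3)
  have m2 := (min_le_right r1 (min r2 r3)).trans (min_le_left r2 r3)
  have m3 := (min_le_right r1 (min r2 r3)).trans (min_le_right r2 r3)
  constructor
  · have := h1 x y (hx.trans m1) hy (hyr.trans m1) hxy
    linarith
  · rcases le_total 0 x with h | h
    · rw [abs_of_nonneg h] at hx
      have := h2 x y h (hx.trans m2) hy (hyr.trans m2) hxy
      have := W_cmp hp (lt_min hc hc') (min_le_left c c') hy hxy
      linarith
    · rw [abs_of_nonpos h] at hx
      have := h3 (-x) y (by linarith) (hx.trans m3) hy (hyr.trans m3) (fun h' => hxy ⟨by linarith [h'.1], h'.2⟩)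
      rw [neg_neg, neg_sq] at this
      have := W_cmp hp (lt_min hc hc') (min_le_right c c') hy hxy
      linarith

lemma ubd (H : Dat p R T1 T u ux uy ut uxx uyy) : ∃ C > 0, ∀ x y, |x| ≤ 2*R → 0 < y → y ≤ 2*R →
    u x y T ≤ C ∧ |ux x y T| ≤ C := by
  obtain ⟨K, E⟩ := exists_ex H
  have hR := H.hR
  have hK := E.hK
  have hp := H.hp
  obtain ⟨M1, hM1, b1⟩ := bdd_away (T' := T - 1) hR (by linarith) H.cu
  obtain ⟨M2, hM2, b2⟩ := bdd_away (T' := T - 1) hR (by linarith) H.cux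
  have hU := U_nonneg hp hR.le
  have k0 : 0 < K*R^2 := by positivity
  have k1 : 0 < K*R := by positivity
  refine ⟨M1+M2+U p R+K*R^2+K*R, by linarith, fun x y hx hy hyR => ?_⟩
  by_cases hc : R ≤ |x| ∨ R ≤ y
  · have hc' : R ≤ |x| ∨ R ≤ y ∨ T ≤ T - 1 := by tauto
    have a1 := b1 x y T hx hy.le hyR H.hT.le le_rfl hc'
    have a2 := b2 x y T hx hy.le hyR H.hT.le le_rfl hc'
    constructor
    · linarith [le_abs_self (u x y T)]
    · linarith
  · push Not at hc
    have he : ed R T1 T x y T := ⟨hc.1.le, hy.le, hc.2.le, H.hT.le, le_rfl, fun h => hy.ne' h.2.1⟩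
    have a1 : u x y T ≤ U p y + K*y^2 := by
      by_cases hx0 : x = 0
      · rw [hx0]; exact uT0 H E hy hc.2.le
      · exact F4u' H E ⟨hc.1.le, H.hT.le, le_rfl, fun h => hx0 h.1⟩ y ⟨hy.le, hc.2.le⟩
    have a2 := U_mono hp hy.le hc.2.le
    have a3 : K*y^2 ≤ K*R^2 := by have := hc.2.le; gcongr
    have a4 := E.hux he
    have a5 : K*|x| ≤ K*R := by have := hc.1.le; gcongr
    constructor <;> linarith
end


lemma mkDat (p L T : ℝ) (hp : 2 < p) (hp3 : p ≤ 3)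
    (hL : 0 < L) (hT : 0 < T) (u : ℝ → ℝ → ℝ → ℝ)
    (hsol : ClassicalSolution p L T u) (hgbu : IsolatedGBU L T u)
    (hext : ExtC21 L T u) (hmon : MonCond L T u) :
    Dat p (L/4) (T/2) T u (pdx u) (pdy u) (pdt u) (pdxx u) (pdyy u) := by
  have hc : ∀ ⦃x y t⦄, dom (L/4) (T/2) T x y t → C21At u x y t := fun x y t h =>
    hext (by linarith [h.1]) ⟨h.2.1, by linarith [h.2.2.1]⟩ ⟨h.2.2.2.1, h.2.2.2.2.1⟩ h.2.2.2.2.2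
  have hg : ∀ x y t, gradNorm u x y t ^ p = ((pdx u x y t)^2 + (pdy u x y t)^2)^(p/2) := by
    intro x y t
    unfold gradNorm
    rw [Real.sqrt_eq_rpow, ← rpow_mul (by positivity)]
    congr 1; ring
  refine ⟨hp, hp3, by linarith, by linarith, ?_, ?_, ?_, ?_, ?_, ?_, ?_, ?_, ?_, ?_, ?_, ?_⟩
  · intro x y t h
    obtain ⟨h1, h2, h3, h4, h5, -⟩ := hc h
    exact ⟨h1.hasDerivAt, h2.hasDerivAt, h3.hasDerivAt, h4.hasDerivAt, h5.hasDerivAt⟩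
  · intro x y t h
    obtain ⟨-, -, -, -, -, -, h1, h2, h3, h4, h5, h6, -⟩ := hc h
    exact h1
  · intro x y t h
    obtain ⟨-, -, -, -, -, -, h1, h2, h3, h4, h5, h6, -⟩ := hc h
    exact h2
  · intro x y t h
    obtain ⟨-, -, -, -, -, -, h1, h2, h3, h4, h5, h6, -⟩ := hc h
    exact h3
  · intro x y t h
    obtain ⟨-, -, -, -, -, -, h1, h2, h3, h4, h5, h6, -⟩ := hc h
    exact h4
  · intro x y t h
    obtain ⟨-, -, -, -, -, -, h1, h2, h3, h4, h5, h6, -⟩ := hc h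
    exact h5
  · intro x y t h
    obtain ⟨-, -, -, -, -, -, h1, h2, h3, h4, h5, h6, -⟩ := hc h
    exact h6
  · intro x y t h hy ht
    rw [← hg]
    exact hsol.pde (by linarith [h.1]) ⟨hy, by linarith [h.2.2.1]⟩ ⟨by linarith [h.2.2.2.1], ht⟩
  · intro x t hx h1 h2
    exact hsol.bc (by linarith) ⟨by linarith, h2⟩
  · intro x y t h ht
    exact hsol.nonneg (by linarith [h.1]) ⟨h.2.1, by linarith [h.2.2.1]⟩ ⟨by linarith [h.2.2.2.1], ht⟩
  · intro x y t h hy ht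
    exact hmon (by linarith [h.1]) ⟨hy, by linarith [h.2.2.1]⟩ ⟨by linarith [h.2.2.2.1], ht⟩
  · intro M δ hδ
    obtain ⟨x, y, t, h1, h2, h3, h4, h5, h6, h7⟩ := hgbu.blowup (|M|+1) (min δ (min (L/4) (T/4)))
      (lt_min hδ (lt_min (by linarith) (by linarith)))
    have m1 := min_le_left δ (min (L/4) (T/4))
    have m2 := (min_le_right δ (min (L/4) (T/4))).trans (min_le_left _ _)
    have m3 := (min_le_right δ (min (L/4) (T/4))).trans (min_le_right _ _)
    rw [abs_of_nonneg h2.1] at h5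
    refine ⟨x, y, t, ⟨by linarith, h2.1, by linarith, by linarith, h3.2.le, fun h => by linarith [h3.2, h.2.2]⟩,
      by linarith, by linarith, by linarith, h3.2, ?_⟩
    have e : (gradNorm u x y t)^2 = (pdx u x y t)^2 + (pdy u x y t)^2 := by
      unfold gradNorm
      exact Real.sq_sqrt (by positivity)
    rw [← e]
    nlinarith [abs_nonneg M, le_abs_self M]

/-- Theorem 1.1: the final gradient blow-up profile near an isolated boundary
singularity, for `2 < p ≤ 3`. Here `β = 1/(p-1)` and `d_p = β^β`. -/
theorem final_gbu_profile (p L T : ℝ) (hp : 2 < p) (hp3 : p ≤ 3)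
    (hL : 0 < L) (hT : 0 < T) (u : ℝ → ℝ → ℝ → ℝ)
    (hsol : ClassicalSolution p L T u) (hgbu : IsolatedGBU L T u)
    (hext : ExtC21 L T u) (hmon : MonCond L T u) :
    ∃ C₁ C₂ C₃ ρ : ℝ, 0 < C₁ ∧ 0 < C₂ ∧ 0 < C₃ ∧ 0 < ρ ∧ ρ < L ∧
      (∀ x y : ℝ, |x| ≤ ρ → y ∈ Icc (0:ℝ) ρ → ¬(x = 0 ∧ y = 0) →
        ((1/(p-1) : ℝ) ^ (1/(p-1))) *
            (y + C₁ * |x| ^ (2*(p-1)/(p-2))) ^ (-(1/(p-1))) - C₃ ≤ pdy u x y T ∧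
          pdy u x y T ≤
            ((1/(p-1) : ℝ) ^ (1/(p-1))) *
              (y + C₂ * |x| ^ (2*(p-1)/(p-2))) ^ (-(1/(p-1))) + C₃) ∧
      (∃ C₄ C₅ : ℝ, 0 < C₄ ∧ 0 < C₅ ∧ ∀ x : ℝ, 0 < |x| → |x| ≤ ρ →
        C₄ * |x| ^ (-(2/(p-2))) ≤ pdy u x 0 T ∧ pdy u x 0 T ≤ C₅ * |x| ^ (-(2/(p-2)))) ∧
      (∃ C : ℝ, 0 < C ∧ ∀ x y : ℝ, |x| < L/2 → y ∈ Ioo (0:ℝ) (L/2) →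
        u x y T ≤ C ∧ |pdx u x y T| ≤ C) := by
  have H := mkDat p L T hp hp3 hL hT u hsol hgbu hext hmon
  obtain ⟨C1, hC1, C2, hC2, C3, hC3, r, hr, hrR, hprof⟩ := profile H
  obtain ⟨C, hC, hub⟩ := ubd H
  have hdp := dp_pos hp
  have hb0 := bt_pos hp
  have hp2 : 0 < p - 2 := by linarith
  have hp1 : 0 < p - 1 := by linarith
  have hm : ∀ x : ℝ, (x^2)^((p-1)/(p-2)) = |x|^(2*(p-1)/(p-2)) := by
    intro x
    rw [← sq_abs, ← rpow_natCast, ← rpow_mul (abs_nonneg x)]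
    congr 1; push_cast; ring
  have hW0 : ∀ c x : ℝ, 0 < c → 0 < |x| → W p (0 + c*(x^2)^((p-1)/(p-2))) =
      bt p^bt p*c^(-bt p)*|x|^(-(2/(p-2))) := by
    intro c x hc hx
    rw [hm, zero_add]
    unfold W
    rw [mul_rpow hc.le (by positivity), ← rpow_mul hx.le]
    rw [show 2*(p-1)/(p-2)*(-bt p) = -(2/(p-2)) by unfold bt; field_simp]
    ring
  have hA1 : 0 < bt p^bt p*C1^(-bt p) := by positivity
  have hA2 : 0 < bt p^bt p*C2^(-bt p) := by positivity
  obtain ⟨r1, hr1, hsm⟩ := small_pow (e := 2/(p-2)) (c := bt p^bt p*C1^(-bt p)/(2*C3)) (by positivity)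
    (by positivity)
  obtain ⟨ρ, hρ, m1, m2, m3⟩ : ∃ ρ > 0, ρ ≤ r ∧ ρ ≤ r1 ∧ ρ ≤ 1 :=
    ⟨min r (min r1 1), lt_min hr (lt_min hr1 one_pos), by simp, by simp, by simp⟩
  refine ⟨C1, C2, C3, ρ, hC1, hC2, hC3, hρ, by linarith, ?_, ?_, ?_⟩
  · intro x y hx hy hxy
    have := hprof x y (by linarith) hy.1 (by linarith [hy.2]) hxy
    rw [hm] at this
    exact this
  · refine ⟨bt p^bt p*C1^(-bt p)/2, bt p^bt p*C2^(-bt p) + C3, by linarith, by linarith, ?_⟩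
    intro x hx0 hx
    have := hprof x 0 (by linarith) le_rfl hr.le (fun h => by rw [h.1, abs_zero] at hx0; exact lt_irrefl _ hx0)
    rw [hW0 C1 x hC1 hx0, hW0 C2 x hC2 hx0] at this
    obtain ⟨h1, h2⟩ := this
    have hZ : 0 < |x|^(-(2/(p-2))) := rpow_pos_of_pos hx0 _
    have hZ' : |x|^(2/(p-2))*|x|^(-(2/(p-2))) = 1 := by
      rw [← rpow_add hx0, add_neg_cancel, rpow_zero]
    have hs := hsm |x| hx0.le (by linarith)
    rw [le_div_iff₀ (by positivity)] at hs
    have hs1 := mul_le_mul_of_nonneg_right hs hZ.le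
    have e1 : |x|^(2/(p-2))*(2*C3)*|x|^(-(2/(p-2))) = 2*C3 := by
      rw [mul_right_comm, hZ', one_mul]
    rw [e1] at hs1
    have hZ1 : 1 ≤ |x|^(-(2/(p-2))) :=
      one_le_rpow_of_pos_of_le_one_of_nonpos hx0 (by linarith) (by
        have : 0 < 2/(p-2) := by positivity
        linarith)
    have hs2 := mul_le_mul_of_nonneg_left hZ1 hC3.le
    constructor
    · linarith
    · linarith
  · exact ⟨C, hC, fun x y hx hy => hub x y (by linarith) hy.1 (by linarith [hy.2])⟩
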